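/- For a combinatorial pseudo-triangulation G with non-degenerate faces, the following are equivalent: (i) G can be stretched to become a pseudo-triangulation realizing the given assignment of big and small angles; (ii) every subgraph of G with at least three vertices has at least three corners. -/

import Mathlib

/-! ## Combinatorial plane graphs via rotation systems -/

/-- The permutation of darts of a simple graph reversing each dart. -/
def dartSymmPerm {V : Type} (G : SimpleGraph V) : Equiv.Perm G.Dart where
  toFun := SimpleGraph.Dart.symm
  invFun := SimpleGraph.Dart.symm
  left_inv d := SimpleGraph.Dart.symm_symm d
  right_inv d := SimpleGraph.Dart.symm_symm d

/-- The setoid on `α` whose classes are the cycles (orbits) of a permutation `σ`. -/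
def faceSetoid {α : Type} (σ : Equiv.Perm α) : Setoid α :=
  ⟨σ.SameCycle, ⟨fun x => Equiv.Perm.SameCycle.refl σ x,
    fun h => h.symm, fun h h' => h.trans h'⟩⟩

/-- A (topological, non-crossing) embedding of a connected graph `G` in the plane, encoded
combinatorially: a rotation system (the counterclockwise cyclic order of the darts around
each vertex), which is planar in the sense of Euler's formula (the number of orbits of the
face permutation `rot * symm` is the number of faces), together with a distinguished
outer (unbounded) face.  A *plane graph* is a graph `G` together with such a structure. -/
structure PlaneEmb {V : Type} (G : SimpleGraph V) where
  rot : Equiv.Perm G.Dart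
  rot_fst : ∀ d : G.Dart, (rot d).fst = d.fst
  rot_vertex : ∀ d d' : G.Dart, d.fst = d'.fst → ∃ n : ℕ, (rot ^ n) d = d'
  connected : G.Connected
  outer : Quotient (faceSetoid (rot * dartSymmPerm G))
  euler : Nat.card V + Nat.card (Quotient (faceSetoid (rot * dartSymmPerm G)))
      = Nat.card G.edgeSet + 2

namespace PlaneEmb

variable {V : Type} {G : SimpleGraph V}

/-- The faces of a plane graph: orbits of the face permutation. -/
abbrev Face (E : PlaneEmb G) : Type := Quotient (faceSetoid (E.rot * dartSymmPerm G))

/-- The face having the dart `d` on its contour. -/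
def dartFace (E : PlaneEmb G) (d : G.Dart) : E.Face :=
  Quotient.mk (faceSetoid (E.rot * dartSymmPerm G)) d

/-- Each dart `d` determines an *angle* of the plane graph, namely the angle at the vertex
`d.fst` between the edges of `d` and `rot d`; `E.angleFace d` is the face this angle lies in. -/
def angleFace (E : PlaneEmb G) (d : G.Dart) : E.Face :=
  Quotient.mk (faceSetoid (E.rot * dartSymmPerm G)) d.symm

end PlaneEmb

/-- A vertex is *pointed* (w.r.t. an assignment `big` of which angles are labelled big)
if some angle at it is labelled big. -/
def PointedVx {V : Type} {G : SimpleGraph V} (big : G.Dart → Prop) (v : V) : Prop :=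
  ∃ d : G.Dart, big d ∧ d.fst = v

/-- A *combinatorial pseudo-triangulation labelling* (CPT-labelling): every bounded face has
exactly three small angles, all angles of the unbounded face are big, and no vertex is
incident to more than one big angle. -/
structure IsCPTLabelling {V : Type} {G : SimpleGraph V} (E : PlaneEmb G)
    (big : G.Dart → Prop) : Prop where
  bounded_small : ∀ F : E.Face, F ≠ E.outer →
    Nat.card {d : G.Dart | E.angleFace d = F ∧ ¬ big d} = 3
  outer_big : ∀ d : G.Dart, E.angleFace d = E.outer → big d
  one_big : ∀ d d' : G.Dart, big d → big d' → d.fst = d'.fst → d = d'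

/-- The generalized Laman property of a combinatorial pseudo-triangulation: any `x` non-pointed
plus `y` pointed vertices, with `x + y ≥ 2`, induce at most `3x + 2y - 3` edges. -/
def GenLaman {V : Type} (G : SimpleGraph V) (big : G.Dart → Prop) : Prop :=
  ∀ S : Set V, 2 ≤ Nat.card S →
    (Nat.card ((G.induce S).edgeSet) : ℤ) ≤
      3 * Nat.card {v ∈ S | ¬ PointedVx big v} + 2 * Nat.card {v ∈ S | PointedVx big v} - 3

/-! ## Rigidity -/

/-- Dot product in the plane. -/
def dot2 (u w : ℝ × ℝ) : ℝ := u.1 * w.1 + u.2 * w.2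

/-- Rotation by 90 degrees. -/
def rot90 (u : ℝ × ℝ) : ℝ × ℝ := (-u.2, u.1)

/-- `q` is an infinitesimal motion of the bar-and-joint framework `(G, p)`. -/
def IsInfMotion {V : Type} (G : SimpleGraph V) (p q : V → ℝ × ℝ) : Prop :=
  ∀ u v : V, G.Adj u v → dot2 (p u - p v) (q u - q v) = 0

/-- Trivial infinitesimal motions: those coming from rigid motions of the plane
(infinitesimal rotations and translations). -/
def IsTrivialMotion {V : Type} (p q : V → ℝ × ℝ) : Prop :=
  ∃ (a : ℝ) (t : ℝ × ℝ), ∀ v : V, q v = a • rot90 (p v) + t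

/-- The framework `(G, p)` is infinitesimally rigid: it has no non-trivial infinitesimal
motions. -/
def InfRigid {V : Type} (G : SimpleGraph V) (p : V → ℝ × ℝ) : Prop :=
  ∀ q : V → ℝ × ℝ, IsInfMotion G p q → IsTrivialMotion p q

/-- A configuration of points is *generic* if its coordinates are algebraically
independent over `ℚ`. -/
def GenericConf {V : Type} (p : V → ℝ × ℝ) : Prop :=
  AlgebraicIndependent ℚ (fun x : V ⊕ V => Sum.elim (fun v => (p v).1) (fun v => (p v).2) x)

/-- A graph is *generically rigid in the plane* if every generic framework on it has no
non-trivial infinitesimal motions. -/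
def GenRigid {V : Type} (G : SimpleGraph V) : Prop :=
  ∀ p : V → ℝ × ℝ, GenericConf p → InfRigid G p

/-- A graph is *isostatic* (generically minimally rigid) if it is generically rigid and
removing any edge destroys generic rigidity. -/
def Isostatic {V : Type} (G : SimpleGraph V) : Prop :=
  GenRigid G ∧ ∀ e ∈ G.edgeSet, ¬ GenRigid (G.deleteEdges {e})

/-- Laman's condition: exactly `2n - 3` edges, and every `k ≥ 2` vertices span at most
`2k - 3` edges. -/
def LamanGraph {V : Type} (L : SimpleGraph V) : Prop :=
  (Nat.card L.edgeSet : ℤ) = 2 * Nat.card V - 3 ∧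
  ∀ S : Set V, 2 ≤ Nat.card S →
    (Nat.card ((L.induce S).edgeSet) : ℤ) ≤ 2 * Nat.card S - 3

/-! ## Geometry: straight-line drawings, angles, stretching -/

/-- The counterclockwise angle from the direction `u` to the direction `w`,
normalized to lie in `(0, 2π]` (a full turn for `w` pointing in the direction of `u`). -/
noncomputable def ccwAngle (u w : ℝ × ℝ) : ℝ :=
  if 0 < Complex.arg ((⟨w.1, w.2⟩ : ℂ) / (⟨u.1, u.2⟩ : ℂ)) then
    Complex.arg ((⟨w.1, w.2⟩ : ℂ) / (⟨u.1, u.2⟩ : ℂ))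
  else Complex.arg ((⟨w.1, w.2⟩ : ℂ) / (⟨u.1, u.2⟩ : ℂ)) + 2 * Real.pi

/-- The (counterclockwise) geometric angle, in the straight-line drawing `p`, of the angle of
the dart `d`, i.e. the angle at `d.fst` between the edge of `d` and the edge of `rot d`. -/
noncomputable def dartAngle {V : Type} {G : SimpleGraph V} (E : PlaneEmb G)
    (p : V → ℝ × ℝ) (d : G.Dart) : ℝ :=
  ccwAngle (p d.snd - p d.fst) (p (E.rot d).snd - p (E.rot d).fst)

/-- A straight-line drawing is non-crossing: distinct edges meet only in common endpoints,
and no vertex lies on an edge not incident to it. -/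
def NonCrossing {V : Type} (G : SimpleGraph V) (p : V → ℝ × ℝ) : Prop :=
  (∀ a b c d : V, G.Adj a b → G.Adj c d → ({a, b} : Set V) ≠ {c, d} →
    segment ℝ (p a) (p b) ∩ segment ℝ (p c) (p d) ⊆ p '' ({a, b} ∩ {c, d} : Set V)) ∧
  (∀ x a b : V, G.Adj a b → x ≠ a → x ≠ b → p x ∉ segment ℝ (p a) (p b))

/-- The points of the drawing are in general position: no three of them are collinear. -/
def GenPos {V : Type} (p : V → ℝ × ℝ) : Prop :=
  ∀ u v w : V, u ≠ v → u ≠ w → v ≠ w → ¬ Collinear ℝ ({p u, p v, p w} : Set (ℝ × ℝ))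

/-- The straight-line drawing `p` realizes the plane graph `(G, E)`: it is injective and
non-crossing, and around every (non-isolated) vertex the counterclockwise angles between
rotation-consecutive darts sum to `2π`, so the drawing induces the given rotation system. -/
def RealizesEmb {V : Type} [Fintype V] [DecidableEq V] (G : SimpleGraph V)
    [DecidableRel G.Adj] (E : PlaneEmb G) (p : V → ℝ × ℝ) : Prop :=
  Function.Injective p ∧ NonCrossing G p ∧
  ∀ v : V, (∃ d : G.Dart, d.fst = v) →
    ∑ d ∈ Finset.univ.filter (fun d : G.Dart => d.fst = v), dartAngle E p d = 2 * Real.pi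

/-- The drawing `p` *stretches* the angle labelling `big` of the plane graph `(G, E)`:
it realizes the embedding, has its (finitely many) vertices in general position, and every
angle labelled big is reflex (> 180°) while every angle labelled small is convex (< 180°).
If `big` is a CPT-labelling this makes `p` a pseudo-triangulation of its vertex set:
every bounded face is a pseudo-triangle and the convex hull edges are present. -/
def Stretches {V : Type} [Fintype V] [DecidableEq V] (G : SimpleGraph V)
    [DecidableRel G.Adj] (E : PlaneEmb G) (big : G.Dart → Prop) (p : V → ℝ × ℝ) : Prop :=
  RealizesEmb G E p ∧ GenPos p ∧
  ∀ d : G.Dart, (big d → Real.pi < dartAngle E p d) ∧ (¬ big d → dartAngle E p d < Real.pi)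

/-- The drawing `p` makes the plane graph `(G, E)` a pseudo-triangulation of its vertex set
(with the given embedding): for the labelling of the angles of the drawing as big (reflex)
or small (convex), every bounded face has exactly three small angles (is a pseudo-triangle)
and all outer angles are big (so the convex hull edges are present). -/
def StretchesToPT {V : Type} [Fintype V] [DecidableEq V] (G : SimpleGraph V)
    [DecidableRel G.Adj] (E : PlaneEmb G) (p : V → ℝ × ℝ) : Prop :=
  ∃ big : G.Dart → Prop, IsCPTLabelling E big ∧ Stretches G E big p

/-- A vertex `v` of a geometric straight-line drawing is *pointed* if all the edges at `v`
lie in a closed half-plane supported at `v`. -/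
def GeoPointed {V : Type} (G : SimpleGraph V) (p : V → ℝ × ℝ) (v : V) : Prop :=
  ∃ u : ℝ × ℝ, u ≠ 0 ∧ ∀ w : V, G.Adj v w → 0 ≤ dot2 u (p w - p v)

/-! ## Subgraphs, outer face, corners -/

/-- One step of dual connectivity avoiding the edge set `A`: the faces `F`, `F'` are the two
sides of some edge of `G` not belonging to `A`. -/
def FaceStep {V : Type} {G : SimpleGraph V} (E : PlaneEmb G) (A : Set (Sym2 V)) :
    E.Face → E.Face → Prop :=
  fun F F' => ∃ d : G.Dart, E.dartFace d = F ∧ E.dartFace d.symm = F' ∧ d.edge ∉ A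

/-- The face `F` of `G` is contained in the outer (unbounded) face of the plane subgraph of
`G` with edge set `A`: `F` can reach the outer face of `G` in the dual graph without
crossing the edges of `A`. -/
def InOuterOf {V : Type} {G : SimpleGraph V} (E : PlaneEmb G) (A : Set (Sym2 V))
    (F : E.Face) : Prop :=
  Relation.ReflTransGen (FaceStep E A) F E.outer

/-- `v` is a *corner* of the subgraph `H` of the combinatorial pseudo-triangulation
`(G, E, big)`: either `v` is pointed in `G` and its big angle is contained in the
outer face of `H`, or `v` is non-pointed in `G` and two consecutive (small) angles at `v`
are contained in the outer face of `H`. -/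
def IsCPTCorner {V : Type} {G : SimpleGraph V} (E : PlaneEmb G) (big : G.Dart → Prop)
    (H : G.Subgraph) (v : V) : Prop :=
  (v ∈ H.verts ∧ ∃ d : G.Dart, big d ∧ d.fst = v ∧ InOuterOf E H.edgeSet (E.angleFace d)) ∨
  (v ∈ H.verts ∧ ¬ PointedVx big v ∧ ∃ d : G.Dart, d.fst = v ∧
    InOuterOf E H.edgeSet (E.angleFace d) ∧ InOuterOf E H.edgeSet (E.angleFace (E.rot d)) ∧
    (E.rot d).edge ∉ H.edgeSet)

/-- A plane graph has *non-degenerate faces* if no edge appears twice on the contour cycle of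
a face, i.e. the edges incident to every face form a simple closed cycle. -/
def NonDegenerateFaces {V : Type} {G : SimpleGraph V} (E : PlaneEmb G) : Prop :=
  ∀ d : G.Dart, ¬ (E.rot * dartSymmPerm G).SameCycle d d.symm


set_option linter.unusedSectionVars false
set_option linter.unusedSimpArgs false

section Harm
variable {X : Type} [Fintype X] [DecidableEq X]

def Inact (out : X → Finset X) (bd : X → Prop) (K : Finset X) (x : X) : Prop :=
  x ∈ K ∧ ¬ bd x ∧ out x ⊆ K

def TriP (out : X → Finset X) (bd : X → Prop) : Prop :=
  ∀ K : Finset X, (∃ x, Inact out bd K x) → ∃ a b c, a ∈ K ∧ b ∈ K ∧ c ∈ K ∧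
    a ≠ b ∧ a ≠ c ∧ b ≠ c ∧ ¬ Inact out bd K a ∧ ¬ Inact out bd K b ∧ ¬ Inact out bd K c

def Strad (out : X → Finset X) (g : X → ℝ) (x : X) : Prop :=
  (∃ o ∈ out x, g o < g x) ∧ ∃ o ∈ out x, g x < g o

def HGood (out : X → Finset X) (bd : X → Prop) (L : Finset X) (g : X → ℝ) : Prop :=
  Set.InjOn g (L : Set X) ∧ ∀ x, Inact out bd L x → Strad out g x

theorem harm_max {out : X → Finset X} {bd : X → Prop} (hP : TriP out bd) (L : Finset X)
    (g : X → ℝ) (h0 : ∀ x, ¬ Inact out bd L x → g x ≤ 0)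
    (h1 : ∀ x, Inact out bd L x → ∑ o ∈ out x, (g o - g x) = 0) : ∀ x, g x ≤ 0 := by
  classical
  by_contra hcon
  push Not at hcon
  obtain ⟨x0, hx0⟩ := hcon
  obtain ⟨m, -, hm⟩ := Finset.exists_max_image Finset.univ g ⟨x0, Finset.mem_univ _⟩
  have hM : 0 < g m := lt_of_lt_of_le hx0 (hm x0 (Finset.mem_univ _))
  let K := Finset.univ.filter (fun x => g x = g m)
  have hK : ∀ x ∈ K, Inact out bd K x := by
    intro x hx
    have hgx : g x = g m := by simpa [K] using hx
    have hin : Inact out bd L x := by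
      by_contra h; have := h0 x h; linarith
    refine ⟨hx, hin.2.1, ?_⟩
    intro o ho
    have hs := h1 x hin
    have := (Finset.sum_eq_zero_iff_of_nonpos (s := out x) (f := fun o => g o - g x)
      (by intro i _; have := hm i (Finset.mem_univ _); linarith)).1 hs o ho
    simp only [K, Finset.mem_filter, Finset.mem_univ, true_and]
    linarith
  obtain ⟨a, b, c, ha, -, -, -, -, -, hna, -⟩ := hP K ⟨m, hK m (by simp [K])⟩
  exact hna (hK a ha)

theorem harm_exists {out : X → Finset X} {bd : X → Prop} (hP : TriP out bd) (L : Finset X) :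
    ∃ Φ : (X → ℝ) →ₗ[ℝ] (X → ℝ), (∀ φ x, ¬ Inact out bd L x → Φ φ x = φ x) ∧
      ∀ φ x, Inact out bd L x → ∑ o ∈ out x, (Φ φ o - Φ φ x) = 0 := by
  classical
  let T : (X → ℝ) →ₗ[ℝ] (X → ℝ) :=
    { toFun := fun g x => if Inact out bd L x then ∑ o ∈ out x, (g o - g x) else g x
      map_add' := by
        intro g h; ext x
        by_cases hx : Inact out bd L x
        · simp only [hx, if_true, Pi.add_apply]
          rw [← Finset.sum_add_distrib]; apply Finset.sum_congr rfl; intros; ring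
        · simp [hx]
      map_smul' := by
        intro r g; ext x
        by_cases hx : Inact out bd L x
        · simp only [hx, if_true, Pi.smul_apply, smul_eq_mul, RingHom.id_apply]
          rw [Finset.mul_sum]; apply Finset.sum_congr rfl; intros; ring
        · simp [hx] }
  have hT1 : ∀ g x, Inact out bd L x → T g x = ∑ o ∈ out x, (g o - g x) := by
    intro g x hx; simp [T, hx]
  have hT2 : ∀ g x, ¬ Inact out bd L x → T g x = g x := by
    intro g x hx; simp [T, hx]
  have hinj : Function.Injective T := by
    rw [injective_iff_map_eq_zero]
    intro g hg
    have e1 : ∀ x, Inact out bd L x → ∑ o ∈ out x, (g o - g x) = 0 := by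
      intro x hx; rw [← hT1 g x hx, hg]; rfl
    have e2 : ∀ x, ¬ Inact out bd L x → g x = 0 := by
      intro x hx; rw [← hT2 g x hx, hg]; rfl
    have u1 := harm_max hP L g (fun x hx => (e2 x hx).le) e1
    have u2 := harm_max hP L (fun x => - g x) (fun x hx => by simp [e2 x hx]) (by
      intro x hx
      have := e1 x hx
      calc ∑ o ∈ out x, (- g o - - g x) = - ∑ o ∈ out x, (g o - g x) := by
            rw [← Finset.sum_neg_distrib]; apply Finset.sum_congr rfl; intros; ring
        _ = 0 := by rw [this]; simp)
    ext x
    have a := u1 x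
    have b := u2 x
    simp only [Pi.zero_apply]
    linarith
  let e := LinearEquiv.ofInjectiveEndo T hinj
  let cut : (X → ℝ) →ₗ[ℝ] (X → ℝ) :=
    { toFun := fun g x => if Inact out bd L x then 0 else g x
      map_add' := by intro g h; ext x; by_cases hx : Inact out bd L x <;> simp [hx]
      map_smul' := by intro r g; ext x; by_cases hx : Inact out bd L x <;> simp [hx] }
  have he : ∀ φ, T (e.symm (cut φ)) = cut φ := fun φ => e.apply_symm_apply (cut φ)
  refine ⟨e.symm.toLinearMap ∘ₗ cut, ?_, ?_⟩
  · intro φ x hx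
    have := hT2 (e.symm (cut φ)) x hx
    rw [he] at this
    simp only [LinearMap.comp_apply, LinearEquiv.coe_coe]
    rw [← this]; simp [cut, hx]
  · intro φ x hx
    have := hT1 (e.symm (cut φ)) x hx
    rw [he] at this
    simp only [LinearMap.comp_apply, LinearEquiv.coe_coe]
    rw [← this]; simp [cut, hx]

theorem eps_exists (g0 g1 : X → ℝ) : ∃ ε : ℝ, 0 < ε ∧
    ∀ x y, g0 x < g0 y → g0 x + ε * g1 x < g0 y + ε * g1 y := by
  have : ∀ᶠ ε : ℝ in nhdsWithin 0 (Set.Ioi 0), ∀ x y, g0 x < g0 y →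
      g0 x + ε * g1 x < g0 y + ε * g1 y := by
    rw [Filter.eventually_all]; intro x
    rw [Filter.eventually_all]; intro y
    by_cases h : g0 x < g0 y
    · have hc1 : Continuous (fun ε : ℝ => g0 x + ε * g1 x) := by fun_prop
      have hc2 : Continuous (fun ε : ℝ => g0 y + ε * g1 y) := by fun_prop
      have := (hc1.tendsto 0).eventually_lt (hc2.tendsto 0) (by simpa using h)
      exact (this.filter_mono nhdsWithin_le_nhds).mono (fun ε h _ => h)
    · exact Filter.Eventually.of_forall (fun _ h' => absurd h' h)
  obtain ⟨ε, h1, h2⟩ := (this.and self_mem_nhdsWithin).exists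
  exact ⟨ε, h2, h1⟩

theorem harm_refine {out : X → Finset X} {bd : X → Prop} (L : Finset X) (g0 : X → ℝ)
    (hw : ∀ x, Inact out bd L x → (∀ o ∈ out x, g0 o = g0 x) ∨ Strad out g0 x)
    (hS : ∀ t : ℝ, ∃ g, HGood out bd (L.filter (fun x => g0 x = t)) g)
    (t0 : ℝ) (g' : X → ℝ) (hg' : HGood out bd (L.filter (fun x => g0 x = t0)) g') :
    ∃ g, HGood out bd L g ∧ (∀ x y, g0 x < g0 y → g x < g y) ∧
      ∀ x y, g0 x = t0 → g0 y = t0 → g' x < g' y → g x < g y := by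
  classical
  have hS' : ∀ t : ℝ, ∃ g, HGood out bd (L.filter (fun x => g0 x = t)) g ∧ (t = t0 → g = g') := by
    intro t
    by_cases h : t = t0
    · subst h; exact ⟨g', hg', fun _ => rfl⟩
    · obtain ⟨g, hg⟩ := hS t
      exact ⟨g, hg, fun h' => absurd h' h⟩
  choose Gc hGc hGt using hS'
  let g1 : X → ℝ := fun x => Gc (g0 x) x
  obtain ⟨ε, hε, hlt⟩ := eps_exists g0 g1
  refine ⟨fun x => g0 x + ε * g1 x, ⟨?_, ?_⟩, hlt, ?_⟩
  · intro x hx y hy hxy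
    rcases lt_trichotomy (g0 x) (g0 y) with h | h | h
    · have := hlt x y h; simp only at hxy; linarith
    · have h1 : g1 x = g1 y := by
        simp only at hxy
        have : ε * g1 x = ε * g1 y := by linarith
        exact mul_left_cancel₀ hε.ne' this
      simp only [g1, h] at h1
      exact (hGc (g0 y)).1 (by simpa [h] using hx) (by simpa using hy) h1
    · have := hlt y x h; simp only at hxy; linarith
  · intro x hx
    rcases hw x hx with h | h
    · have hin : Inact out bd (L.filter (fun y => g0 y = g0 x)) x := by
        refine ⟨by simp [hx.1], hx.2.1, ?_⟩
        intro o ho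
        simp [hx.2.2 ho, h o ho]
      obtain ⟨⟨o, ho, h1⟩, ⟨o', ho', h2⟩⟩ := (hGc (g0 x)).2 x hin
      refine ⟨⟨o, ho, ?_⟩, ⟨o', ho', ?_⟩⟩
      · simp only [g1, h o ho]
        have := mul_lt_mul_of_pos_left h1 hε; linarith
      · simp only [g1, h o' ho']
        have := mul_lt_mul_of_pos_left h2 hε; linarith
    · obtain ⟨⟨o, ho, h1⟩, ⟨o', ho', h2⟩⟩ := h
      exact ⟨⟨o, ho, hlt _ _ h1⟩, ⟨o', ho', hlt _ _ h2⟩⟩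
  · intro x y hx hy h
    have : g1 x < g1 y := by simp only [g1, hx, hy, hGt t0 rfl]; exact h
    have := mul_lt_mul_of_pos_left this hε
    simp only [hx, hy]; linarith

theorem exists_inj_real : ∃ g : X → ℝ, Function.Injective g ∧ ∀ x, 0 ≤ g x := by
  refine ⟨fun x => ((Fintype.equivFin X x : ℕ) : ℝ), ?_, fun x => by positivity⟩
  intro x y h
  have h' : ((Fintype.equivFin X x : ℕ) : ℝ) = ((Fintype.equivFin X y : ℕ) : ℝ) := h
  have : (Fintype.equivFin X x : ℕ) = (Fintype.equivFin X y : ℕ) := by exact_mod_cast h'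
  exact (Fintype.equivFin X).injective (Fin.ext this)

theorem weak_of_sum {out : X → Finset X} (g : X → ℝ) (x : X)
    (h : ∑ o ∈ out x, (g o - g x) = 0) : (∀ o ∈ out x, g o = g x) ∨ Strad out g x := by
  by_cases h1 : ∃ o ∈ out x, g o < g x
  · right
    refine ⟨h1, ?_⟩
    by_contra hc
    push Not at hc
    obtain ⟨o, ho, hlt⟩ := h1
    have := (Finset.sum_eq_zero_iff_of_nonpos (s := out x) (f := fun o => g o - g x)
      (by intro i hi; have := hc i hi; linarith)).1 h o ho
    linarith
  · left
    push Not at h1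
    intro o ho
    have := (Finset.sum_eq_zero_iff_of_nonneg (s := out x) (f := fun o => g o - g x)
      (by intro i hi; have := h1 i hi; linarith)).1 h o ho
    linarith

theorem harm_sep {out : X → Finset X} {bd : X → Prop} (hP : TriP out bd) :
    ∀ (n : ℕ) (L : Finset X), L.card = n → (∃ g, HGood out bd L g) ∧
      ∀ a ∈ L, ∀ b ∈ L, ∀ c ∈ L, a ≠ b → a ≠ c → b ≠ c →
        ∃ g, HGood out bd L g ∧ g a < g b ∧ g b < g c := by
  intro n
  induction n using Nat.strong_induction_on with
  | _ n ih =>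
  intro L hL
  by_cases hin : ∃ x, Inact out bd L x
  · obtain ⟨Φ, hΦ1, hΦ2⟩ := harm_exists hP L
    obtain ⟨y1, y2, y3, hy1, hy2, hy3, h12, h13, h23, n1, n2, n3⟩ := hP L hin
    have hw : ∀ δ, ∀ x, Inact out bd L x → (∀ o ∈ out x, Φ δ o = Φ δ x) ∨ Strad out (Φ δ) x :=
      fun δ x hx => weak_of_sum _ _ (hΦ2 δ x hx)
    have hcard : ∀ g0 : X → ℝ, (∃ u ∈ L, ∃ v ∈ L, g0 u ≠ g0 v) → ∀ t,
        (L.filter (fun x => g0 x = t)).card < n := by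
      rintro g0 ⟨u, hu, v, hv, huv⟩ t
      rw [← hL]
      apply Finset.card_lt_card
      refine ⟨Finset.filter_subset _ _, fun hsub => huv ?_⟩
      have a := (Finset.mem_filter.1 (hsub hu)).2
      have b := (Finset.mem_filter.1 (hsub hv)).2
      rw [a, b]
    have key : ∀ a ∈ L, ∀ b ∈ L, ∀ c ∈ L, a ≠ b → a ≠ c → b ≠ c →
        ∃ g, HGood out bd L g ∧ g a < g b ∧ g b < g c := by
      intro a ha b hb c hc hab hac hbc
      by_cases hex : ∃ δ, Φ δ a < Φ δ b ∧ Φ δ b < Φ δ c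
      · obtain ⟨δ, d1, d2⟩ := hex
        have hc' := hcard (Φ δ) ⟨a, ha, b, hb, d1.ne⟩
        have hS : ∀ t : ℝ, ∃ g, HGood out bd (L.filter (fun x => Φ δ x = t)) g :=
          fun t => (ih _ (hc' t) _ rfl).1
        obtain ⟨g', hg'⟩ := hS 0
        obtain ⟨g, hg, hlt, -⟩ := harm_refine L (Φ δ) (hw δ) hS 0 g' hg'
        exact ⟨g, hg, hlt _ _ d1, hlt _ _ d2⟩
      · -- dependent case
        have hdep : ∃ δ, Φ δ a = Φ δ b ∧ Φ δ b = Φ δ c ∧ ∃ u ∈ L, ∃ v ∈ L, Φ δ u ≠ Φ δ v := by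
          let p1 : (X → ℝ) → ℝ := fun δ => Φ δ b - Φ δ a
          let p2 : (X → ℝ) → ℝ := fun δ => Φ δ c - Φ δ b
          have l1 : ∀ (r s : ℝ) u v, p1 (r • u + s • v) = r * p1 u + s * p1 v := by
            intro r s u v; simp only [p1, map_add, map_smul, Pi.add_apply, Pi.smul_apply, smul_eq_mul]; ring
          have l2 : ∀ (r s : ℝ) u v, p2 (r • u + s • v) = r * p2 u + s * p2 v := by
            intro r s u v; simp only [p2, map_add, map_smul, Pi.add_apply, Pi.smul_apply, smul_eq_mul]; ring
          have hno : ∀ δ, ¬ (0 < p1 δ ∧ 0 < p2 δ) := by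
            rintro δ ⟨q1, q2⟩
            exact hex ⟨δ, by simp only [p1] at q1; linarith, by simp only [p2] at q2; linarith⟩
          have hdet : ∀ u v, p1 u * p2 v = p1 v * p2 u := by
            intro u v
            by_contra hne
            have hD : p1 u * p2 v - p1 v * p2 u ≠ 0 := sub_ne_zero.2 hne
            set D := p1 u * p2 v - p1 v * p2 u with hDdef
            apply hno (((p2 v - p1 v) / D) • u + ((p1 u - p2 u) / D) • v)
            have e1 : (p2 v - p1 v) / D * p1 u + (p1 u - p2 u) / D * p1 v = 1 := by
              field_simp; rw [hDdef]; ring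
            have e2 : (p2 v - p1 v) / D * p2 u + (p1 u - p2 u) / D * p2 v = 1 := by
              field_simp; rw [hDdef]; ring
            rw [l1, l2, e1, e2]; norm_num
          let u : X → ℝ := Pi.single y1 1
          let v : X → ℝ := Pi.single y2 1
          have hrs : ∃ r s : ℝ, (r ≠ 0 ∨ s ≠ 0) ∧ r * p1 u + s * p1 v = 0 ∧ r * p2 u + s * p2 v = 0 := by
            by_cases hA : p1 u = 0 ∧ p1 v = 0
            · by_cases hB : p2 u = 0 ∧ p2 v = 0
              · exact ⟨1, 0, Or.inl one_ne_zero, by rw [hA.1]; ring, by rw [hB.1]; ring⟩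
              · refine ⟨p2 v, - p2 u, ?_, by rw [hA.1, hA.2]; ring, by ring⟩
                by_contra hc; push Not at hc
                exact hB ⟨by linarith [hc.2], hc.1⟩
            · refine ⟨p1 v, - p1 u, ?_, by ring, ?_⟩
              · by_contra hc; push Not at hc
                exact hA ⟨by linarith [hc.2], hc.1⟩
              · have := hdet u v; linarith
          obtain ⟨r, s, hrs0, hr1, hr2⟩ := hrs
          refine ⟨r • u + s • v, ?_, ?_, ?_⟩
          · have := l1 r s u v; rw [hr1] at this; simp only [p1] at this; linarith
          · have := l2 r s u v; rw [hr2] at this; simp only [p2] at this; linarith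
          · have f1 : Φ (r • u + s • v) y1 = r := by
              rw [hΦ1 _ _ n1]; simp [u, v, Pi.single_apply, h12]
            have f2 : Φ (r • u + s • v) y2 = s := by
              rw [hΦ1 _ _ n2]; simp [u, v, Pi.single_apply, h12.symm]
            have f3 : Φ (r • u + s • v) y3 = 0 := by
              rw [hΦ1 _ _ n3]; simp [u, v, Pi.single_apply, h13.symm, h23.symm]
            rcases hrs0 with h | h
            · exact ⟨y1, hy1, y3, hy3, by rw [f1, f3]; exact h⟩
            · exact ⟨y2, hy2, y3, hy3, by rw [f2, f3]; exact h⟩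
        obtain ⟨δ, e1, e2, hnc⟩ := hdep
        have hc' := hcard (Φ δ) hnc
        have hS : ∀ t : ℝ, ∃ g, HGood out bd (L.filter (fun x => Φ δ x = t)) g :=
          fun t => (ih _ (hc' t) _ rfl).1
        obtain ⟨g', hg', q1, q2⟩ := (ih _ (hc' (Φ δ b)) _ rfl).2 a (by simp [ha, e1]) b
          (by simp [hb]) c (by simp [hc, e2]) hab hac hbc
        obtain ⟨g, hg, -, hlt⟩ := harm_refine L (Φ δ) (hw δ) hS (Φ δ b) g' hg'
        exact ⟨g, hg, hlt _ _ e1 rfl q1, hlt _ _ rfl e2.symm q2⟩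
    refine ⟨?_, key⟩
    obtain ⟨g, hg, -⟩ := key y1 hy1 y2 hy2 y3 hy3 h12 h13 h23
    exact ⟨g, hg⟩
  · obtain ⟨g, hg, hpos⟩ := exists_inj_real (X := X)
    refine ⟨⟨g, hg.injOn, fun x hx => absurd ⟨x, hx⟩ hin⟩, ?_⟩
    intro a ha b hb c hc hab hac hbc
    refine ⟨fun x => if x = a then -3 else if x = b then -2 else if x = c then -1 else g x,
      ⟨?_, fun x hx => absurd ⟨x, hx⟩ hin⟩, ?_, ?_⟩
    · intro x _ y _ hxy
      have px := hpos x
      have py := hpos y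
      simp only at hxy
      split_ifs at hxy <;> first | (subst_vars; rfl) | (exfalso; linarith) | (exact hg hxy)
    · simp [hab.symm]; norm_num
    · simp [hab.symm, hac.symm, hbc.symm]

/-- top level separation -/
theorem sep_top {out : X → Finset X} {bd : X → Prop} (hP : TriP out bd) (g0 : X → ℝ)
    (hw : ∀ x, ¬ bd x → ∑ o ∈ out x, (g0 o - g0 x) = 0) :
    (∃ g, HGood out bd Finset.univ g ∧ ∀ x y, g0 x < g0 y → g x < g y) ∧
    ∀ a b c, a ≠ b → a ≠ c → b ≠ c → g0 a = g0 b → g0 b = g0 c →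
      ∃ g, HGood out bd Finset.univ g ∧ (∀ x y, g0 x < g0 y → g x < g y) ∧ g a < g b ∧ g b < g c := by
  have hw' : ∀ x, Inact out bd Finset.univ x → (∀ o ∈ out x, g0 o = g0 x) ∨ Strad out g0 x :=
    fun x hx => weak_of_sum _ _ (hw x hx.2.1)
  have hS : ∀ t : ℝ, ∃ g, HGood out bd (Finset.univ.filter (fun x => g0 x = t)) g :=
    fun t => (harm_sep hP _ _ rfl).1
  constructor
  · obtain ⟨g', hg'⟩ := hS 0
    obtain ⟨g, hg, hlt, -⟩ := harm_refine Finset.univ g0 hw' hS 0 g' hg'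
    exact ⟨g, hg, hlt⟩
  · intro a b c hab hac hbc e1 e2
    obtain ⟨g', hg', q1, q2⟩ := (harm_sep hP _ (Finset.univ.filter (fun x => g0 x = g0 b)) rfl).2
      a (by simp [e1]) b (by simp) c (by simp [e2]) hab hac hbc
    obtain ⟨g, hg, hlt, hlt2⟩ := harm_refine Finset.univ g0 hw' hS (g0 b) g' hg'
    exact ⟨g, hg, hlt, hlt2 _ _ e1 rfl q1, hlt2 _ _ rfl e2.symm q2⟩

theorem sep_flip {out : X → Finset X} {bd : X → Prop} (hP : TriP out bd) (g0 : X → ℝ)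
    (hw : ∀ x, ¬ bd x → ∑ o ∈ out x, (g0 o - g0 x) = 0) (h : X → ℝ)
    (hh : HGood out bd Finset.univ h) (t : ℝ) :
    ∃ g, HGood out bd Finset.univ g ∧ (∀ x y, g0 x < g0 y → g x < g y) ∧
      ∀ x y, g0 x = t → g0 y = t → h x < h y → g y < g x := by
  have hw' : ∀ x, Inact out bd Finset.univ x → (∀ o ∈ out x, g0 o = g0 x) ∨ Strad out g0 x :=
    fun x hx => weak_of_sum _ _ (hw x hx.2.1)
  have hS : ∀ t : ℝ, ∃ g, HGood out bd (Finset.univ.filter (fun x => g0 x = t)) g :=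
    fun t => (harm_sep hP _ _ rfl).1
  obtain ⟨g, hg, hlt, hlt2⟩ := harm_refine Finset.univ g0 hw' hS t (fun x => - h x) (by
    constructor
    · intro x _ y _ hxy
      exact hh.1 (by simp) (by simp) (neg_injective hxy)
    · intro x hx
      obtain ⟨⟨o, ho, h1⟩, ⟨o', ho', h2⟩⟩ := hh.2 x ⟨by simp, hx.2.1, by simp⟩
      exact ⟨⟨o', ho', by simpa using h2⟩, ⟨o, ho, by simpa using h1⟩⟩)
  exact ⟨g, hg, hlt, fun x y hx hy hxy => hlt2 y x hy hx (by simpa using hxy)⟩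

end Harm


set_option linter.unusedSectionVars false
set_option linter.unusedSimpArgs false
set_option linter.unusedVariables false

section Comb
variable {V : Type} [Fintype V] [DecidableEq V] {G : SimpleGraph V} [DecidableRel G.Adj]

/-- next angle dart in the same face -/
def psi (E : PlaneEmb G) : Equiv.Perm G.Dart := dartSymmPerm G * E.rot

theorem psi_apply (E : PlaneEmb G) (d : G.Dart) : psi E d = (E.rot d).symm := rfl

theorem psi_fst (E : PlaneEmb G) (d : G.Dart) : (psi E d).fst = (E.rot d).snd := rfl

theorem psi_snd (E : PlaneEmb G) (d : G.Dart) : (psi E d).snd = d.fst := by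
  rw [psi_apply]; exact E.rot_fst d

theorem psi_symm_apply (E : PlaneEmb G) (d : G.Dart) : (psi E).symm d = E.rot.symm d.symm := by
  rw [Equiv.symm_apply_eq, psi_apply, Equiv.apply_symm_apply, SimpleGraph.Dart.symm_symm]

theorem rot_symm_fst (E : PlaneEmb G) (d : G.Dart) : (E.rot.symm d).fst = d.fst := by
  have := E.rot_fst (E.rot.symm d)
  rw [Equiv.apply_symm_apply] at this; exact this.symm

theorem psi_symm_fst (E : PlaneEmb G) (d : G.Dart) : ((psi E).symm d).fst = d.snd := by
  rw [psi_symm_apply, rot_symm_fst]; rfl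

theorem perm_closed {α : Type} [Finite α] (σ : Equiv.Perm α) (S : Set α) (x y : α)
    (hx : x ∈ S) (hS : ∀ z ∈ S, σ z ∈ S) (h : σ.SameCycle x y) : y ∈ S := by
  obtain ⟨n, hn⟩ := h.exists_nat_pow_eq
  rw [← hn]
  clear hn h
  induction n with
  | zero => simpa
  | succ k ih => rw [pow_succ', Equiv.Perm.mul_apply]; exact hS _ ih

theorem psi_conj (E : PlaneEmb G) (n : ℕ) (d : G.Dart) :
    ((psi E) ^ n) d = (((E.rot * dartSymmPerm G) ^ n) d.symm).symm := by
  induction n with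
  | zero => simp
  | succ k ih =>
    rw [pow_succ', Equiv.Perm.mul_apply, ih, pow_succ', Equiv.Perm.mul_apply]
    rfl

theorem angleFace_eq_iff (E : PlaneEmb G) (d d' : G.Dart) :
    E.angleFace d = E.angleFace d' ↔ (psi E).SameCycle d d' := by
  have : E.angleFace d = E.angleFace d' ↔ (E.rot * dartSymmPerm G).SameCycle d.symm d'.symm := by
    unfold PlaneEmb.angleFace
    exact Quotient.eq
  rw [this]
  constructor
  · intro h
    obtain ⟨n, hn⟩ := h.exists_nat_pow_eq
    refine ⟨n, ?_⟩
    rw [zpow_natCast, psi_conj, hn, SimpleGraph.Dart.symm_symm]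
  · intro h
    obtain ⟨n, hn⟩ := h.exists_nat_pow_eq
    refine ⟨n, ?_⟩
    rw [zpow_natCast, ← hn, psi_conj, SimpleGraph.Dart.symm_symm]

theorem angleFace_psi (E : PlaneEmb G) (d : G.Dart) : E.angleFace (psi E d) = E.angleFace d := by
  rw [angleFace_eq_iff]
  exact ⟨-1, by simp⟩

theorem angleFace_psi_symm (E : PlaneEmb G) (d : G.Dart) :
    E.angleFace ((psi E).symm d) = E.angleFace d := by
  have := angleFace_psi E ((psi E).symm d)
  rw [Equiv.apply_symm_apply] at this; exact this.symm

theorem dartFace_symm (E : PlaneEmb G) (d : G.Dart) : E.dartFace d.symm = E.angleFace d := rfl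
theorem angleFace_symm (E : PlaneEmb G) (d : G.Dart) : E.angleFace d.symm = E.dartFace d := by
  unfold PlaneEmb.angleFace PlaneEmb.dartFace; rw [SimpleGraph.Dart.symm_symm]

theorem angleFace_rot_symm (E : PlaneEmb G) (d : G.Dart) :
    E.angleFace ((E.rot d).symm) = E.angleFace d := angleFace_psi E d

theorem face_closed (E : PlaneEmb G) (S : Set G.Dart) (d d' : G.Dart) (hd : d ∈ S)
    (hS : ∀ z ∈ S, psi E z ∈ S) (h : E.angleFace d = E.angleFace d') : d' ∈ S :=
  perm_closed (psi E) S d d' hd hS ((angleFace_eq_iff E d d').1 h)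

theorem face_surj (E : PlaneEmb G) (F : E.Face) : ∃ d, E.angleFace d = F := by
  induction F using Quotient.inductionOn with
  | _ d => exact ⟨d.symm, by rw [angleFace_symm]; rfl⟩

theorem sides_ne {E : PlaneEmb G} (hnd : NonDegenerateFaces E) (d : G.Dart) :
    E.angleFace d ≠ E.angleFace d.symm := by
  intro h
  rw [angleFace_symm] at h
  have : (E.rot * dartSymmPerm G).SameCycle d.symm d := Quotient.eq.1 h
  exact hnd d this.symm

theorem rot_ne {E : PlaneEmb G} (hnd : NonDegenerateFaces E) (d : G.Dart) : E.rot d ≠ d := by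
  intro h
  have := angleFace_rot_symm E d
  rw [h] at this
  exact sides_ne hnd d this.symm

theorem dart_eq_of {d d' : G.Dart} (h1 : d.fst = d'.fst) (h2 : d.snd = d'.snd) : d = d' := by
  apply SimpleGraph.Dart.ext; exact Prod.ext h1 h2

theorem rot_snd_ne {E : PlaneEmb G} (hnd : NonDegenerateFaces E) (d : G.Dart) :
    (E.rot d).snd ≠ d.snd := fun h => rot_ne hnd d (dart_eq_of (E.rot_fst d) h)

theorem exists_dart_at (E : PlaneEmb G) (v : V) : ∃ d : G.Dart, d.fst = v := by
  obtain ⟨d, -⟩ := face_surj E E.outer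
  by_cases h : d.fst = v
  · exact ⟨d, h⟩
  · haveI : Nontrivial V := ⟨d.fst, v, h⟩
    obtain ⟨w, hw⟩ := E.connected.preconnected.exists_adj_of_nontrivial v
    exact ⟨⟨(v, w), hw⟩, rfl⟩

inductive XT (E : PlaneEmb G) : Type
  | vx (v : V) : XT E
  | fc (F : E.Face) (h : F ≠ E.outer) : XT E

instance faceFinite (E : PlaneEmb G) : Finite E.Face := Quotient.finite _

instance xtFinite (E : PlaneEmb G) : Finite (XT E) :=
  Finite.of_injective (β := V ⊕ E.Face)
    (fun x => match x with
      | XT.vx v => Sum.inl v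
      | XT.fc F _ => Sum.inr F) (by
    intro x y h
    cases x <;> cases y <;> simp_all)

noncomputable instance faceFintype (E : PlaneEmb G) : Fintype E.Face := Fintype.ofFinite _
noncomputable instance xtFintype (E : PlaneEmb G) : Fintype (XT E) := Fintype.ofFinite _
noncomputable instance xtDec (E : PlaneEmb G) : DecidableEq (XT E) := Classical.decEq _

open Classical in
noncomputable def zX (E : PlaneEmb G) (d : G.Dart) : XT E :=
  if h : E.angleFace d = E.outer then XT.vx d.fst else XT.fc (E.angleFace d) h

def outR (E : PlaneEmb G) (big : G.Dart → Prop) : XT E → XT E → Prop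
  | XT.vx v, y => (¬ PointedVx big v ∧ ∃ w, G.Adj v w ∧ y = XT.vx w) ∨
      ∃ d, big d ∧ d.fst = v ∧ (y = XT.vx d.snd ∨ y = XT.vx (E.rot d).snd ∨ y = zX E d)
  | XT.fc F _, y => ∃ d, E.angleFace d = F ∧ ¬ big d ∧ y = XT.vx d.fst

open Classical in
noncomputable def outX (E : PlaneEmb G) (big : G.Dart → Prop) (x : XT E) : Finset (XT E) :=
  Finset.univ.filter (outR E big x)

theorem mem_outX {E : PlaneEmb G} {big : G.Dart → Prop} {x y : XT E} :
    y ∈ outX E big x ↔ outR E big x y := by simp [outX]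

def bdX (E : PlaneEmb G) (x : XT E) : Prop := ∃ d, E.angleFace d = E.outer ∧ x = XT.vx d.fst

theorem blocking_two {E : PlaneEmb G} {big : G.Dart → Prop} (hcpt : IsCPTLabelling E big)
    (F : E.Face) (hF : F ≠ E.outer) (I B : G.Dart → Prop) (hIB : ∀ d, I d → big d)
    (hI : ∃ d, E.angleFace d = F ∧ I d)
    (h1 : ∀ d, E.angleFace d = F → I d → I (psi E d) ∨ B (psi E d))
    (h2 : ∀ d, E.angleFace d = F → I d → I ((psi E).symm d) ∨ B ((psi E).symm d)) :
    ∃ p q, p ≠ q ∧ E.angleFace p = F ∧ E.angleFace q = F ∧ B p ∧ B q := by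
  classical
  by_contra hcon
  have huniq : ∀ p q, E.angleFace p = F → E.angleFace q = F → B p → B q → p = q := by
    intro p q hp hq bp bq
    by_contra h
    exact hcon ⟨p, q, h, hp, hq, bp, bq⟩
  have hsm : 3 = (Finset.univ.filter (fun d : G.Dart => E.angleFace d = F ∧ ¬ big d)).card := by
    rw [← hcpt.bounded_small F hF, Nat.card_eq_fintype_card]
    simp [Fintype.card_subtype]
  obtain ⟨d0, hd0, hI0⟩ := hI
  have hall : ∃ p, ∀ d, E.angleFace d = F → I d ∨ d = p := by
    by_cases hc : ∀ d, E.angleFace d = F → I d → I (psi E d)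
    · refine ⟨d0, fun d hd => ?_⟩
      have := face_closed E {d | E.angleFace d = F ∧ I d} d0 d ⟨hd0, hI0⟩
        (fun z hz => ⟨by rw [angleFace_psi]; exact hz.1, hc z hz.1 hz.2⟩) (by rw [hd0, hd])
      exact Or.inl this.2
    · push Not at hc
      obtain ⟨d1, hd1, hI1, hn1⟩ := hc
      have hB1 := (h1 d1 hd1 hI1).resolve_left hn1
      set p := psi E d1 with hp
      have hpF : E.angleFace p = F := by rw [hp, angleFace_psi, hd1]
      have hsub : ∀ d, E.angleFace d = F → I d → I (psi E d) ∨ psi E d = p := by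
        intro d hd hI
        rcases h1 d hd hI with h | h
        · exact Or.inl h
        · exact Or.inr (huniq _ _ (by rw [angleFace_psi, hd]) hpF h hB1)
      -- psi p in I
      have hpI : I (psi E p) := by
        by_contra hnp
        -- I closed under psi symm
        have hcl : ∀ d, E.angleFace d = F → I d → I ((psi E).symm d) := by
          intro d hd hI
          rcases h2 d hd hI with h | h
          · exact h
          · have := huniq _ _ (by rw [angleFace_psi_symm, hd]) hpF h hB1
            exfalso; apply hnp; rw [← this, Equiv.apply_symm_apply]; exact hI
        have hmem : p ∈ {d | E.angleFace d = F ∧ I d} := by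
          have hsc : (psi E)⁻¹.SameCycle d1 p := by
            rw [Equiv.Perm.sameCycle_inv, ← angleFace_eq_iff, hpF, hd1]
          exact perm_closed (psi E)⁻¹ {d | E.angleFace d = F ∧ I d} d1 p ⟨hd1, hI1⟩
            (fun z hz => ⟨(angleFace_psi_symm E z).trans hz.1, hcl z hz.1 hz.2⟩) hsc
        exact hn1 hmem.2
      refine ⟨p, fun d hd => ?_⟩
      have := face_closed E {d | E.angleFace d = F ∧ (I d ∨ d = p)} d0 d ⟨hd0, Or.inl hI0⟩
        (fun z hz => ⟨by rw [angleFace_psi]; exact hz.1, by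
          rcases hz.2 with h | h
          · exact hsub z hz.1 h
          · rw [h]; exact Or.inl hpI⟩) (by rw [hd0, hd])
      exact this.2
  obtain ⟨p, hp⟩ := hall
  have : (Finset.univ.filter (fun d : G.Dart => E.angleFace d = F ∧ ¬ big d)) ⊆ {p} := by
    intro d hd
    simp only [Finset.mem_filter, Finset.mem_univ, true_and] at hd
    rcases hp d hd.1 with h | h
    · exact absurd (hIB d h) hd.2
    · simp [h]
  have := Finset.card_le_card this
  simp at this
  omega

theorem small_card {E : PlaneEmb G} {big : G.Dart → Prop} (hcpt : IsCPTLabelling E big)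
    (F : E.Face) (hF : F ≠ E.outer) [DecidablePred (fun d : G.Dart => E.angleFace d = F ∧ ¬ big d)] :
    (Finset.univ.filter (fun d : G.Dart => E.angleFace d = F ∧ ¬ big d)).card = 3 := by
  rw [← hcpt.bounded_small F hF, Nat.card_eq_fintype_card]
  simp [Fintype.card_subtype]

def famF (E : PlaneEmb G) (big : G.Dart → Prop) (K : Finset (XT E)) (F : E.Face) : Prop :=
  ∃ h, XT.fc F h ∈ K ∧ (Inact (outX E big) (bdX E) K (XT.fc F h) ∨
    ∃ d, big d ∧ E.angleFace d = F ∧ Inact (outX E big) (bdX E) K (XT.vx d.fst))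

def subK (E : PlaneEmb G) (K : Finset (XT E)) (𝓕 : E.Face → Prop) : G.Subgraph where
  verts := {v | XT.vx v ∈ K ∨ ∃ d, d.fst = v ∧ 𝓕 (E.angleFace d)}
  Adj u v := G.Adj u v ∧ ((XT.vx u ∈ K ∧ XT.vx v ∈ K) ∨
    ∃ d : G.Dart, d.edge = s(u, v) ∧ 𝓕 (E.angleFace d))
  adj_sub h := h.1
  edge_vert := by
    rintro u v ⟨h, ⟨h1, h2⟩ | ⟨d, hd, hF⟩⟩
    · exact Or.inl h1
    · right
      rcases (SimpleGraph.dart_edge_eq_mk'_iff'.1 hd) with h | h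
      · exact ⟨d, h.1, hF⟩
      · exact ⟨(psi E).symm d, by rw [psi_symm_fst, h.2], by rwa [angleFace_psi_symm]⟩
  symm := ⟨by
    rintro u v ⟨h, ⟨h1, h2⟩ | ⟨d, hd, hF⟩⟩
    · exact ⟨h.symm, Or.inl ⟨h2, h1⟩⟩
    · exact ⟨h.symm, Or.inr ⟨d, by rw [hd, Sym2.eq_swap], hF⟩⟩⟩

theorem subK_edge {E : PlaneEmb G} {K : Finset (XT E)} {𝓕 : E.Face → Prop} (d : G.Dart) :
    d.edge ∈ (subK E K 𝓕).edgeSet ↔ ((XT.vx d.fst ∈ K ∧ XT.vx d.snd ∈ K) ∨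
      ∃ d' : G.Dart, d'.edge = d.edge ∧ 𝓕 (E.angleFace d')) := by
  have : d.edge = s(d.fst, d.snd) := rfl
  rw [this, SimpleGraph.Subgraph.mem_edgeSet]
  exact ⟨fun h => h.2, fun h => ⟨d.adj, h⟩⟩

theorem subK_not_outer {E : PlaneEmb G} {K : Finset (XT E)} {𝓕 : E.Face → Prop} (F : E.Face)
    (h𝓕 : ¬ 𝓕 E.outer) (hF : 𝓕 F) : ¬ InOuterOf E (subK E K 𝓕).edgeSet F := by
  intro h
  rcases Relation.ReflTransGen.cases_head h with h | ⟨F', ⟨d, h1, h2, h3⟩, -⟩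
  · exact h𝓕 (h ▸ hF)
  · apply h3
    rw [subK_edge]
    refine Or.inr ⟨d.symm, SimpleGraph.Dart.edge_symm d, ?_⟩
    rw [angleFace_symm, h1]; exact hF

end Comb


set_option linter.unusedSectionVars false
set_option linter.unusedSimpArgs false
set_option linter.unusedVariables false

section R1
variable {V : Type} [Fintype V] [DecidableEq V] {G : SimpleGraph V} [DecidableRel G.Adj]

theorem zX_of_ne {E : PlaneEmb G} {d : G.Dart} (h : E.angleFace d ≠ E.outer) :
    zX E d = XT.fc (E.angleFace d) h := by simp [zX, h]

theorem big_inact {E : PlaneEmb G} {big : G.Dart → Prop} {K : Finset (XT E)} {d : G.Dart}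
    (hb : big d) (h : Inact (outX E big) (bdX E) K (XT.vx d.fst)) :
    XT.vx d.snd ∈ K ∧ XT.vx (E.rot d).snd ∈ K ∧ ∃ h : E.angleFace d ≠ E.outer,
      XT.fc (E.angleFace d) h ∈ K := by
  have h0 : E.angleFace d ≠ E.outer := fun ho => h.2.1 ⟨d, ho, rfl⟩
  refine ⟨h.2.2 (mem_outX.2 (Or.inr ⟨d, hb, rfl, Or.inl rfl⟩)),
    h.2.2 (mem_outX.2 (Or.inr ⟨d, hb, rfl, Or.inr (Or.inl rfl)⟩)), h0, ?_⟩
  have := h.2.2 (mem_outX.2 (Or.inr ⟨d, hb, rfl, Or.inr (Or.inr rfl)⟩))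
  rwa [zX_of_ne h0] at this

theorem triP_of_corners {E : PlaneEmb G} {big : G.Dart → Prop} (hcpt : IsCPTLabelling E big)
    (hnd : NonDegenerateFaces E)
    (hH : ∀ H : G.Subgraph, 3 ≤ Nat.card H.verts →
        3 ≤ Nat.card {v : V | IsCPTCorner E big H v}) :
    TriP (outX E big) (bdX E) := by
  classical
  intro K ⟨x0, hx0⟩
  set Ina := Inact (outX E big) (bdX E) K with hIna
  set 𝓕 := famF E big K with h𝓕
  set H := subK E K 𝓕 with hHdef
  have hout : ¬ 𝓕 E.outer := fun ⟨h, _⟩ => h rfl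
  -- face vertices in H
  have hfv : ∀ d, 𝓕 (E.angleFace d) → d.fst ∈ H.verts ∧ d.snd ∈ H.verts ∧ (E.rot d).snd ∈ H.verts := by
    intro d hd
    refine ⟨Or.inr ⟨d, rfl, hd⟩, Or.inr ⟨(psi E).symm d, psi_symm_fst E d, by rwa [angleFace_psi_symm]⟩,
      Or.inr ⟨psi E d, psi_fst E d, by rwa [angleFace_psi]⟩⟩
  have h3 : ∃ d : G.Dart, d.fst ∈ H.verts ∧ d.snd ∈ H.verts ∧ (E.rot d).snd ∈ H.verts := by
    cases x0 with
    | vx v =>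
      by_cases hp : PointedVx big v
      · obtain ⟨d, hd, rfl⟩ := hp
        obtain ⟨h1, h2, h3⟩ := big_inact hd hx0
        exact ⟨d, Or.inl hx0.1, Or.inl h1, Or.inl h2⟩
      · obtain ⟨d, rfl⟩ := exists_dart_at E v
        refine ⟨d, Or.inl hx0.1, Or.inl ?_, Or.inl ?_⟩
        · exact hx0.2.2 (mem_outX.2 (Or.inl ⟨hp, d.snd, d.adj, rfl⟩))
        · exact hx0.2.2 (mem_outX.2 (Or.inl ⟨hp, (E.rot d).snd, by
            have := (E.rot d).adj; rwa [E.rot_fst] at this, rfl⟩))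
    | fc F hF =>
      obtain ⟨d, rfl⟩ := face_surj E F
      exact ⟨d, hfv d ⟨hF, hx0.1, Or.inl hx0⟩⟩
  have hHc : 3 ≤ Nat.card H.verts := by
    obtain ⟨d, h1, h2, h3⟩ := h3
    rw [Nat.card_coe_set_eq, Nat.succ_le_iff, Set.two_lt_ncard]
    exact ⟨d.fst, h1, d.snd, h2, (E.rot d).snd, h3, d.adj.ne, by
      have := (E.rot d).adj.ne; rwa [E.rot_fst] at this, (rot_snd_ne hnd d).symm⟩
  have hC := hH H hHc
  let Act : Finset (XT E) := K.filter (fun x => ¬ Ina x)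
  suffices hA : 2 < Act.card by
    obtain ⟨a, b, c, ha, hb, hc, hab, hac, hbc⟩ := Finset.two_lt_card_iff.1 hA
    simp only [Act, Finset.mem_filter] at ha hb hc
    exact ⟨a, b, c, ha.1, hb.1, hc.1, hab, hac, hbc, ha.2, hb.2, hc.2⟩
  let S0 : Finset V := Finset.univ.filter (fun v => XT.vx v ∈ Act ∧
    ∀ d, big d → d.fst = v → ¬ 𝓕 (E.angleFace d))
  let T : E.Face → Finset V := fun F => (Finset.univ.filter
    (fun d : G.Dart => (E.angleFace d = F ∧ ¬ big d) ∧ XT.vx d.fst ∉ K)).image (fun d => d.fst)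
  let FF : Finset E.Face := Finset.univ.filter 𝓕
  let A : E.Face → Finset (XT E) := fun F => Act.filter (fun x => (∃ h, x = XT.fc F h) ∨
    ∃ d, big d ∧ E.angleFace d = F ∧ x = XT.vx d.fst)
  have hsub : (Finset.univ.filter (fun v => IsCPTCorner E big H v)) ⊆ S0 ∪ FF.biUnion T := by
    intro v hv
    simp only [Finset.mem_filter, Finset.mem_univ, true_and] at hv
    have hvH : v ∈ H.verts := hv.elim (fun h => h.1) (fun h => h.1)
    have hbig : ∀ d, big d → d.fst = v → InOuterOf E H.edgeSet (E.angleFace d) := by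
      intro d hd hdv
      rcases hv with ⟨-, d', hd', hf', ho⟩ | ⟨-, hnp, -⟩
      · rwa [hcpt.one_big d d' hd hd' (hdv.trans hf'.symm)]
      · exact absurd ⟨d, hd, hdv⟩ hnp
    have hnF : ∀ d, big d → d.fst = v → ¬ 𝓕 (E.angleFace d) := fun d hd hdv hF =>
      subK_not_outer _ hout hF (hbig d hd hdv)
    rw [Finset.mem_union]
    by_cases hvK : XT.vx v ∈ K
    · left
      simp only [S0, Finset.mem_filter, Finset.mem_univ, true_and, Act]
      refine ⟨⟨hvK, fun hin => ?_⟩, hnF⟩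
      rcases hv with ⟨-, d', hd', hf', ho⟩ | ⟨-, hnp, d, hdv, -, -, hed⟩
      · subst hf'
        obtain ⟨-, -, h0, hk⟩ := big_inact hd' hin
        exact hnF d' hd' rfl ⟨h0, hk, Or.inr ⟨d', hd', rfl, hin⟩⟩
      · apply hed
        rw [hHdef, subK_edge]
        left
        rw [E.rot_fst, hdv]
        refine ⟨hvK, hin.2.2 (mem_outX.2 (Or.inl ⟨hnp, (E.rot d).snd, ?_, rfl⟩))⟩
        have := (E.rot d).adj; rwa [E.rot_fst, hdv] at this
    · right
      rcases hvH with h | ⟨d, hdv, hF⟩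
      · exact absurd h hvK
      · rw [Finset.mem_biUnion]
        refine ⟨E.angleFace d, by simp [FF, hF], ?_⟩
        simp only [T, Finset.mem_image, Finset.mem_filter, Finset.mem_univ, true_and]
        exact ⟨d, ⟨⟨rfl, fun hb => hnF d hb hdv hF⟩, by rwa [hdv]⟩, hdv⟩
  have hTA : ∀ F ∈ FF, (T F).card ≤ (A F).card := by
    intro F hF
    have hF' : 𝓕 F := by simpa [FF] using hF
    obtain ⟨h0, hk, hor⟩ := hF'
    by_cases hin : Ina (XT.fc F h0)
    · have : T F = ∅ := by
        rw [Finset.eq_empty_iff_forall_notMem]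
        intro v hv
        simp only [T, Finset.mem_image, Finset.mem_filter, Finset.mem_univ, true_and] at hv
        obtain ⟨d, ⟨⟨h1, h2⟩, h3⟩, -⟩ := hv
        exact h3 (hin.2.2 (mem_outX.2 ⟨d, h1, h2, rfl⟩))
      rw [this]; simp
    · obtain ⟨d0, hb0, hF0, hi0⟩ := hor.resolve_left hin
      obtain ⟨p, q, hpq, hpF, hqF, hBp, hBq⟩ := blocking_two hcpt F h0
        (fun d => big d ∧ Ina (XT.vx d.fst))
        (fun d => XT.vx d.fst ∈ K ∧ (big d → ¬ Ina (XT.vx d.fst)))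
        (fun d h => h.1) ⟨d0, hF0, hb0, hi0⟩
        (by
          intro d hd ⟨hb, hi⟩
          have := (big_inact hb hi).2.1
          rw [← psi_fst] at this
          by_cases h : big (psi E d) ∧ Ina (XT.vx (psi E d).fst)
          · exact Or.inl h
          · exact Or.inr ⟨this, fun hb hi => h ⟨hb, hi⟩⟩)
        (by
          intro d hd ⟨hb, hi⟩
          have := (big_inact hb hi).1
          rw [← psi_symm_fst E] at this
          by_cases h : big ((psi E).symm d) ∧ Ina (XT.vx ((psi E).symm d).fst)
          · exact Or.inl h
          · exact Or.inr ⟨this, fun hb hi => h ⟨hb, hi⟩⟩)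
      let sm := Finset.univ.filter (fun d : G.Dart => E.angleFace d = F ∧ ¬ big d)
      have hsm : sm.card = 3 := small_card hcpt F h0
      let smK := sm.filter (fun d => XT.vx d.fst ∈ K)
      let smN := sm.filter (fun d => ¬ XT.vx d.fst ∈ K)
      have hsplit : smK.card + smN.card = 3 := by
        rw [← hsm]; exact Finset.card_filter_add_card_filter_not _
      let ab := Finset.univ.filter (fun d : G.Dart => E.angleFace d = F ∧ big d ∧
        XT.vx d.fst ∈ K ∧ ¬ Ina (XT.vx d.fst))
      have hT : (T F).card ≤ smN.card := by
        refine Finset.card_image_le.trans (le_of_eq ?_)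
        congr 1
        ext d; simp [smN, sm]
      have hpq2 : 2 ≤ smK.card + ab.card := by
        have h1 : ({p, q} : Finset G.Dart) ⊆ smK ∪ ab := by
          intro x hx
          have hx' : E.angleFace x = F ∧ XT.vx x.fst ∈ K ∧ (big x → ¬ Ina (XT.vx x.fst)) := by
            rcases Finset.mem_insert.1 hx with h | h
            · rw [h]; exact ⟨hpF, hBp⟩
            · rw [Finset.mem_singleton.1 h]; exact ⟨hqF, hBq⟩
          simp only [smK, ab, sm, Finset.mem_union, Finset.mem_filter, Finset.mem_univ, true_and]
          by_cases hb : big x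
          · exact Or.inr ⟨hx'.1, hb, hx'.2.1, hx'.2.2 hb⟩
          · exact Or.inl ⟨⟨hx'.1, hb⟩, hx'.2.1⟩
        have h2 := Finset.card_le_card h1
        rw [Finset.card_pair hpq] at h2
        exact h2.trans (Finset.card_union_le _ _)
      have hA : 1 + ab.card ≤ (A F).card := by
        have h1 : insert (XT.fc F h0) (ab.image (fun d => XT.vx d.fst)) ⊆ A F := by
          intro x hx
          rcases Finset.mem_insert.1 hx with h | h
          · rw [h]
            simp only [A, Act, Finset.mem_filter]
            exact ⟨⟨hk, hin⟩, Or.inl ⟨h0, trivial⟩⟩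
          · obtain ⟨d, hd, rfl⟩ := Finset.mem_image.1 h
            simp only [ab, Finset.mem_filter, Finset.mem_univ, true_and] at hd
            simp only [A, Act, Finset.mem_filter]
            exact ⟨⟨hd.2.2.1, hd.2.2.2⟩, Or.inr ⟨d, hd.2.1, hd.1, rfl⟩⟩
        have h2 := Finset.card_le_card h1
        rw [Finset.card_insert_of_notMem (by simp), Finset.card_image_of_injOn] at h2
        · omega
        · intro d hd d' hd' he
          simp only [ab, Finset.coe_filter, Finset.mem_univ, true_and, Set.mem_ofPred_eq] at hd hd'
          exact hcpt.one_big d d' hd.2.1 hd'.2.1 (by simpa using he)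
      omega
  have hdisj1 : Disjoint (S0.image XT.vx) (FF.biUnion A) := by
    rw [Finset.disjoint_left]
    intro x hx hx'
    obtain ⟨v, hv, rfl⟩ := Finset.mem_image.1 hx
    obtain ⟨F, hF, hA⟩ := Finset.mem_biUnion.1 hx'
    simp only [S0, Finset.mem_filter, Finset.mem_univ, true_and] at hv
    simp only [A, Finset.mem_filter] at hA
    rcases hA.2 with ⟨h, he⟩ | ⟨d, hb, hd, he⟩
    · exact absurd he (by simp)
    · have : v = d.fst := by simpa using he
      exact hv.2 d hb this.symm (by rw [hd]; simpa [FF] using hF)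
  have hdisj2 : ∀ F ∈ FF, ∀ F' ∈ FF, F ≠ F' → Disjoint (A F) (A F') := by
    intro F _ F' _ hne
    rw [Finset.disjoint_left]
    intro x hx hx'
    simp only [A, Finset.mem_filter] at hx hx'
    rcases hx.2 with ⟨h, he⟩ | ⟨d, hb, hd, he⟩ <;> rcases hx'.2 with ⟨h', he'⟩ | ⟨d', hb', hd', he'⟩
    · rw [he] at he'; exact hne (by simpa using he')
    · rw [he] at he'; exact absurd he' (by simp)
    · rw [he] at he'; exact absurd he' (by simp)
    · rw [he] at he'
      have := hcpt.one_big d d' hb hb' (by simpa using he')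
      exact hne (by rw [← hd, ← hd', this])
  have hc1 : 3 ≤ (Finset.univ.filter (fun v => IsCPTCorner E big H v)).card := by
    refine hC.trans (le_of_eq ?_)
    rw [Nat.card_eq_fintype_card]
    simp [Fintype.card_subtype]
  have : 3 ≤ Act.card := by
    calc 3 ≤ (S0 ∪ FF.biUnion T).card := hc1.trans (Finset.card_le_card hsub)
      _ ≤ S0.card + (FF.biUnion T).card := Finset.card_union_le _ _
      _ ≤ S0.card + ∑ F ∈ FF, (T F).card := by gcongr; exact Finset.card_biUnion_le
      _ ≤ S0.card + ∑ F ∈ FF, (A F).card := by gcongr with F hF; exact hTA F hF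
      _ = (S0.image XT.vx).card + (FF.biUnion A).card := by
        rw [Finset.card_biUnion hdisj2, Finset.card_image_of_injective]
        intro a b h; simpa using h
      _ = (S0.image (XT.vx (E := E)) ∪ FF.biUnion A).card := (Finset.card_union_of_disjoint hdisj1).symm
      _ ≤ Act.card := by
        apply Finset.card_le_card
        apply Finset.union_subset
        · intro x hx
          obtain ⟨v, hv, rfl⟩ := Finset.mem_image.1 hx
          simp only [S0, Finset.mem_filter, Finset.mem_univ, true_and] at hv
          exact hv.1
        · intro x hx
          obtain ⟨F, hF, hA⟩ := Finset.mem_biUnion.1 hx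
          exact (Finset.mem_filter.1 hA).1
  omega

end R1


set_option linter.unusedSectionVars false
set_option linter.unusedSimpArgs false
set_option linter.unusedVariables false

section R3

open Classical in
noncomputable def ind (p : Prop) : ℤ := if p then 1 else 0

theorem ind_nonneg (p : Prop) : 0 ≤ ind p := by unfold ind; split_ifs <;> norm_num
theorem ind_true {p : Prop} (h : p) : ind p = 1 := by simp [ind, h]
theorem ind_false {p : Prop} (h : ¬ p) : ind p = 0 := by simp [ind, h]

theorem up_eq_dn {α : Type} [Fintype α] (σ : Equiv.Perm α) (s : α → Prop) (C : α → Prop)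
    (hC : ∀ x, C (σ x) ↔ C x) :
    ∑ x, ind (C x ∧ ¬ s x ∧ s (σ x)) = ∑ x, ind (C x ∧ s x ∧ ¬ s (σ x)) := by
  classical
  have h1 : ∑ x, ind (C (σ x) ∧ s (σ x)) = ∑ x, ind (C x ∧ s x) :=
    Equiv.sum_comp σ (fun x => ind (C x ∧ s x))
  have h2 : ∀ x, ind (C (σ x) ∧ s (σ x)) - ind (C x ∧ s x) =
      ind (C x ∧ ¬ s x ∧ s (σ x)) - ind (C x ∧ s x ∧ ¬ s (σ x)) := by
    intro x
    rw [hC]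
    by_cases a : C x <;> by_cases b : s x <;> by_cases c : s (σ x) <;> simp [ind, a, b, c]
  have h3 : ∑ x, (ind (C (σ x) ∧ s (σ x)) - ind (C x ∧ s x)) =
      ∑ x, (ind (C x ∧ ¬ s x ∧ s (σ x)) - ind (C x ∧ s x ∧ ¬ s (σ x))) :=
    Finset.sum_congr rfl (fun x _ => h2 x)
  rw [Finset.sum_sub_distrib, Finset.sum_sub_distrib, h1] at h3
  linarith

theorem up_pos {α : Type} [Fintype α] (σ : Equiv.Perm α) (s : α → Prop) (C : α → Prop)
    (a b : α) (ha : C a) (hna : ¬ s a) (hsb : s b)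
    (hcl : ∀ S : Set α, a ∈ S → (∀ x ∈ S, C x → σ x ∈ S) → b ∈ S) (hC : ∀ x, C (σ x) ↔ C x) :
    1 ≤ ∑ x, ind (C x ∧ ¬ s x ∧ s (σ x)) := by
  classical
  by_cases h : ∃ x, C x ∧ ¬ s x ∧ s (σ x)
  · obtain ⟨x, hx⟩ := h
    rw [← ind_true hx]
    exact Finset.single_le_sum (f := fun x => ind (C x ∧ ¬ s x ∧ s (σ x)))
      (fun i _ => ind_nonneg _) (Finset.mem_univ x)
  · push Not at h
    have := hcl {x | C x ∧ ¬ s x} ⟨ha, hna⟩ (fun x hx _ => ⟨(hC x).2 hx.1, h x hx.1 hx.2⟩)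
    exact absurd hsb this.2

variable {V : Type} [Fintype V] [DecidableEq V] {G : SimpleGraph V} [DecidableRel G.Adj]

/-- rotation on the ring of neighbours and faces -/
def rho (E : PlaneEmb G) : Equiv.Perm (G.Dart × Bool) where
  toFun r := match r with
    | (d, false) => (d, true)
    | (d, true) => (E.rot d, false)
  invFun r := match r with
    | (d, true) => (d, false)
    | (d, false) => (E.rot.symm d, true)
  left_inv r := by rcases r with ⟨d, _ | _⟩ <;> simp
  right_inv r := by rcases r with ⟨d, _ | _⟩ <;> simp

theorem rho_false (E : PlaneEmb G) (d : G.Dart) : rho E (d, false) = (d, true) := rfl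
theorem rho_true (E : PlaneEmb G) (d : G.Dart) : rho E (d, true) = (E.rot d, false) := rfl
theorem rho_fst (E : PlaneEmb G) (r : G.Dart × Bool) : (rho E r).1.fst = r.1.fst := by
  rcases r with ⟨d, _ | _⟩
  · rfl
  · exact E.rot_fst d

noncomputable def ring1 (E : PlaneEmb G) (r : G.Dart × Bool) : XT E :=
  match r with
  | (d, false) => XT.vx d.snd
  | (d, true) => zX E d

theorem rho_closed (E : PlaneEmb G) (S : Set (G.Dart × Bool)) (a b : G.Dart × Bool) (ha : a ∈ S)
    (hab : a.1.fst = b.1.fst) (hS : ∀ r ∈ S, r.1.fst = a.1.fst → rho E r ∈ S) : b ∈ S := by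
  have key : ∀ d : G.Dart, d.fst = a.1.fst → (d, false) ∈ S → ∀ d', d'.fst = a.1.fst →
      (d', false) ∈ S ∧ (d', true) ∈ S := by
    intro d hd hm d' hd'
    have : ∀ n : ℕ, (((E.rot ^ n) d, false) ∈ S ∧ ((E.rot ^ n) d).fst = a.1.fst) := by
      intro n
      induction n with
      | zero => exact ⟨by simpa using hm, by simpa using hd⟩
      | succ k ih =>
        have h1 := hS _ ih.1 ih.2
        rw [rho_false] at h1
        have h2 := hS _ h1 ih.2
        rw [rho_true] at h2
        rw [pow_succ', Equiv.Perm.mul_apply]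
        exact ⟨h2, (E.rot_fst _).trans ih.2⟩
    obtain ⟨n, hn⟩ := E.rot_vertex d d' (hd.trans hd'.symm)
    have h1 := (this n).1
    rw [hn] at h1
    exact ⟨h1, hS _ h1 hd'⟩
  obtain ⟨d, t⟩ := a
  obtain ⟨d', t'⟩ := b
  have : (d', false) ∈ S ∧ (d', true) ∈ S := by
    cases t with
    | false => exact key d rfl ha d' hab.symm
    | true =>
      have h2 := hS _ ha rfl
      rw [rho_true] at h2
      exact key (E.rot d) (E.rot_fst d) h2 d' hab.symm
  cases t'
  · exact this.1
  · exact this.2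

/-- sign at ring position -/
def rs (E : PlaneEmb G) (h : XT E → ℝ) (r : G.Dart × Bool) : Prop :=
  h (XT.vx r.1.fst) < h (ring1 E r)

def upR (E : PlaneEmb G) (h : XT E → ℝ) (r : G.Dart × Bool) : Prop :=
  ¬ rs E h r ∧ rs E h (rho E r)

def fs (E : PlaneEmb G) (h : XT E → ℝ) (d : G.Dart) : Prop := h (zX E d) < h (XT.vx d.fst)

theorem zX_outer {E : PlaneEmb G} {d : G.Dart} (h : E.angleFace d = E.outer) :
    zX E d = XT.vx d.fst := by simp [zX, h]

theorem zX_psi_symm {E : PlaneEmb G} {d : G.Dart} (h : E.angleFace d ≠ E.outer) :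
    zX E ((psi E).symm d) = zX E d := by
  have h1 := angleFace_psi_symm E d
  rw [zX_of_ne h, zX_of_ne (by rw [h1]; exact h)]
  simp [h1]

theorem rot_psi_symm (E : PlaneEmb G) (d : G.Dart) : E.rot ((psi E).symm d) = d.symm := by
  rw [psi_symm_apply, Equiv.apply_symm_apply]

theorem tri_change (E : PlaneEmb G) (h : XT E → ℝ) (hinj : Function.Injective h) (d : G.Dart) :
    (ind (¬ (rs E h (d, false) ↔ rs E h (d, true)))) +
    (ind (¬ (rs E h ((psi E).symm d, true) ↔ rs E h (E.rot ((psi E).symm d), false)))) +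
    ind (¬ (fs E h ((psi E).symm d) ↔ fs E h d)) = 1 := by
  have hAB : h (XT.vx d.fst) ≠ h (XT.vx d.snd) := fun e => d.adj.ne (by simpa using hinj e)
  simp only [rs, fs, ring1, rot_psi_symm, psi_symm_fst]
  have e1 : d.symm.snd = d.fst := rfl
  have e2 : d.symm.fst = d.snd := rfl
  rw [e1, e2]
  by_cases ho : E.angleFace d = E.outer
  · rw [zX_outer ho, zX_outer (d := (psi E).symm d) (by rw [angleFace_psi_symm]; exact ho), psi_symm_fst]
    rcases lt_or_gt_of_ne hAB with hl | hl <;> simp [ind, hl, hl.le, not_lt.2 hl.le]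
  · rw [zX_psi_symm ho]
    have hAz : h (XT.vx d.fst) ≠ h (zX E d) := fun e => by
      have := hinj e; rw [zX_of_ne ho] at this; simp at this
    have hBz : h (XT.vx d.snd) ≠ h (zX E d) := fun e => by
      have := hinj e; rw [zX_of_ne ho] at this; simp at this
    rcases lt_or_gt_of_ne hAB with h1 | h1 <;> rcases lt_or_gt_of_ne hAz with h2 | h2 <;>
      rcases lt_or_gt_of_ne hBz with h3 | h3 <;>
      first
      | (exfalso; linarith)
      | simp [ind, h1, h2, h3, not_lt.2 h1.le, not_lt.2 h2.le, not_lt.2 h3.le, h1.le, h2.le, h3.le]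

theorem ind_change (p q : Prop) : ind (¬ (p ↔ q)) = ind (¬ p ∧ q) + ind (p ∧ ¬ q) := by
  by_cases a : p <;> by_cases b : q <;> simp [ind, a, b]

theorem total_change (E : PlaneEmb G) (h : XT E → ℝ) (hinj : Function.Injective h) :
    ∑ r, ind (upR E h r) + ∑ d, ind (¬ fs E h d ∧ fs E h (psi E d)) = Fintype.card V +
      Fintype.card E.Face - 2 := by
  classical
  have hs := Finset.sum_congr rfl (fun d (_ : d ∈ (Finset.univ : Finset G.Dart)) => tri_change E h hinj d)
  simp only [Finset.sum_add_distrib] at hs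
  have r1 : ∑ d, ind (¬ (rs E h ((psi E).symm d, true) ↔ rs E h (E.rot ((psi E).symm d), false))) =
      ∑ d, ind (¬ (rs E h (d, true) ↔ rs E h (E.rot d, false))) :=
    Equiv.sum_comp (psi E).symm (fun d => ind (¬ (rs E h (d, true) ↔ rs E h (E.rot d, false))))
  have r2 : ∑ d, ind (¬ (fs E h ((psi E).symm d) ↔ fs E h d)) =
      ∑ d, ind (¬ (fs E h d ↔ fs E h (psi E d))) := by
    rw [← Equiv.sum_comp (psi E).symm (fun d => ind (¬ (fs E h d ↔ fs E h (psi E d))))]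
    simp
  rw [r1, r2] at hs
  have r3 : ∑ r : G.Dart × Bool, ind (¬ (rs E h r ↔ rs E h (rho E r))) =
      ∑ d, ind (¬ (rs E h (d, false) ↔ rs E h (d, true))) +
        ∑ d, ind (¬ (rs E h (d, true) ↔ rs E h (E.rot d, false))) := by
    rw [Fintype.sum_prod_type, ← Finset.sum_add_distrib]
    apply Finset.sum_congr rfl
    intro d _
    rw [Fintype.sum_bool, rho_true, rho_false, add_comm]
  rw [← r3] at hs
  simp only [ind_change, Finset.sum_add_distrib] at hs
  have u1 := up_eq_dn (rho E) (rs E h) (fun _ => True) (fun _ => Iff.rfl)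
  have u2 := up_eq_dn (psi E) (fs E h) (fun _ => True) (fun _ => Iff.rfl)
  simp only [true_and] at u1 u2
  have hcard : (∑ d : G.Dart, (1 : ℤ)) = 2 * (Fintype.card V + Fintype.card E.Face - 2) := by
    have e1 := G.dart_card_eq_twice_card_edges
    have e2 := E.euler
    rw [Nat.card_eq_fintype_card, Nat.card_eq_fintype_card, Nat.card_eq_fintype_card,
      ← SimpleGraph.edgeFinset_card] at e2
    simp only [Finset.sum_const, Finset.card_univ, smul_eq_mul, mul_one, nsmul_eq_mul]
    rw [e1]
    have e3 : (Fintype.card V : ℤ) + Fintype.card E.Face = G.edgeFinset.card + 2 := by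
      exact_mod_cast e2
    push_cast
    linarith
  rw [hcard] at hs
  unfold upR
  linarith

theorem sum_ind_class {α β : Type} [Fintype α] [Fintype β] (c : α → β) (p : α → Prop) :
    ∑ x, ind (p x) = ∑ b, ∑ x, ind (c x = b ∧ p x) := by
  classical
  rw [Finset.sum_comm]
  apply Finset.sum_congr rfl
  intro x _
  rw [Finset.sum_eq_single (c x)]
  · simp
  · intro b _ hb; exact ind_false (fun h => hb h.1.symm)
  · intro h; exact absurd (Finset.mem_univ _) h

theorem inact_univ {E : PlaneEmb G} {big : G.Dart → Prop} {x : XT E} (hx : ¬ bdX E x) :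
    Inact (outX E big) (bdX E) Finset.univ x := ⟨Finset.mem_univ _, hx, Finset.subset_univ _⟩

theorem out_in_ring {E : PlaneEmb G} {big : G.Dart → Prop} {v : V} {o : XT E}
    (ho : o ∈ outX E big (XT.vx v)) : ∃ r : G.Dart × Bool, r.1.fst = v ∧ ring1 E r = o := by
  rcases mem_outX.1 ho with ⟨-, w, hw, rfl⟩ | ⟨d, -, hd, h⟩
  · exact ⟨(⟨(v, w), hw⟩, false), rfl, rfl⟩
  · rcases h with rfl | rfl | rfl
    · exact ⟨(d, false), hd, rfl⟩
    · exact ⟨(E.rot d, false), (E.rot_fst d).trans hd, rfl⟩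
    · exact ⟨(d, true), hd, rfl⟩

def excV (E : PlaneEmb G) (h : XT E → ℝ) (v : V) : Prop :=
  ∃ e, E.angleFace e = E.outer ∧ e.fst = v ∧
    h (XT.vx e.snd) < h (XT.vx e.fst) ∧ h (XT.vx (E.rot e).snd) < h (XT.vx e.fst)

theorem ring_core {E : PlaneEmb G} {big : G.Dart → Prop} (h : XT E → ℝ)
    (hg : HGood (outX E big) (bdX E) Finset.univ h)
    (hloc : ∀ v v', excV E h v → excV E h v' → v = v') (v0 : V)
    (hv0 : 2 - ind (excV E h v0) ≤ ∑ r : G.Dart × Bool, ind (r.1.fst = v0 ∧ upR E h r)) : False := by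
  classical
  have hinj : Function.Injective h := fun a b hab => hg.1 (by simp) (by simp) hab
  have htot := total_change E h hinj
  rw [sum_ind_class (fun r : G.Dart × Bool => r.1.fst) (upR E h),
    sum_ind_class E.angleFace (fun d => ¬ fs E h d ∧ fs E h (psi E d))] at htot
  -- face bound
  have hF : ∀ F : E.Face, 1 - ind (F = E.outer) ≤
      ∑ d, ind (E.angleFace d = F ∧ ¬ fs E h d ∧ fs E h (psi E d)) := by
    intro F
    by_cases hFo : F = E.outer
    · rw [ind_true hFo]
      simpa using Finset.sum_nonneg (fun d _ => ind_nonneg _)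
    · rw [ind_false hFo, sub_zero]
      have hnb : ¬ bdX E (XT.fc F hFo) := by rintro ⟨d, -, hd⟩; exact absurd hd (by simp)
      obtain ⟨⟨o, ho, h1⟩, ⟨o', ho', h2⟩⟩ := hg.2 _ (inact_univ hnb)
      obtain ⟨d, hd, -, rfl⟩ := mem_outX.1 ho
      obtain ⟨d', hd', -, rfl⟩ := mem_outX.1 ho'
      have hz : ∀ d, E.angleFace d = F → zX E d = XT.fc F hFo := by
        intro d hd
        rw [zX_of_ne (by rw [hd]; exact hFo)]; simp [hd]
      refine up_pos (psi E) (fs E h) (fun d => E.angleFace d = F) d d' hd ?_ ?_ ?_ ?_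
      · unfold fs; rw [hz d hd]; exact not_lt.2 h1.le
      · unfold fs; rw [hz d' hd']; exact h2
      · intro S hS hcl
        have := face_closed E {x | x ∈ S ∧ E.angleFace x = F} d d' ⟨hS, hd⟩
          (fun z hz => ⟨hcl z hz.1 hz.2, by rw [angleFace_psi]; exact hz.2⟩) (by rw [hd, hd'])
        exact this.1
      · intro x; rw [angleFace_psi]
  -- vertex bound
  have hexc : ∑ v, ind (excV E h v) ≤ 1 := by
    by_cases hex : ∃ v, excV E h v
    · obtain ⟨v1, hv1⟩ := hex
      rw [Finset.sum_eq_single v1]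
      · unfold ind; split_ifs <;> norm_num
      · rintro v - hv
        exact ind_false (fun h' => hv (hloc _ _ h' hv1))
      · intro h; exact absurd (Finset.mem_univ _) h
    · push Not at hex
      rw [Finset.sum_eq_zero (fun v _ => ind_false (hex v))]; norm_num
  have hV1 : ∀ v, ¬ excV E h v → 1 ≤ ∑ r : G.Dart × Bool, ind (r.1.fst = v ∧ upR E h r) := by
    intro v hv
    have hex : ∃ a b : G.Dart × Bool, a.1.fst = v ∧ b.1.fst = v ∧ ¬ rs E h a ∧ rs E h b := by
      by_cases hb : bdX E (XT.vx v)
      · obtain ⟨e, he, hev⟩ := hb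
        have hev' : v = e.fst := by simpa using hev
        subst hev'
        have hna : ¬ rs E h (e, true) := by
          unfold rs ring1; simp only; rw [zX_outer he]; exact lt_irrefl _
        by_cases h1 : h (XT.vx e.snd) < h (XT.vx e.fst)
        · have h2 : ¬ h (XT.vx (E.rot e).snd) < h (XT.vx e.fst) := fun h2 => hv ⟨e, he, rfl, h1, h2⟩
          refine ⟨(e, true), (E.rot e, false), rfl, E.rot_fst e, hna, ?_⟩
          unfold rs ring1; simp only [E.rot_fst]
          refine lt_of_le_of_ne (not_lt.1 h2) (fun e' => ?_)
          have := (E.rot e).adj.ne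
          rw [E.rot_fst] at this
          exact this (by simpa using hinj e')
        · refine ⟨(e, true), (e, false), rfl, rfl, hna, ?_⟩
          unfold rs ring1; simp only
          refine lt_of_le_of_ne (not_lt.1 h1) (fun e' => e.adj.ne (by simpa using hinj e'))
      · obtain ⟨⟨o, ho, h1⟩, ⟨o', ho', h2⟩⟩ := hg.2 _ (inact_univ hb)
        obtain ⟨a, ha, rfl⟩ := out_in_ring ho
        obtain ⟨b, hb, rfl⟩ := out_in_ring ho'
        refine ⟨a, b, ha, hb, ?_, ?_⟩
        · unfold rs; rw [ha]; exact not_lt.2 h1.le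
        · unfold rs; rw [hb]; exact h2
    obtain ⟨a, b, ha, hb, hna, hsb⟩ := hex
    refine up_pos (rho E) (rs E h) (fun r => r.1.fst = v) a b ha hna hsb ?_ ?_
    · intro S hS hcl
      exact rho_closed E S a b hS (ha.trans hb.symm) (fun r hr hr' => hcl r hr (hr'.trans ha))
    · intro x; rw [rho_fst]
  have hV : ∀ v, 1 - ind (excV E h v) + ind (v = v0) ≤
      ∑ r : G.Dart × Bool, ind (r.1.fst = v ∧ upR E h r) := by
    intro v
    by_cases hv : v = v0
    · rw [ind_true hv, hv]
      linarith
    · rw [ind_false hv]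
      by_cases hex : excV E h v
      · rw [ind_true hex]
        simpa using Finset.sum_nonneg (fun d _ => ind_nonneg _)
      · rw [ind_false hex]; simpa using hV1 v hex
  have s1 := Finset.sum_le_sum (fun F (_ : F ∈ (Finset.univ : Finset E.Face)) => hF F)
  have s2 := Finset.sum_le_sum (fun v (_ : v ∈ (Finset.univ : Finset V)) => hV v)
  have t1 : ∑ F, ind (F = E.outer) = 1 := by
    rw [Finset.sum_eq_single E.outer]
    · exact ind_true rfl
    · intro F _ hF; exact ind_false hF
    · intro h; exact absurd (Finset.mem_univ _) h
  have t2 : ∑ v, ind (v = v0) = 1 := by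
    rw [Finset.sum_eq_single v0]
    · exact ind_true rfl
    · intro F _ hF; exact ind_false hF
    · intro h; exact absurd (Finset.mem_univ _) h
  rw [Finset.sum_sub_distrib, t1] at s1
  rw [Finset.sum_add_distrib, Finset.sum_sub_distrib, t2] at s2
  simp only [Finset.sum_const, Finset.card_univ, smul_eq_mul, mul_one, nsmul_eq_mul] at s1 s2
  linarith

theorem ring_up {E : PlaneEmb G} {big : G.Dart → Prop} (h : XT E → ℝ)
    (hg : HGood (outX E big) (bdX E) Finset.univ h)
    (hloc : ∀ v v', excV E h v → excV E h v' → v = v')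
    (r r' : G.Dart × Bool) (hrr : r.1.fst = r'.1.fst) (hr : upR E h r) (hr' : upR E h r') : r = r' := by
  classical
  by_contra hne
  apply ring_core h hg hloc r.1.fst
  have : ∑ x ∈ ({r, r'} : Finset (G.Dart × Bool)), ind (x.1.fst = r.1.fst ∧ upR E h x) = 2 := by
    rw [Finset.sum_pair hne, ind_true ⟨rfl, hr⟩, ind_true ⟨hrr.symm, hr'⟩]; norm_num
  have h2 := ind_nonneg (excV E h r.1.fst)
  have h3 : ∑ x ∈ ({r, r'} : Finset (G.Dart × Bool)), ind (x.1.fst = r.1.fst ∧ upR E h x) ≤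
      ∑ x : G.Dart × Bool, ind (x.1.fst = r.1.fst ∧ upR E h x) :=
    Finset.sum_le_sum_of_subset_of_nonneg (Finset.subset_univ _) (fun i _ _ => ind_nonneg _)
  linarith

theorem ring_noup {E : PlaneEmb G} {big : G.Dart → Prop} (h : XT E → ℝ)
    (hg : HGood (outX E big) (bdX E) Finset.univ h)
    (hloc : ∀ v v', excV E h v → excV E h v' → v = v')
    (r : G.Dart × Bool) (hr : upR E h r) : ¬ excV E h r.1.fst := by
  classical
  intro hex
  apply ring_core h hg hloc r.1.fst
  rw [ind_true hex]
  have h3 : ind (r.1.fst = r.1.fst ∧ upR E h r) ≤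
      ∑ x : G.Dart × Bool, ind (x.1.fst = r.1.fst ∧ upR E h x) :=
    Finset.single_le_sum (f := fun x : G.Dart × Bool => ind (x.1.fst = r.1.fst ∧ upR E h x))
      (fun i _ => ind_nonneg _) (Finset.mem_univ r)
  rw [ind_true ⟨rfl, hr⟩] at h3
  linarith

/-- if r is minus, rho r plus, rho rho r minus, then all others minus. -/
theorem ring_only {E : PlaneEmb G} {big : G.Dart → Prop} (h : XT E → ℝ)
    (hg : HGood (outX E big) (bdX E) Finset.univ h)
    (hloc : ∀ v v', excV E h v → excV E h v' → v = v')
    (r : G.Dart × Bool) (h0 : ¬ rs E h r) (h1 : rs E h (rho E r)) (h2 : ¬ rs E h (rho E (rho E r)))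
    (q : G.Dart × Bool) (hq : q.1.fst = r.1.fst) (hqs : rs E h q) : q = rho E r := by
  have := rho_closed E {x | x.1.fst = r.1.fst ∧ (¬ rs E h x ∨ x = rho E r)} r q ⟨rfl, Or.inl h0⟩ hq.symm (by
    rintro x ⟨hx, hx'⟩ -
    refine ⟨(rho_fst E x).trans hx, ?_⟩
    rcases hx' with hx' | rfl
    · by_cases hs : rs E h (rho E x)
      · right
        rw [ring_up h hg hloc x r hx ⟨hx', hs⟩ ⟨h0, h1⟩]
      · exact Or.inl hs
    · exact Or.inl h2)
  exact this.2.resolve_left (fun h => h hqs)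

end R3


set_option linter.unusedSectionVars false
set_option linter.unusedSimpArgs false
set_option linter.unusedVariables false

section R4

def det3 (a b c : ℝ × ℝ) : ℝ := (b.1 - a.1) * (c.2 - a.2) - (b.2 - a.2) * (c.1 - a.1)

theorem det3_cyc (a b c : ℝ × ℝ) : det3 b c a = det3 a b c := by unfold det3; ring
theorem det3_swap (a b c : ℝ × ℝ) : det3 a c b = - det3 a b c := by unfold det3; ring

variable {V : Type} [Fintype V] [DecidableEq V] {G : SimpleGraph V} [DecidableRel G.Adj]

def lin {E : PlaneEmb G} (P : XT E → ℝ × ℝ) (α β : ℝ) (x : XT E) : ℝ := α * (P x).1 + β * (P x).2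

structure Pos (E : PlaneEmb G) (big : G.Dart → Prop) (P : XT E → ℝ × ℝ) : Prop where
  cpt : IsCPTLabelling E big
  nd : NonDegenerateFaces E
  tri : TriP (outX E big) (bdX E)
  harm : ∀ α β x, ¬ bdX E x → ∑ o ∈ outX E big x, (lin P α β o - lin P α β x) = 0
  conv : ∀ e e' : G.Dart, E.angleFace e = E.outer → E.angleFace e' = E.outer →
    e'.fst ≠ e.fst → e'.fst ≠ (E.rot e).snd →
    0 < det3 (P (XT.vx e.fst)) (P (XT.vx (E.rot e).snd)) (P (XT.vx e'.fst))

variable {E : PlaneEmb G} {big : G.Dart → Prop} {P : XT E → ℝ × ℝ}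

theorem cramer (a w u p : ℝ × ℝ) (α β : ℝ) :
    (α * p.1 + β * p.2 - (α * a.1 + β * a.2)) * det3 a w u =
      det3 a w p * (α * u.1 + β * u.2 - (α * a.1 + β * a.2)) +
      det3 u a p * (α * w.1 + β * w.2 - (α * a.1 + β * a.2)) := by
  unfold det3; ring

theorem outer_unique (hP : Pos E big P) {e e' : G.Dart} (he : E.angleFace e = E.outer)
    (he' : E.angleFace e' = E.outer) (h : e.fst = e'.fst) : e = e' :=
  hP.cpt.one_big e e' (hP.cpt.outer_big e he) (hP.cpt.outer_big e' he') h

theorem conv_loc (hP : Pos E big P) {α β : ℝ} (hab : α ≠ 0 ∨ β ≠ 0) {h : XT E → ℝ}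
    (href : ∀ x y, lin P α β x < lin P α β y → h x < h y) {e e' : G.Dart}
    (he : E.angleFace e = E.outer) (he' : E.angleFace e' = E.outer)
    (h1 : h (XT.vx e.snd) < h (XT.vx e.fst)) (h2 : h (XT.vx (E.rot e).snd) < h (XT.vx e.fst))
    (n1 : e'.fst ≠ e.fst) (n2 : e'.fst ≠ (E.rot e).snd) (n3 : e'.fst ≠ e.snd) :
    lin P α β (XT.vx e'.fst) < lin P α β (XT.vx e.fst) := by
  have f1 : lin P α β (XT.vx e.snd) ≤ lin P α β (XT.vx e.fst) := by
    by_contra hc; exact absurd (href _ _ (not_le.1 hc)) (not_lt.2 h1.le)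
  have f2 : lin P α β (XT.vx (E.rot e).snd) ≤ lin P α β (XT.vx e.fst) := by
    by_contra hc; exact absurd (href _ _ (not_le.1 hc)) (not_lt.2 h2.le)
  have k1 := hP.conv e e' he he' n1 n2
  have hpo : E.angleFace ((psi E).symm e) = E.outer := by rw [angleFace_psi_symm]; exact he
  have k2 := hP.conv ((psi E).symm e) e' hpo he' (by rw [psi_symm_fst]; exact n3)
    (by rw [rot_psi_symm]; exact n1)
  rw [psi_symm_fst, rot_psi_symm] at k2
  have e2 : e.symm.snd = e.fst := rfl
  rw [e2] at k2
  have k3 := hP.conv e ((psi E).symm e) he hpo (by rw [psi_symm_fst]; exact e.adj.ne.symm)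
    (by rw [psi_symm_fst]; exact (rot_snd_ne hP.nd e).symm)
  rw [psi_symm_fst] at k3
  have hc := cramer (P (XT.vx e.fst)) (P (XT.vx (E.rot e).snd)) (P (XT.vx e.snd)) (P (XT.vx e'.fst)) α β
  unfold lin at *
  set a := P (XT.vx e.fst)
  set w := P (XT.vx (E.rot e).snd)
  set u := P (XT.vx e.snd)
  set p := P (XT.vx e'.fst)
  by_contra hcon
  have hp : 0 ≤ (α * p.1 + β * p.2 - (α * a.1 + β * a.2)) := by linarith
  have hl : 0 ≤ (α * p.1 + β * p.2 - (α * a.1 + β * a.2)) * det3 a w u := mul_nonneg hp k3.le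
  have t1 : det3 a w p * (α * u.1 + β * u.2 - (α * a.1 + β * a.2)) ≤ 0 :=
    mul_nonpos_of_nonneg_of_nonpos k1.le (by linarith)
  have t2 : det3 u a p * (α * w.1 + β * w.2 - (α * a.1 + β * a.2)) ≤ 0 :=
    mul_nonpos_of_nonneg_of_nonpos k2.le (by linarith)
  have t1' : (α * u.1 + β * u.2 - (α * a.1 + β * a.2)) = 0 := by
    have : det3 a w p * (α * u.1 + β * u.2 - (α * a.1 + β * a.2)) = 0 := by linarith
    exact (mul_eq_zero.1 this).resolve_left k1.ne'
  have t2' : (α * w.1 + β * w.2 - (α * a.1 + β * a.2)) = 0 := by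
    have : det3 u a p * (α * w.1 + β * w.2 - (α * a.1 + β * a.2)) = 0 := by linarith
    exact (mul_eq_zero.1 this).resolve_left k2.ne'
  have q1 : α * det3 a w u = 0 := by
    have : α * det3 a w u = (u.2 - a.2) * (α * w.1 + β * w.2 - (α * a.1 + β * a.2)) -
      (w.2 - a.2) * (α * u.1 + β * u.2 - (α * a.1 + β * a.2)) := by unfold det3; ring
    rw [this, t1', t2']; ring
  have q2 : β * det3 a w u = 0 := by
    have : β * det3 a w u = - (u.1 - a.1) * (α * w.1 + β * w.2 - (α * a.1 + β * a.2)) +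
      (w.1 - a.1) * (α * u.1 + β * u.2 - (α * a.1 + β * a.2)) := by unfold det3; ring
    rw [this, t1', t2']; ring
  rcases hab with hh | hh
  · exact hh ((mul_eq_zero.1 q1).resolve_right k3.ne')
  · exact hh ((mul_eq_zero.1 q2).resolve_right k3.ne')

theorem pos_loc (hP : Pos E big P) {α β : ℝ} (hab : α ≠ 0 ∨ β ≠ 0) {h : XT E → ℝ}
    (href : ∀ x y, lin P α β x < lin P α β y → h x < h y) (v v' : V)
    (hv : excV E h v) (hv' : excV E h v') : v = v' := by
  obtain ⟨e, he, rfl, h1, h2⟩ := hv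
  obtain ⟨e', he', rfl, h1', h2'⟩ := hv'
  by_contra hne
  have nb : ∀ e e' : G.Dart, E.angleFace e = E.outer → E.angleFace e' = E.outer →
      h (XT.vx (E.rot e).snd) < h (XT.vx e.fst) → h (XT.vx e'.snd) < h (XT.vx e'.fst) →
      e'.fst ≠ (E.rot e).snd := by
    intro e e' he he' h1 h2 heq
    have : e' = psi E e := outer_unique hP he' (by rw [angleFace_psi]; exact he) (by rw [psi_fst]; exact heq)
    rw [this, psi_snd, psi_fst] at h2
    linarith
  have nb2 : ∀ e e' : G.Dart, E.angleFace e = E.outer → E.angleFace e' = E.outer →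
      h (XT.vx e.snd) < h (XT.vx e.fst) → h (XT.vx (E.rot e').snd) < h (XT.vx e'.fst) →
      e'.fst ≠ e.snd := by
    intro e e' he he' h1 h2 heq
    have : e' = (psi E).symm e := outer_unique hP he' (by rw [angleFace_psi_symm]; exact he)
      (by rw [psi_symm_fst]; exact heq)
    rw [this, rot_psi_symm, psi_symm_fst] at h2
    have e2 : e.symm.snd = e.fst := rfl
    rw [e2] at h2
    linarith
  have a1 := conv_loc hP hab href he he' h1 h2 (Ne.symm hne) (nb e e' he he' h2 h1')
    (nb2 e e' he he' h1 h2')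
  have a2 := conv_loc hP hab href he' he h1' h2' hne (nb e' e he' he h2' h1)
    (nb2 e' e he' he h1' h2)
  linarith

/-- a refinement with prescribed position of a tied element -/
theorem sep_pair (hP : Pos E big P) (α β : ℝ) (x a : XT E) (hxa : x ≠ a)
    (ht : lin P α β x = lin P α β a) :
    ∃ g, HGood (outX E big) (bdX E) Finset.univ g ∧ (∀ x y, lin P α β x < lin P α β y → g x < g y) ∧
      g x < g a := by
  obtain ⟨g, hg, hr⟩ := (sep_top hP.tri (lin P α β) (hP.harm α β)).1
  have hne : g x ≠ g a := fun e => hxa (hg.1 (by simp) (by simp) e)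
  rcases lt_or_gt_of_ne hne with h | h
  · exact ⟨g, hg, hr, h⟩
  · obtain ⟨g', hg', hr', hf⟩ := sep_flip hP.tri (lin P α β) (hP.harm α β) g hg (lin P α β a)
    exact ⟨g', hg', hr', hf a x rfl ht h⟩

theorem exists_up {s : ℕ → Prop} (a b : ℕ) (hab : a ≤ b) (ha : ¬ s a) (hb : s b) :
    ∃ k, a ≤ k ∧ k < b ∧ ¬ s k ∧ s (k + 1) := by
  by_contra hcon
  push Not at hcon
  have : ∀ k, a ≤ k → k ≤ b → ¬ s k := by
    intro k hk
    induction k, hk using Nat.le_induction with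
    | base => intro _; exact ha
    | succ n hn ih => intro hnb; exact hcon n hn (by omega) (ih (by omega))
  exact this b hab le_rfl hb

theorem rho_pow_fst (E : PlaneEmb G) (r : G.Dart × Bool) (k : ℕ) : ((rho E ^ k) r).1.fst = r.1.fst := by
  induction k with
  | zero => rfl
  | succ n ih => rw [pow_succ', Equiv.Perm.mul_apply, rho_fst, ih]

theorem rho_reach (E : PlaneEmb G) (r q : G.Dart × Bool) (h : r.1.fst = q.1.fst) :
    ∃ k : ℕ, (rho E ^ k) r = q := by
  have := rho_closed E {x | ∃ k : ℕ, (rho E ^ k) r = x} r q ⟨0, rfl⟩ h (by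
    rintro x ⟨k, rfl⟩ -
    exact ⟨k + 1, by rw [pow_succ', Equiv.Perm.mul_apply]⟩)
  exact this

/-- key step: all outs tied, one strictly lower ring element : contradiction -/
theorem tied_contra (hP : Pos E big P) {α β : ℝ} (hab : α ≠ 0 ∨ β ≠ 0) (r : G.Dart × Bool)
    (hbd : ¬ bdX E (XT.vx r.1.fst))
    (h0 : lin P α β (ring1 E r) < lin P α β (XT.vx r.1.fst))
    (hne : ∀ q : G.Dart × Bool, q.1.fst = r.1.fst → ring1 E q ≠ XT.vx r.1.fst)
    (htie : ∀ o ∈ outX E big (XT.vx r.1.fst), lin P α β o = lin P α β (XT.vx r.1.fst)) : False := by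
  classical
  set x := XT.vx (E := E) r.1.fst with hx
  have hex : ∀ q : {q : G.Dart × Bool // q.1.fst = r.1.fst}, ∃ k : ℕ, (rho E ^ k) r = q.1 :=
    fun q => rho_reach E r q.1 q.2.symm
  let pos : {q : G.Dart × Bool // q.1.fst = r.1.fst} → ℕ := fun q => Nat.find (hex q)
  have hpos : ∀ q, (rho E ^ (pos q)) r = q.1 := fun q => Nat.find_spec (hex q)
  have hmin : ∀ q k, k < pos q → (rho E ^ k) r ≠ q.1 := fun q k hk => Nat.find_min (hex q) hk
  have hdist : ∀ q a b, a < b → b < pos q → (rho E ^ a) r ≠ (rho E ^ b) r := by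
    intro q a b hab hb heq
    apply hmin q (pos q - b + a) (by omega)
    rw [pow_add, Equiv.Perm.mul_apply, heq, ← Equiv.Perm.mul_apply, ← pow_add,
      Nat.sub_add_cancel hb.le]
    exact hpos q
  let I : Finset {q : G.Dart × Bool // q.1.fst = r.1.fst} :=
    Finset.univ.filter (fun q => ring1 E q.1 ∈ outX E big x)
  obtain ⟨g0, hg0, -⟩ := (sep_top hP.tri (lin P α β) (hP.harm α β)).1
  have hIne : I.Nonempty := by
    obtain ⟨⟨o, ho, -⟩, -⟩ := hg0.2 _ (inact_univ hbd)
    obtain ⟨q, hq, rfl⟩ := out_in_ring ho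
    exact ⟨⟨q, hq⟩, by simp [I]; exact ho⟩
  obtain ⟨q1, hq1, hmin1⟩ := Finset.exists_min_image I pos hIne
  obtain ⟨q2, hq2, hmax2⟩ := Finset.exists_max_image I pos hIne
  have m1 : ring1 E q1.1 ∈ outX E big x := by simpa [I] using hq1
  have m2 : ring1 E q2.1 ∈ outX E big x := by simpa [I] using hq2
  have hg : ∃ g, HGood (outX E big) (bdX E) Finset.univ g ∧
      (∀ x y, lin P α β x < lin P α β y → g x < g y) ∧ g x < g (ring1 E q1.1) ∧ g x < g (ring1 E q2.1) := by
    by_cases h12 : ring1 E q1.1 = ring1 E q2.1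
    · obtain ⟨g, h1, h2, h3⟩ := sep_pair hP α β x (ring1 E q1.1) (hne _ q1.2).symm (htie _ m1).symm
      exact ⟨g, h1, h2, h3, by rw [← h12]; exact h3⟩
    · obtain ⟨g, h1, h2, h3, h4⟩ := (sep_top hP.tri (lin P α β) (hP.harm α β)).2 x (ring1 E q1.1)
        (ring1 E q2.1) (hne _ q1.2).symm (hne _ q2.2).symm h12 (htie _ m1).symm
        ((htie _ m1).trans (htie _ m2).symm)
      exact ⟨g, h1, h2, h3, h3.trans h4⟩
  obtain ⟨g, hgood, href, hs1, hs2⟩ := hg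
  obtain ⟨⟨o, ho, hlo⟩, -⟩ := hgood.2 _ (inact_univ hbd)
  obtain ⟨q, hq, rfl⟩ := out_in_ring ho
  have hqI : (⟨q, hq⟩ : {q : G.Dart × Bool // q.1.fst = r.1.fst}) ∈ I := by simp [I]; exact ho
  have c1 := hmin1 _ hqI
  have c2 := hmax2 _ hqI
  set q' : {q : G.Dart × Bool // q.1.fst = r.1.fst} := ⟨q, hq⟩ with hq'
  let s : ℕ → Prop := fun k => rs E g ((rho E ^ k) r)
  have hsx : ∀ p : {q : G.Dart × Bool // q.1.fst = r.1.fst}, s (pos p) ↔ g x < g (ring1 E p.1) := by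
    intro p
    simp only [s, rs, hpos p, p.2, hx]
  have s0 : ¬ s 0 := by
    simp only [s, rs, pow_zero, Equiv.Perm.coe_one, id]
    exact not_lt.2 (href _ _ h0).le
  have t1 : s (pos q1) := (hsx q1).2 hs1
  have t2 : s (pos q2) := (hsx q2).2 hs2
  have t3 : ¬ s (pos q') := fun h => absurd ((hsx q').1 h) (not_lt.2 hlo.le)
  obtain ⟨k1, -, hk1, u1, u1'⟩ := exists_up 0 (pos q1) (Nat.zero_le _) s0 t1
  obtain ⟨k2, hk2, hk2', u2, u2'⟩ := exists_up (pos q') (pos q2) c2 t3 t2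
  have hup : ∀ k, ¬ s k → s (k + 1) → upR E g ((rho E ^ k) r) := by
    intro k a b
    refine ⟨a, ?_⟩
    simp only [s, pow_succ', Equiv.Perm.mul_apply] at b
    exact b
  have := ring_up g hgood (pos_loc hP hab href) ((rho E ^ k1) r) ((rho E ^ k2) r)
    (by rw [rho_pow_fst, rho_pow_fst]) (hup _ u1 u1') (hup _ u2 u2')
  exact hdist q2 k1 k2 (by omega) hk2' this

theorem ring1_ne_self (q : G.Dart × Bool) (h : q.2 = false ∨ E.angleFace q.1 ≠ E.outer) :
    ring1 E q ≠ XT.vx q.1.fst := by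
  obtain ⟨d, t⟩ := q
  cases t with
  | false =>
    intro he
    have : d.snd = d.fst := by simpa [ring1] using he
    exact d.adj.ne this.symm
  | true =>
    have h' : E.angleFace d ≠ E.outer := by simpa using h
    intro he
    simp only [ring1] at he
    rw [zX_of_ne h'] at he
    simp at he

theorem ring1_succ_ne (q : G.Dart × Bool) (h : E.angleFace q.1 ≠ E.outer) :
    ring1 E q ≠ ring1 E (rho E q) := by
  obtain ⟨d, t⟩ := q
  cases t with
  | false => simp [ring1, rho_false, zX_of_ne h]
  | true => simp [ring1, rho_true, zX_of_ne h]

/-- ring positions r, rho r, rho rho r ; triangles (r, rho r) good implies next good. -/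
theorem ring_step (hP : Pos E big P) (r : G.Dart × Bool)
    (b0 : E.angleFace r.1 ≠ E.outer) (b1 : E.angleFace (rho E r).1 ≠ E.outer)
    (hgood : 0 < det3 (P (XT.vx r.1.fst)) (P (ring1 E r)) (P (ring1 E (rho E r)))) :
    0 < det3 (P (XT.vx r.1.fst)) (P (ring1 E (rho E r))) (P (ring1 E (rho E (rho E r)))) := by
  by_contra hcon
  set x := XT.vx (E := E) r.1.fst with hx
  set r1 := ring1 E (rho E r) with hr1
  let α := -((P r1).2 - (P x).2)
  let β := (P r1).1 - (P x).1
  have hf : ∀ y, lin P α β y - lin P α β x = det3 (P x) (P r1) (P y) := by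
    intro y; simp only [lin, α, β, det3]; ring
  have hab : α ≠ 0 ∨ β ≠ 0 := by
    by_contra hc; push Not at hc
    have h1 : (P r1).2 - (P x).2 = 0 := by have := hc.1; simp only [α] at this; linarith
    have h2 : (P r1).1 - (P x).1 = 0 := hc.2
    unfold det3 at hgood
    rw [h1, h2] at hgood; simp at hgood
  have f0 : lin P α β (ring1 E r) < lin P α β x := by
    have := hf (ring1 E r); rw [det3_swap] at this; linarith
  have f1 : lin P α β x = lin P α β r1 := by
    have := hf r1
    have h0 : det3 (P x) (P r1) (P r1) = 0 := by unfold det3; ring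
    linarith
  have f2 : lin P α β (ring1 E (rho E (rho E r))) ≤ lin P α β x := by
    have := hf (ring1 E (rho E (rho E r))); linarith
  have hx1 : x ≠ r1 := by
    have := ring1_ne_self (rho E r) (Or.inr b1)
    rw [rho_fst] at this; exact this.symm
  have hr12 : r1 ≠ ring1 E (rho E (rho E r)) := ring1_succ_ne _ b1
  have hx2 : x ≠ ring1 E (rho E (rho E r)) := by
    have : (rho E (rho E r)).2 = false ∨ E.angleFace (rho E (rho E r)).1 ≠ E.outer := by
      obtain ⟨d, t⟩ := r
      cases t with
      | false => left; rfl
      | true => right; exact b1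
    have := ring1_ne_self (rho E (rho E r)) this
    rw [rho_fst, rho_fst] at this; exact this.symm
  have hg : ∃ g, HGood (outX E big) (bdX E) Finset.univ g ∧
      (∀ x y, lin P α β x < lin P α β y → g x < g y) ∧ g x < g r1 ∧
        g (ring1 E (rho E (rho E r))) < g x := by
    rcases f2.lt_or_eq with hlt | heq
    · obtain ⟨g, h1, h2, h3⟩ := sep_pair hP α β x r1 hx1 f1
      exact ⟨g, h1, h2, h3, h2 _ _ hlt⟩
    · obtain ⟨g, h1, h2, h3, h4⟩ := (sep_top hP.tri (lin P α β) (hP.harm α β)).2 _ _ _ hx2.symm hr12.symm hx1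
        heq f1
      exact ⟨g, h1, h2, h4, h3⟩
  obtain ⟨g, hgg, href, g1, g2⟩ := hg
  have hloc := pos_loc hP hab href
  have s0 : ¬ rs E g r := not_lt.2 (href _ _ f0).le
  have s1 : rs E g (rho E r) := by unfold rs; rw [rho_fst]; exact g1
  have s2 : ¬ rs E g (rho E (rho E r)) := by
    unfold rs; rw [rho_fst, rho_fst]; exact not_lt.2 g2.le
  have honly := ring_only g hgg hloc r s0 s1 s2
  have hinj : Function.Injective g := fun a b hab => hgg.1 (by simp) (by simp) hab
  by_cases hbd : bdX E x
  · obtain ⟨e, he, hev⟩ := hbd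
    have hev' : e.fst = r.1.fst := by have : r.1.fst = e.fst := by simpa [hx] using hev
                                      exact this.symm
    apply ring_noup g hgg hloc r ⟨s0, s1⟩
    refine ⟨e, he, hev', ?_, ?_⟩
    · by_contra hc
      have hlt : g (XT.vx e.fst) < g (XT.vx e.snd) := lt_of_le_of_ne (not_lt.1 hc)
        (fun e' => e.adj.ne (by simpa using hinj e'))
      have := honly (e, false) hev' hlt
      rw [← this] at b1
      exact b1 he
    · by_contra hc
      have hlt : g (XT.vx e.fst) < g (XT.vx (E.rot e).snd) := lt_of_le_of_ne (not_lt.1 hc)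
        (fun e' => by
          have := (E.rot e).adj.ne
          rw [E.rot_fst] at this
          exact this (by simpa using hinj e'))
      have := honly (E.rot e, false) ((E.rot_fst e).trans hev') (by
        unfold rs; simp only [E.rot_fst]; exact hlt)
      have h3 : rho E (e, true) = rho E r := this
      have := (rho E).injective h3
      rw [← this] at b0
      exact b0 he
  · -- interior
    have hout : ∀ o ∈ outX E big x, lin P α β o ≤ lin P α β x := by
      intro o ho
      obtain ⟨q, hq, rfl⟩ := out_in_ring ho
      by_contra hc
      have := honly q hq (by unfold rs; rw [hq]; exact href _ _ (not_le.1 hc))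
      rw [this] at hc
      exact hc f1.symm.le
    have htie : ∀ o ∈ outX E big x, lin P α β o = lin P α β x := by
      rcases weak_of_sum _ _ (hP.harm α β x hbd) with h | h
      · exact h
      · obtain ⟨-, o, ho, hlt⟩ := h
        exact absurd hlt (not_lt.2 (hout o ho))
    refine tied_contra hP hab r hbd f0 ?_ htie
    intro q hq
    have := ring1_ne_self q (Or.inr (fun ho => hbd ⟨q.1, ho, by rw [hx, hq]⟩))
    rwa [hq] at this

end R4


set_option linter.unusedSectionVars false
set_option linter.unusedSimpArgs false
set_option linter.unusedVariables false

section R4b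

variable {V : Type} [Fintype V] [DecidableEq V] {G : SimpleGraph V} [DecidableRel G.Adj]
variable {E : PlaneEmb G} {big : G.Dart → Prop} {P : XT E → ℝ × ℝ}

def gd (P : XT E → ℝ × ℝ) (d : G.Dart) : Prop :=
  0 < det3 (P (XT.vx d.fst)) (P (XT.vx d.snd)) (P (zX E d))

theorem gd_bounded {d : G.Dart} (h : gd P d) : E.angleFace d ≠ E.outer := by
  intro ho
  unfold gd at h
  rw [zX_outer ho] at h
  unfold det3 at h
  simp at h

theorem gd_start (hP : Pos E big P) {e : G.Dart} (he : E.angleFace e = E.outer) : gd P (E.rot e) := by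
  classical
  have hb : E.angleFace (E.rot e) ≠ E.outer := by
    intro h
    have := sides_ne hP.nd (E.rot e)
    rw [angleFace_rot_symm, he, h] at this
    exact this rfl
  unfold gd
  rw [E.rot_fst]
  set v := XT.vx (E := E) e.fst with hv
  set w := XT.vx (E := E) (E.rot e).snd with hw
  set z := zX E (E.rot e) with hz
  let g : XT E → ℝ := fun x => - det3 (P v) (P w) (P x)
  have gl : ∀ o x, g o - g x = lin P ((P w).2 - (P v).2) (-((P w).1 - (P v).1)) o -
      lin P ((P w).2 - (P v).2) (-((P w).1 - (P v).1)) x := by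
    intro o x; simp only [g, lin, det3]; ring
  have gh : ∀ x, ¬ bdX E x → ∑ o ∈ outX E big x, (g o - g x) = 0 := by
    intro x hx
    rw [← hP.harm ((P w).2 - (P v).2) (-((P w).1 - (P v).1)) x hx]
    exact Finset.sum_congr rfl (fun o _ => gl o x)
  have gv : g v = 0 := by simp [g, det3]
  have gw : g w = 0 := by simp only [g, det3]; ring
  have gb : ∀ x, bdX E x → x = v ∨ x = w ∨ g x < 0 := by
    rintro x ⟨e', he', rfl⟩
    by_cases h1 : e'.fst = e.fst
    · left; rw [h1]
    by_cases h2 : e'.fst = (E.rot e).snd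
    · right; left; rw [h2]
    · right; right
      have := hP.conv e e' he he' h1 h2
      simp only [g]; linarith
  have g0 : ∀ x, g x ≤ 0 := by
    apply harm_max hP.tri Finset.univ g
    · intro x hx
      have hbx : bdX E x := by by_contra hc; exact hx (inact_univ hc)
      rcases gb x hbx with h | h | h
      · rw [h, gv]
      · rw [h, gw]
      · exact h.le
    · intro x hx; exact gh x hx.2.1
  by_contra hcon
  have gz : g z = 0 := le_antisymm (g0 z) (by simp only [g]; linarith)
  let K := Finset.univ.filter (fun x => g x = 0)
  have hK : ∀ x ∈ K, ¬ bdX E x → Inact (outX E big) (bdX E) K x := by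
    intro x hx hbx
    refine ⟨hx, hbx, fun o ho => ?_⟩
    have hx0 : g x = 0 := by simpa [K] using hx
    rcases weak_of_sum g x (gh x hbx) with h | ⟨-, o', ho', h⟩
    · simp [K, h o ho, hx0]
    · rw [hx0] at h; exact absurd (g0 o') (not_le.2 h)
  have hzb : ¬ bdX E z := by
    rintro ⟨d, -, h⟩
    rw [hz, zX_of_ne hb] at h; simp at h
  obtain ⟨a, b, c, ha, hb', hc, hab, hac, hbc, na, nb, nc⟩ := hP.tri K ⟨z, hK z (by simp [K, gz]) hzb⟩
  have key : ∀ a ∈ K, ¬ Inact (outX E big) (bdX E) K a → a = v ∨ a = w := by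
    intro a ha hn
    have : bdX E a := by by_contra hc; exact hn (hK a ha hc)
    rcases gb a this with h | h | h
    · exact Or.inl h
    · exact Or.inr h
    · have : g a = 0 := by simpa [K] using ha
      rw [this] at h; exact absurd h (lt_irrefl _)
  rcases key a ha na with h1 | h1 <;> rcases key b hb' nb with h2 | h2 <;>
    rcases key c hc nc with h3 | h3 <;> simp_all

theorem zX_psi {d : G.Dart} (h : E.angleFace d ≠ E.outer) : zX E (psi E d) = zX E d := by
  have := zX_psi_symm (E := E) (d := psi E d) (by rw [angleFace_psi]; exact h)
  rw [Equiv.symm_apply_apply] at this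
  exact this.symm

theorem gd_snd (hP : Pos E big P) {d : G.Dart} (h : gd P d) :
    0 < det3 (P (XT.vx d.fst)) (P (zX E d)) (P (XT.vx (E.rot d).snd)) := by
  have hb := gd_bounded h
  exact ring_step hP (d, false) hb hb h

theorem gd_psi (hP : Pos E big P) {d : G.Dart} (h : gd P d) : gd P (psi E d) := by
  unfold gd
  rw [zX_psi (gd_bounded h), psi_fst, psi_snd, ← det3_cyc]
  exact gd_snd hP h

theorem gd_rot (hP : Pos E big P) {d : G.Dart} (h : gd P d)
    (hb : E.angleFace (E.rot d) ≠ E.outer) : gd P (E.rot d) := by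
  have := ring_step hP (d, true) (gd_bounded h) hb (gd_snd hP h)
  unfold gd
  rw [E.rot_fst]
  exact this

theorem rot_pow_mem (T : Set G.Dart) (h : ∀ d ∈ T, E.rot d ∈ T) (d d' : G.Dart)
    (hd : d ∈ T) (hdd : d.fst = d'.fst) : d' ∈ T := by
  obtain ⟨n, rfl⟩ := E.rot_vertex d d' hdd
  clear hdd
  induction n with
  | zero => exact hd
  | succ n ih => rw [pow_succ', Equiv.Perm.mul_apply]; exact h _ ih

theorem dart_ind (T : Set G.Dart) (h1 : ∀ d ∈ T, E.rot d ∈ T) (h2 : ∀ d ∈ T, psi E d ∈ T)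
    (d0 : G.Dart) (h0 : d0 ∈ T) (d : G.Dart) : d ∈ T := by
  have hr := E.connected.preconnected d0.fst d.fst
  rw [SimpleGraph.reachable_iff_reflTransGen] at hr
  have : ∀ v, Relation.ReflTransGen G.Adj d0.fst v → ∀ d : G.Dart, d.fst = v → d ∈ T := by
    intro v hv
    induction hv with
    | refl => intro d hd; exact rot_pow_mem T h1 d0 d h0 hd.symm
    | tail _ hadj ih =>
      rename_i b c _
      intro d hd
      let a : G.Dart := ⟨(b, c), hadj⟩
      have ha : E.rot.symm a ∈ T := ih _ (rot_symm_fst E a)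
      have hs := h2 _ ha
      rw [psi_apply, Equiv.apply_symm_apply] at hs
      exact rot_pow_mem T h1 _ d hs hd.symm
  exact this _ hr d rfl

theorem gd_all (hP : Pos E big P) (d : G.Dart) (hb : E.angleFace d ≠ E.outer) : gd P d := by
  obtain ⟨e, he⟩ := face_surj E E.outer
  have h1 : ∀ d ∈ {d | E.angleFace d = E.outer ∨ gd P d}, E.rot d ∈ {d | E.angleFace d = E.outer ∨ gd P d} := by
    rintro d (hd | hd)
    · exact Or.inr (gd_start hP hd)
    · by_cases h : E.angleFace (E.rot d) = E.outer
      · exact Or.inl h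
      · exact Or.inr (gd_rot hP hd h)
  have h2 : ∀ d ∈ {d | E.angleFace d = E.outer ∨ gd P d}, psi E d ∈ {d | E.angleFace d = E.outer ∨ gd P d} := by
    rintro d (hd | hd)
    · exact Or.inl (by rw [angleFace_psi]; exact hd)
    · exact Or.inr (gd_psi hP hd)
  exact (dart_ind _ h1 h2 e (Or.inl he) d).resolve_left hb

theorem np_bounded (hP : Pos E big P) {d : G.Dart} (hn : ¬ PointedVx big d.fst) :
    E.angleFace d ≠ E.outer := fun h => hn ⟨d, hP.cpt.outer_big d h, rfl⟩

theorem del_np (hP : Pos E big P) (d : G.Dart) (hn : ¬ PointedVx big d.fst) :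
    0 < det3 (P (XT.vx d.fst)) (P (XT.vx d.snd)) (P (XT.vx (E.rot d).snd)) := by
  by_contra hcon
  have hg := gd_all hP d (np_bounded hP hn)
  have hg2 := gd_snd hP hg
  unfold gd at hg
  have hbd : ¬ bdX E (XT.vx d.fst) := by
    rintro ⟨e, he, hev⟩
    have : d.fst = e.fst := by simpa using hev
    exact hn ⟨e, hP.cpt.outer_big e he, this.symm⟩
  set x := XT.vx (E := E) d.fst with hx
  set r0 := XT.vx (E := E) d.snd with hr0
  set r1 := zX E d with hr1
  set r2 := XT.vx (E := E) (E.rot d).snd with hr2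
  let α := -((P r0).2 - (P x).2) + ((P r2).2 - (P x).2)
  let β := ((P r0).1 - (P x).1) - ((P r2).1 - (P x).1)
  have hf : ∀ y, lin P α β y - lin P α β x = det3 (P x) (P r0) (P y) + det3 (P x) (P y) (P r2) := by
    intro y; simp only [lin, α, β, det3]; ring
  have f1 : lin P α β x < lin P α β r1 := by have := hf r1; linarith
  have z0 : ∀ a b : ℝ × ℝ, det3 a b b = 0 := by intro a b; unfold det3; ring
  have f0 : lin P α β r0 - lin P α β x = det3 (P x) (P r0) (P r2) := by rw [hf, z0]; ring
  have f2 : lin P α β r2 - lin P α β x = det3 (P x) (P r0) (P r2) := by rw [hf, z0]; ring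
  have hab : α ≠ 0 ∨ β ≠ 0 := by
    by_contra hc; push Not at hc
    unfold lin at f1
    rw [hc.1, hc.2] at f1; simp at f1
  have n02 : r0 ≠ r2 := by
    intro h; exact rot_snd_ne hP.nd d (by simpa [hr0, hr2] using h.symm)
  have n0x : r0 ≠ x := by
    intro h; exact d.adj.ne (by simpa [hr0, hx] using h.symm)
  have n2x : r2 ≠ x := by
    intro h
    have := (E.rot d).adj.ne
    rw [E.rot_fst] at this
    exact this (by simpa [hr2, hx] using h.symm)
  have hgx : ∃ g, HGood (outX E big) (bdX E) Finset.univ g ∧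
      (∀ x y, lin P α β x < lin P α β y → g x < g y) ∧ g r0 < g x ∧ g r2 < g x := by
    rcases (not_lt.1 hcon).lt_or_eq with hlt | heq
    · obtain ⟨g, h1, h2⟩ := (sep_top hP.tri (lin P α β) (hP.harm α β)).1
      exact ⟨g, h1, h2, h2 _ _ (by linarith), h2 _ _ (by linarith)⟩
    · obtain ⟨g, h1, h2, h3, h4⟩ := (sep_top hP.tri (lin P α β) (hP.harm α β)).2 r0 r2 x n02 n0x n2x
        (by linarith) (by linarith)
      exact ⟨g, h1, h2, h3.trans h4, h4⟩
  obtain ⟨g, hgg, href, g0, g2⟩ := hgx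
  have honly := ring_only g hgg (pos_loc hP hab href) (d, false) (not_lt.2 g0.le) (href _ _ f1)
    (by
      unfold rs; rw [rho_fst, rho_fst, rho_false, rho_true]; exact not_lt.2 g2.le)
  obtain ⟨-, o, ho, hlt⟩ := hgg.2 _ (inact_univ hbd)
  rw [mem_outX] at ho
  rcases ho with ⟨-, w, hw, rfl⟩ | ⟨d', hb', hd', -⟩
  · have := honly (⟨(d.fst, w), hw⟩, false) rfl hlt
    simp [rho_false] at this
  · exact hn ⟨d', hb', hd'⟩

theorem del_big (hP : Pos E big P) (d : G.Dart) (hb : big d) :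
    det3 (P (XT.vx d.fst)) (P (XT.vx d.snd)) (P (XT.vx (E.rot d).snd)) < 0 := by
  classical
  by_cases ho : E.angleFace d = E.outer
  · have := hP.conv d ((psi E).symm d) ho (by rw [angleFace_psi_symm]; exact ho)
      (by rw [psi_symm_fst]; exact d.adj.ne.symm)
      (by rw [psi_symm_fst]; exact (rot_snd_ne hP.nd d).symm)
    rw [psi_symm_fst, det3_swap] at this
    linarith
  · have hg := gd_all hP d ho
    unfold gd at hg
    have hbd : ¬ bdX E (XT.vx d.fst) := by
      rintro ⟨e, he, hev⟩
      have h1 : d.fst = e.fst := by simpa using hev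
      have := hP.cpt.one_big d e hb (hP.cpt.outer_big e he) h1
      rw [this] at ho; exact ho he
    have hout : outX E big (XT.vx d.fst) = {XT.vx d.snd, XT.vx (E.rot d).snd, zX E d} := by
      ext y
      rw [mem_outX]
      simp only [Finset.mem_insert, Finset.mem_singleton]
      constructor
      · rintro (⟨hn, -⟩ | ⟨d', hb', hd', h⟩)
        · exact absurd ⟨d, hb, rfl⟩ hn
        · rw [hP.cpt.one_big d' d hb' hb hd'] at h; exact h
      · intro h; exact Or.inr ⟨d, hb, rfl, h⟩
    have n1 : XT.vx (E := E) d.snd ≠ XT.vx (E.rot d).snd := by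
      intro h; exact rot_snd_ne hP.nd d (by simpa using h.symm)
    have n2 : XT.vx (E := E) d.snd ≠ zX E d := by rw [zX_of_ne ho]; simp
    have n3 : XT.vx (E := E) (E.rot d).snd ≠ zX E d := by rw [zX_of_ne ho]; simp
    have h1 := hP.harm 1 0 _ hbd
    have h2 := hP.harm 0 1 _ hbd
    rw [hout, Finset.sum_insert (by simp [n1, n2]), Finset.sum_insert (by simp [n3]), Finset.sum_singleton] at h1 h2
    simp only [lin, one_mul, zero_mul, add_zero, zero_add] at h1 h2
    unfold det3 at *
    have e1 : (P (XT.vx (E.rot d).snd)).1 - (P (XT.vx d.fst)).1 =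
      - ((P (XT.vx d.snd)).1 - (P (XT.vx d.fst)).1) - ((P (zX E d)).1 - (P (XT.vx d.fst)).1) := by linarith
    have e2 : (P (XT.vx (E.rot d).snd)).2 - (P (XT.vx d.fst)).2 =
      - ((P (XT.vx d.snd)).2 - (P (XT.vx d.fst)).2) - ((P (zX E d)).2 - (P (XT.vx d.fst)).2) := by linarith
    rw [e1, e2]
    linarith

end R4b


set_option linter.unusedSectionVars false
set_option linter.unusedSimpArgs false
set_option linter.unusedVariables false

section R5

variable {V : Type} [Fintype V] [DecidableEq V] {G : SimpleGraph V} [DecidableRel G.Adj]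
variable {E : PlaneEmb G} {big : G.Dart → Prop}

theorem tau_exists (hcpt : IsCPTLabelling E big) : ∃ τ : V → ℕ, Function.Injective τ ∧
    ∀ e : G.Dart, E.angleFace e = E.outer → τ (E.rot e).snd = τ e.fst + 1 ∨
      ∀ e' : G.Dart, E.angleFace e' = E.outer → τ (E.rot e).snd ≤ τ e'.fst ∧ τ e'.fst ≤ τ e.fst := by
  classical
  obtain ⟨e0, he0⟩ := face_surj E E.outer
  have hex : ∀ e : {e : G.Dart // E.angleFace e = E.outer}, ∃ i : ℕ, ((psi E) ^ i) e0 = e.1 := by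
    intro e
    have := (angleFace_eq_iff E e0 e.1).1 (he0.trans e.2.symm)
    exact this.exists_nat_pow_eq
  let ix : {e : G.Dart // E.angleFace e = E.outer} → ℕ := fun e => Nat.find (hex e)
  have ixs : ∀ e, ((psi E) ^ (ix e)) e0 = e.1 := fun e => Nat.find_spec (hex e)
  have ixm : ∀ e k, ((psi E) ^ k) e0 = e.1 → ix e ≤ k := fun e k h => Nat.find_min' (hex e) h
  let M := Finset.univ.sup ix
  have hM : ∀ e, ix e ≤ M := fun e => Finset.le_sup (Finset.mem_univ e)
  let τ : V → ℕ := fun v =>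
    if h : ∃ e : {e : G.Dart // E.angleFace e = E.outer}, e.1.fst = v then ix h.choose
    else M + 1 + (Fintype.equivFin V v : ℕ)
  have τb : ∀ e (he : E.angleFace e = E.outer), τ e.fst = ix ⟨e, he⟩ := by
    intro e he
    have h : ∃ e' : {e : G.Dart // E.angleFace e = E.outer}, e'.1.fst = e.fst := ⟨⟨e, he⟩, rfl⟩
    have hc : h.choose = ⟨e, he⟩ := Subtype.ext (hcpt.one_big _ _ (hcpt.outer_big _ h.choose.2)
      (hcpt.outer_big e he) h.choose_spec)
    simp only [τ]
    rw [dif_pos h, hc]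
  refine ⟨τ, ?_, ?_⟩
  · intro v w hvw
    by_cases hv : ∃ e : {e : G.Dart // E.angleFace e = E.outer}, e.1.fst = v <;>
      by_cases hw : ∃ e : {e : G.Dart // E.angleFace e = E.outer}, e.1.fst = w
    · obtain ⟨⟨e, he⟩, rfl⟩ := hv
      obtain ⟨⟨e', he'⟩, rfl⟩ := hw
      simp only at *
      rw [τb e he, τb e' he'] at hvw
      have h1 := ixs ⟨e, he⟩
      rw [hvw, ixs] at h1
      simp only at h1
      rw [h1]
    · simp only [τ] at hvw
      rw [dif_pos hv, dif_neg hw] at hvw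
      have := hM hv.choose; omega
    · simp only [τ] at hvw
      rw [dif_pos hw, dif_neg hv] at hvw
      have := hM hw.choose; omega
    · simp only [τ] at hvw
      rw [dif_neg hv, dif_neg hw] at hvw
      exact (Fintype.equivFin V).injective (Fin.ext (by omega))
  · intro e he
    have hp : E.angleFace (psi E e) = E.outer := by rw [angleFace_psi]; exact he
    have h1 : τ (E.rot e).snd = ix ⟨psi E e, hp⟩ := τb (psi E e) hp
    rw [h1, τb e he]
    have hs : ((psi E) ^ (ix ⟨e, he⟩ + 1)) e0 = psi E e := by
      rw [pow_succ', Equiv.Perm.mul_apply, ixs]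
    have hle := ixm ⟨psi E e, hp⟩ _ hs
    rcases hle.eq_or_lt with h | h
    · exact Or.inl h
    · right
      have hz : ix ⟨psi E e, hp⟩ = 0 := by
        by_contra hne
        obtain ⟨j, hj⟩ := Nat.exists_eq_succ_of_ne_zero hne
        have := ixs ⟨psi E e, hp⟩
        rw [hj, Nat.succ_eq_add_one, pow_succ', Equiv.Perm.mul_apply] at this
        have := ixm ⟨e, he⟩ j ((psi E).injective this)
        omega
      have hfix : ((psi E) ^ (ix ⟨e, he⟩ + 1)) e0 = e0 := by
        have := ixs ⟨psi E e, hp⟩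
        rw [hz] at this
        rw [hs]; exact this.symm
      intro e' he'
      rw [τb e' he', hz]
      refine ⟨Nat.zero_le _, ?_⟩
      by_contra hc
      have := ixm ⟨e', he'⟩ (ix ⟨e', he'⟩ - (ix ⟨e, he⟩ + 1)) (by
        conv_lhs => rw [← hfix]
        rw [← Equiv.Perm.mul_apply, ← pow_add, Nat.sub_add_cancel (by omega)]
        exact ixs _)
      omega

/-- the geometric package -/
structure Geo (E : PlaneEmb G) (big : G.Dart → Prop) (P : XT E → ℝ × ℝ) (τ : V → ℕ) : Prop where
  cpt : IsCPTLabelling E big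
  nd : NonDegenerateFaces E
  gen : ∀ u v w : V, u ≠ v → u ≠ w → v ≠ w → det3 (P (XT.vx u)) (P (XT.vx v)) (P (XT.vx w)) ≠ 0
  good : ∀ d, E.angleFace d ≠ E.outer → gd P d
  np : ∀ d : G.Dart, ¬ PointedVx big d.fst →
    0 < det3 (P (XT.vx d.fst)) (P (XT.vx d.snd)) (P (XT.vx (E.rot d).snd))
  bg : ∀ d : G.Dart, big d →
    det3 (P (XT.vx d.fst)) (P (XT.vx d.snd)) (P (XT.vx (E.rot d).snd)) < 0
  inj : Function.Injective τ
  par : ∀ e : G.Dart, E.angleFace e = E.outer → P (XT.vx e.fst) = ((τ e.fst : ℝ), (τ e.fst : ℝ) ^ 2)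
  step : ∀ e : G.Dart, E.angleFace e = E.outer → τ e.snd < τ e.fst → τ e.fst = τ e.snd + 1

theorem det_par (v w u : ℝ) : det3 (v, v ^ 2) (w, w ^ 2) (u, u ^ 2) = (w - v) * (u - v) * (u - w) := by
  unfold det3; ring

theorem pos_exists (hcpt : IsCPTLabelling E big) (hnd : NonDegenerateFaces E)
    (ht : TriP (outX E big) (bdX E)) (τ : V → ℕ) (hinj : Function.Injective τ)
    (hτ : ∀ e : G.Dart, E.angleFace e = E.outer → τ (E.rot e).snd = τ e.fst + 1 ∨
      ∀ e' : G.Dart, E.angleFace e' = E.outer → τ (E.rot e).snd ≤ τ e'.fst ∧ τ e'.fst ≤ τ e.fst) :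
    ∃ P : XT E → ℝ × ℝ, Pos E big P ∧
      ∀ e : G.Dart, E.angleFace e = E.outer → P (XT.vx e.fst) = ((τ e.fst : ℝ), (τ e.fst : ℝ) ^ 2) := by
  obtain ⟨Φ, h1, h2⟩ := harm_exists ht Finset.univ
  let φ : XT E → ℝ := fun x => match x with
    | XT.vx v => (τ v : ℝ)
    | XT.fc _ _ => 0
  let P : XT E → ℝ × ℝ := fun x => (Φ φ x, Φ (fun x => φ x ^ 2) x)
  have hb : ∀ e : G.Dart, E.angleFace e = E.outer → P (XT.vx e.fst) = ((τ e.fst : ℝ), (τ e.fst : ℝ) ^ 2) := by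
    intro e he
    have hn : ¬ Inact (outX E big) (bdX E) Finset.univ (XT.vx e.fst) := fun h => h.2.1 ⟨e, he, rfl⟩
    simp only [P]
    rw [h1 _ _ hn, h1 _ _ hn]
  refine ⟨P, ⟨hcpt, hnd, ht, ?_, ?_⟩, hb⟩
  · intro α β x hx
    have a := h2 φ x (inact_univ hx)
    have b := h2 (fun x => φ x ^ 2) x (inact_univ hx)
    have : ∀ o, lin P α β o - lin P α β x = α * (Φ φ o - Φ φ x) +
        β * (Φ (fun x => φ x ^ 2) o - Φ (fun x => φ x ^ 2) x) := by
      intro o; simp only [lin, P]; ring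
    simp only [this]
    rw [Finset.sum_add_distrib, ← Finset.mul_sum, ← Finset.mul_sum, a, b]; ring
  · intro e e' he he' n1 n2
    have hp : E.angleFace (psi E e) = E.outer := by rw [angleFace_psi]; exact he
    have hw := hb (psi E e) hp
    rw [psi_fst] at hw
    rw [hb e he, hw, hb e' he', det_par]
    have m1 : τ e'.fst ≠ τ e.fst := fun h => n1 (hinj h)
    have m2 : τ e'.fst ≠ τ (E.rot e).snd := fun h => n2 (hinj h)
    have m3 : τ (E.rot e).snd ≠ τ e.fst := fun h => by
      have := (E.rot e).adj.ne
      rw [E.rot_fst] at this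
      exact this (hinj h).symm
    rcases hτ e he with h | h
    · rcases lt_or_gt_of_ne m1 with h' | h'
      · have a1 : (τ e'.fst : ℝ) < τ e.fst := by exact_mod_cast h'
        have a2 : (τ (E.rot e).snd : ℝ) = τ e.fst + 1 := by exact_mod_cast h
        rw [a2]
        have : 0 < (τ e.fst - τ e'.fst : ℝ) * (τ e.fst + 1 - τ e'.fst) := mul_pos (by linarith) (by linarith)
        nlinarith
      · have a1 : (τ e.fst + 1 : ℝ) < τ e'.fst := by
          have : τ e.fst + 1 < τ e'.fst := by omega
          exact_mod_cast this
        have a2 : (τ (E.rot e).snd : ℝ) = τ e.fst + 1 := by exact_mod_cast h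
        rw [a2]
        have : 0 < (τ e'.fst - τ e.fst : ℝ) * (τ e'.fst - (τ e.fst + 1)) := mul_pos (by linarith) (by linarith)
        nlinarith
    · obtain ⟨k1, k2⟩ := h e' he'
      have a1 : (τ e'.fst : ℝ) < τ e.fst := by exact_mod_cast lt_of_le_of_ne k2 m1
      have a2 : (τ (E.rot e).snd : ℝ) < τ e'.fst := by exact_mod_cast lt_of_le_of_ne k1 m2.symm
      have := mul_pos (mul_pos (sub_pos.2 (a2.trans a1)) (sub_pos.2 a1)) (sub_pos.2 a2)
      nlinarith

theorem ev_ne (A B C : ℝ) (h : A + B + C ≠ 0) :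
    ∀ᶠ ε in nhdsWithin (0 : ℝ) (Set.Ioi 0), A + B * ε + C * ε ^ 2 ≠ 0 := by
  have hpos : ∀ᶠ ε in nhdsWithin (0 : ℝ) (Set.Ioi 0), 0 < ε := eventually_mem_nhdsWithin
  have cont : ∀ f : ℝ → ℝ, Continuous f → f 0 ≠ 0 → ∀ᶠ ε in nhdsWithin (0 : ℝ) (Set.Ioi 0), f ε ≠ 0 :=
    fun f hf h0 => (hf.continuousAt.eventually_ne h0).filter_mono nhdsWithin_le_nhds
  by_cases hA : A = 0
  · by_cases hB : B = 0
    · filter_upwards [hpos] with ε hε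
      subst hA hB
      have : C ≠ 0 := by simpa using h
      have : C * ε ^ 2 ≠ 0 := mul_ne_zero this (by positivity)
      simpa using this
    · filter_upwards [hpos, cont (fun ε => B + C * ε) (by fun_prop) (by simpa using hB)] with ε hε h2
      subst hA
      have := mul_ne_zero hε.ne' h2
      intro h3; apply this; linarith
  · exact cont (fun ε => A + B * ε + C * ε ^ 2) (by fun_prop) (by simpa using hA)

theorem geo_exists (hcpt : IsCPTLabelling E big) (hnd : NonDegenerateFaces E)
    (ht : TriP (outX E big) (bdX E)) : ∃ P τ, Geo E big P τ := by
  obtain ⟨τ, hinj, hτ⟩ := tau_exists hcpt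
  obtain ⟨P, hP, hb⟩ := pos_exists hcpt hnd ht τ hinj hτ
  let Q : ℝ → XT E → ℝ × ℝ := fun ε x => match x with
    | XT.vx v => ((P (XT.vx v)).1 + ε * ((τ v : ℝ) - (P (XT.vx v)).1),
        (P (XT.vx v)).2 + ε * ((τ v : ℝ) ^ 2 - (P (XT.vx v)).2))
    | XT.fc F h => P (XT.fc F h)
  have Q0 : Q 0 = P := by
    funext x; cases x <;> simp [Q]
  have Q1 : ∀ x, Continuous (fun ε => (Q ε x).1) := by
    intro x; cases x <;> simp only [Q] <;> fun_prop
  have Q2 : ∀ x, Continuous (fun ε => (Q ε x).2) := by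
    intro x; cases x <;> simp only [Q] <;> fun_prop
  have Qd : ∀ x y z, Continuous (fun ε => det3 (Q ε x) (Q ε y) (Q ε z)) := by
    intro x y z
    have := Q1 x; have := Q1 y; have := Q1 z; have := Q2 x; have := Q2 y; have := Q2 z
    unfold det3; fun_prop
  have evpos : ∀ x y z, 0 < det3 (P x) (P y) (P z) →
      ∀ᶠ ε in nhdsWithin (0 : ℝ) (Set.Ioi 0), 0 < det3 (Q ε x) (Q ε y) (Q ε z) := by
    intro x y z h
    have h0 : 0 < det3 (Q 0 x) (Q 0 y) (Q 0 z) := by rw [Q0]; exact h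
    exact (((Qd x y z).tendsto 0).eventually_const_lt h0).filter_mono nhdsWithin_le_nhds
  have e1 : ∀ᶠ ε in nhdsWithin (0 : ℝ) (Set.Ioi 0), ∀ t : V × V × V, t.1 ≠ t.2.1 → t.1 ≠ t.2.2 →
      t.2.1 ≠ t.2.2 → det3 (Q ε (XT.vx t.1)) (Q ε (XT.vx t.2.1)) (Q ε (XT.vx t.2.2)) ≠ 0 := by
    rw [Filter.eventually_all]
    rintro ⟨u, v, w⟩
    by_cases h : u ≠ v ∧ u ≠ w ∧ v ≠ w
    · obtain ⟨h1, h2, h3⟩ := h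
      let a1 := (P (XT.vx u)).1
      let a2 := (P (XT.vx u)).2
      let b1 := (P (XT.vx v)).1
      let b2 := (P (XT.vx v)).2
      let c1 := (P (XT.vx w)).1
      let c2 := (P (XT.vx w)).2
      let s : ℝ := τ u
      let t : ℝ := τ v
      let r : ℝ := τ w
      have hdet : (t - s) * (r - s) * (r - t) ≠ 0 := by
        have i : ∀ a b : V, a ≠ b → (τ b : ℝ) - τ a ≠ 0 := by
          intro a b hab hc
          have : (τ b : ℝ) = τ a := by linarith
          exact hab (hinj (by exact_mod_cast this.symm))
        exact mul_ne_zero (mul_ne_zero (i _ _ h1) (i _ _ h2)) (i _ _ h3)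
      have := ev_ne ((b1 - a1) * (c2 - a2) - (b2 - a2) * (c1 - a1))
        ((b1 - a1) * ((r ^ 2 - c2) - (s ^ 2 - a2)) + ((t - b1) - (s - a1)) * (c2 - a2)
          - (b2 - a2) * ((r - c1) - (s - a1)) - ((t ^ 2 - b2) - (s ^ 2 - a2)) * (c1 - a1))
        (((t - b1) - (s - a1)) * ((r ^ 2 - c2) - (s ^ 2 - a2))
          - ((t ^ 2 - b2) - (s ^ 2 - a2)) * ((r - c1) - (s - a1)))
        (by intro hc; apply hdet; rw [← hc]; ring)
      filter_upwards [this] with ε hε _ _ _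
      intro hc; apply hε
      rw [← hc]; simp only [det3, Q]; ring
    · refine Filter.Eventually.of_forall (fun ε h1 h2 h3 => absurd ⟨h1, h2, h3⟩ h)
  have e2 : ∀ᶠ ε in nhdsWithin (0 : ℝ) (Set.Ioi 0), ∀ d, E.angleFace d ≠ E.outer → gd (Q ε) d := by
    rw [Filter.eventually_all]
    intro d
    by_cases h : E.angleFace d ≠ E.outer
    · filter_upwards [evpos _ _ _ (gd_all hP d h)] with ε hε _ using hε
    · exact Filter.Eventually.of_forall (fun ε h' => absurd h' h)
  have e3 : ∀ᶠ ε in nhdsWithin (0 : ℝ) (Set.Ioi 0), ∀ d : G.Dart, ¬ PointedVx big d.fst →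
      0 < det3 (Q ε (XT.vx d.fst)) (Q ε (XT.vx d.snd)) (Q ε (XT.vx (E.rot d).snd)) := by
    rw [Filter.eventually_all]
    intro d
    by_cases h : ¬ PointedVx big d.fst
    · filter_upwards [evpos _ _ _ (del_np hP d h)] with ε hε _ using hε
    · exact Filter.Eventually.of_forall (fun ε h' => absurd h' h)
  have e4 : ∀ᶠ ε in nhdsWithin (0 : ℝ) (Set.Ioi 0), ∀ d : G.Dart, big d →
      0 < det3 (Q ε (XT.vx d.fst)) (Q ε (XT.vx (E.rot d).snd)) (Q ε (XT.vx d.snd)) := by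
    rw [Filter.eventually_all]
    intro d
    by_cases h : big d
    · have := del_big hP d h
      filter_upwards [evpos (XT.vx d.fst) (XT.vx (E.rot d).snd) (XT.vx d.snd)
        (by rw [det3_swap]; linarith)] with ε hε _ using hε
    · exact Filter.Eventually.of_forall (fun ε h' => absurd h' h)
  obtain ⟨ε, g1, g2, g3, g4⟩ := (e1.and (e2.and (e3.and e4))).exists
  refine ⟨Q ε, τ, hcpt, hnd, fun u v w => g1 (u, v, w), g2, g3, ?_, hinj, ?_, ?_⟩
  · intro d hd
    have := g4 d hd
    rw [det3_swap] at this; linarith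
  · intro e he
    simp only [Q]
    rw [hb e he]; simp
  · intro e he hlt
    have hp : E.angleFace ((psi E).symm e) = E.outer := by rw [angleFace_psi_symm]; exact he
    have := hτ _ hp
    rw [rot_psi_symm, psi_symm_fst] at this
    have e2 : e.symm.snd = e.fst := rfl
    rw [e2] at this
    rcases this with h | h
    · exact h
    · have := (h e he).2; omega

end R5


set_option linter.unusedSectionVars false
set_option linter.unusedSimpArgs false
set_option linter.unusedVariables false

section R6

variable {V : Type} [Fintype V] [DecidableEq V] {G : SimpleGraph V} [DecidableRel G.Adj]
variable {E : PlaneEmb G} {big : G.Dart → Prop}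

noncomputable def kap (q u w : ℝ × ℝ) : ℤ :=
  ind (u.1 ≤ q.1 ∧ ¬ w.1 ≤ q.1 ∧ 0 < det3 u w q) - ind (w.1 ≤ q.1 ∧ ¬ u.1 ≤ q.1 ∧ det3 u w q < 0)

theorem kap_anti (q u w : ℝ × ℝ) : kap q w u = - kap q u w := by
  have : det3 w u q = - det3 u w q := by unfold det3; ring
  unfold kap
  rw [this]
  simp only [Left.neg_pos_iff, Left.neg_neg_iff]
  ring

theorem kap_tri (q a b c : ℝ × ℝ) (h : 0 < det3 a b c) :
    0 ≤ kap q a b + kap q b c + kap q c a ∧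
    (0 < det3 a b q → 0 < det3 b c q → 0 < det3 c a q → 1 ≤ kap q a b + kap q b c + kap q c a) := by
  have h1 : det3 a b q + det3 b c q + det3 c a q = det3 a b c := by unfold det3; ring
  have h2 : det3 a b q * (c.1 - q.1) + det3 b c q * (a.1 - q.1) + det3 c a q * (b.1 - q.1) = 0 := by
    unfold det3; ring
  have h3 : det3 a b q * (c.2 - q.2) + det3 b c q * (a.2 - q.2) + det3 c a q * (b.2 - q.2) = 0 := by
    unfold det3; ring
  unfold kap
  set x := det3 a b q
  set y := det3 b c q
  set z := det3 c a q
  have key : ∀ x y z A B C : ℝ, 0 < x + y + z → x * C + y * A + z * B = 0 → A ≤ 0 → 0 < B → 0 < C →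
      z < 0 → 0 < x := by
    intro x y z A B C hs h0 hA hB hC hz
    by_contra hx
    have : 0 < y * A := by nlinarith [mul_pos (neg_pos.2 hz) hB]
    have hy : y < 0 := by by_contra hy; nlinarith
    linarith
  have key2 : ∀ x y z A B C : ℝ, 0 < x + y + z → x * C + y * A + z * B = 0 → A ≤ 0 → B ≤ 0 → 0 < C →
      z < 0 → 0 < y := by
    intro x y z A B C hs h0 hA hB hC hz
    by_contra hy
    have : 0 ≤ y * A := mul_nonneg_of_nonpos_of_nonpos (not_lt.1 hy) hA
    have : 0 ≤ z * B := mul_nonneg_of_nonpos_of_nonpos hz.le hB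
    have : x ≤ 0 := by by_contra hx; nlinarith [mul_pos (not_le.1 hx) hC]
    linarith
  have hs : 0 < x + y + z := by rw [h1]; exact h
  have pr : ∀ p q : ℝ, (q < 0 → 0 < p) → 0 ≤ ind (0 < p) + -ind (q < 0) ∧
      (0 < p → 0 < q → 1 ≤ ind (0 < p) + -ind (q < 0)) := by
    intro p q h
    constructor
    · by_cases hq : q < 0
      · rw [ind_true hq, ind_true (h hq)]; norm_num
      · rw [ind_false hq]; have := ind_nonneg (0 < p); omega
    · intro h1 h2
      rw [ind_true h1, ind_false (not_lt.2 h2.le)]; norm_num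
  by_cases sa : a.1 ≤ q.1 <;> by_cases sb : b.1 ≤ q.1 <;> by_cases sc : c.1 ≤ q.1 <;>
    simp only [sa, sb, sc, not_true, not_false_iff, true_and, false_and, and_false, ind_false,
      ind_false (not_false), sub_zero, zero_sub, add_zero, zero_add, le_refl, Int.add_zero]
  · intro hx hy hz
    exfalso
    have t1 : 0 ≤ x * (q.1 - c.1) := mul_nonneg hx.le (sub_nonneg.2 sc)
    have t2 : 0 ≤ y * (q.1 - a.1) := mul_nonneg hy.le (sub_nonneg.2 sa)
    have t3 : 0 ≤ z * (q.1 - b.1) := mul_nonneg hz.le (sub_nonneg.2 sb)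
    have u1 : x * (q.1 - c.1) = 0 := by nlinarith
    have u2 : y * (q.1 - a.1) = 0 := by nlinarith
    have u3 : z * (q.1 - b.1) = 0 := by nlinarith
    have v1 := (mul_eq_zero.1 u1).resolve_left hx.ne'
    have v2 := (mul_eq_zero.1 u2).resolve_left hy.ne'
    have v3 := (mul_eq_zero.1 u3).resolve_left hz.ne'
    have : det3 a b c = 0 := by
      unfold det3
      have w1 : b.1 - a.1 = 0 := by linarith
      have w2 : c.1 - a.1 = 0 := by linarith
      rw [w1, w2]; ring
    linarith
  · have := pr y z (key2 x y z _ _ _ hs h2 (by linarith) (by linarith) (by linarith))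
    exact ⟨this.1, fun _ a b => this.2 a b⟩
  · have := pr x y (key2 z x y _ _ _ (by linarith) (by linarith) (sub_nonpos.2 sc) (sub_nonpos.2 sa)
      (sub_pos.2 (not_le.1 sb)))
    exact ⟨this.1, fun a b _ => this.2 a b⟩
  · have := pr x z (key x y z _ _ _ hs h2 (by linarith) (by linarith) (by linarith))
    exact ⟨this.1, fun a _ b => this.2 a b⟩
  · have := pr z x (key2 y z x _ _ _ (by linarith) (by linarith) (sub_nonpos.2 sb) (sub_nonpos.2 sc)
      (sub_pos.2 (not_le.1 sa)))
    rw [add_comm] at this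
    exact ⟨this.1, fun a _ b => this.2 b a⟩
  · have := pr y x (key y z x _ _ _ (by linarith) (by linarith) (sub_nonpos.2 sb)
      (sub_pos.2 (not_le.1 sc)) (sub_pos.2 (not_le.1 sa)))
    rw [add_comm] at this
    exact ⟨this.1, fun a b _ => this.2 b a⟩
  · have := pr z y (key z x y _ _ _ (by linarith) (by linarith) (sub_nonpos.2 sc)
      (sub_pos.2 (not_le.1 sa)) (sub_pos.2 (not_le.1 sb)))
    rw [add_comm] at this
    exact ⟨this.1, fun _ a b => this.2 b a⟩
  · intro hx hy hz
    exfalso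
    have t1 : 0 < x * (c.1 - q.1) := mul_pos hx (by linarith)
    have t2 : 0 < y * (a.1 - q.1) := mul_pos hy (by linarith)
    have t3 : 0 < z * (b.1 - q.1) := mul_pos hz (by linarith)
    linarith

noncomputable def tk (P : XT E → ℝ × ℝ) (q : ℝ × ℝ) (d : G.Dart) : ℤ :=
  kap q (P (XT.vx d.fst)) (P (XT.vx d.snd)) + kap q (P (XT.vx d.snd)) (P (zX E d)) +
    kap q (P (zX E d)) (P (XT.vx d.fst))

def InT (P : XT E → ℝ × ℝ) (q : ℝ × ℝ) (d : G.Dart) : Prop :=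
  0 < det3 (P (XT.vx d.fst)) (P (XT.vx d.snd)) q ∧ 0 < det3 (P (XT.vx d.snd)) (P (zX E d)) q ∧
    0 < det3 (P (zX E d)) (P (XT.vx d.fst)) q

open Classical in
theorem kap_sum (P : XT E → ℝ × ℝ) (q : ℝ × ℝ) :
    ∑ d ∈ Finset.univ.filter (fun d => E.angleFace d ≠ E.outer), tk P q d =
    ∑ e ∈ Finset.univ.filter (fun d => E.angleFace d = E.outer),
      kap q (P (XT.vx e.snd)) (P (XT.vx e.fst)) := by
  have hsp : ∑ d ∈ Finset.univ.filter (fun d => E.angleFace d ≠ E.outer), kap q (P (zX E d)) (P (XT.vx d.fst))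
      = ∑ d ∈ Finset.univ.filter (fun d => E.angleFace d ≠ E.outer), kap q (P (zX E d)) (P (XT.vx d.snd)) := by
    refine Finset.sum_equiv (psi E) ?_ ?_
    · intro d; simp [angleFace_psi]
    · intro d hd
      have : E.angleFace d ≠ E.outer := by simpa using hd
      rw [zX_psi this, psi_snd]
  have hall : ∑ d : G.Dart, kap q (P (XT.vx d.fst)) (P (XT.vx d.snd)) = 0 := by
    have : ∑ d : G.Dart, kap q (P (XT.vx d.fst)) (P (XT.vx d.snd)) =
        ∑ d : G.Dart, - kap q (P (XT.vx d.fst)) (P (XT.vx d.snd)) := by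
      refine Fintype.sum_equiv (dartSymmPerm G) _ _ (fun d => ?_)
      rw [← kap_anti]; rfl
    rw [Finset.sum_neg_distrib] at this
    omega
  have hsplit := Finset.sum_filter_add_sum_filter_not Finset.univ
    (fun d : G.Dart => E.angleFace d = E.outer) (fun d => kap q (P (XT.vx d.fst)) (P (XT.vx d.snd)))
  rw [hall] at hsplit
  simp only [tk]
  rw [Finset.sum_add_distrib, Finset.sum_add_distrib, hsp]
  have h1 : ∑ d ∈ Finset.univ.filter (fun d => E.angleFace d ≠ E.outer), kap q (P (XT.vx d.snd)) (P (zX E d))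
      = - ∑ d ∈ Finset.univ.filter (fun d => E.angleFace d ≠ E.outer), kap q (P (zX E d)) (P (XT.vx d.snd)) := by
    rw [← Finset.sum_neg_distrib]
    exact Finset.sum_congr rfl (fun d _ => kap_anti _ _ _)
  have h2 : ∑ e ∈ Finset.univ.filter (fun d => E.angleFace d = E.outer), kap q (P (XT.vx e.snd)) (P (XT.vx e.fst))
      = - ∑ e ∈ Finset.univ.filter (fun d => E.angleFace d = E.outer), kap q (P (XT.vx e.fst)) (P (XT.vx e.snd)) := by
    rw [← Finset.sum_neg_distrib]
    exact Finset.sum_congr rfl (fun d _ => kap_anti _ _ _)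
  rw [h1, h2]
  simp only [ne_eq]
  omega

theorem sum_ind_le {α : Type} (S : Finset α) (p : α → Prop)
    (h : ∀ a ∈ S, ∀ b ∈ S, p a → p b → a = b) : ∑ a ∈ S, ind (p a) ≤ 1 := by
  classical
  have : ∑ a ∈ S, ind (p a) = ((S.filter p).card : ℤ) := by
    rw [Finset.card_filter]; push_cast
    exact Finset.sum_congr rfl (fun a _ => by unfold ind; split_ifs <;> simp)
  rw [this]
  have : (S.filter p).card ≤ 1 := Finset.card_le_one.2 (fun a ha b hb => by
    rw [Finset.mem_filter] at ha hb; exact h a ha.1 b hb.1 ha.2 hb.2)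
  exact_mod_cast this

theorem par_snd {P : XT E → ℝ × ℝ} {τ : V → ℕ} (hG : Geo E big P τ) (e : G.Dart)
    (he : E.angleFace e = E.outer) : P (XT.vx e.snd) = ((τ e.snd : ℝ), (τ e.snd : ℝ) ^ 2) := by
  have := hG.par ((psi E).symm e) (by rw [angleFace_psi_symm]; exact he)
  rw [psi_symm_fst] at this; exact this

theorem kap_le (q u w : ℝ × ℝ) : kap q u w ≤ ind (u.1 ≤ q.1 ∧ ¬ w.1 ≤ q.1 ∧ 0 < det3 u w q) := by
  unfold kap
  have := ind_nonneg (w.1 ≤ q.1 ∧ ¬ u.1 ≤ q.1 ∧ det3 u w q < 0)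
  omega

theorem outer_edge {P : XT E → ℝ × ℝ} {τ : V → ℕ} (hG : Geo E big P τ) (x : ℝ) (e : G.Dart)
    (he : E.angleFace e = E.outer) (h1 : (P (XT.vx e.snd)).1 ≤ x) (h2 : ¬ (P (XT.vx e.fst)).1 ≤ x) :
    (τ e.snd : ℝ) ≤ x ∧ x < τ e.snd + 1 ∧ τ e.fst = τ e.snd + 1 := by
  rw [par_snd hG e he] at h1
  rw [hG.par e he] at h2
  simp only at h1 h2
  have hlt : τ e.snd < τ e.fst := by
    have : (τ e.snd : ℝ) < τ e.fst := by linarith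
    exact_mod_cast this
  have := hG.step e he hlt
  refine ⟨h1, ?_, this⟩
  rw [this] at h2; push_cast at h2; linarith

theorem nat_floor_eq {a b : ℕ} {x : ℝ} (h1 : (a : ℝ) ≤ x) (h2 : x < a + 1) (h3 : (b : ℝ) ≤ x) (h4 : x < b + 1) :
    a = b := by
  have p : (a : ℝ) < b + 1 := by linarith
  have q : (b : ℝ) < a + 1 := by linarith
  have p' : a < b + 1 := by exact_mod_cast p
  have q' : b < a + 1 := by exact_mod_cast q
  omega

theorem two_tri {P : XT E → ℝ × ℝ} {τ : V → ℕ} (hG : Geo E big P τ) (q : ℝ × ℝ) (d d' : G.Dart)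
    (hb : E.angleFace d ≠ E.outer) (hb' : E.angleFace d' ≠ E.outer) (h : InT P q d) (h' : InT P q d') :
    d = d' := by
  classical
  by_contra hne
  have hk := kap_sum P q
  have hle : ∑ e ∈ Finset.univ.filter (fun d => E.angleFace d = E.outer),
      kap q (P (XT.vx e.snd)) (P (XT.vx e.fst)) ≤ 1 := by
    refine (Finset.sum_le_sum (fun e _ => kap_le q _ _)).trans (sum_ind_le _ _ ?_)
    intro a ha b hb pa pb
    have ha : E.angleFace a = E.outer := by simpa using ha
    have hb : E.angleFace b = E.outer := by simpa using hb
    obtain ⟨a1, a2, a3⟩ := outer_edge hG q.1 a ha pa.1 pa.2.1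
    obtain ⟨b1, b2, b3⟩ := outer_edge hG q.1 b hb pb.1 pb.2.1
    have := nat_floor_eq a1 a2 b1 b2
    exact hG.cpt.one_big a b (hG.cpt.outer_big a ha) (hG.cpt.outer_big b hb) (hG.inj (by rw [a3, b3, this]))
  have hpos : ∀ d, E.angleFace d ≠ E.outer → 0 ≤ tk P q d := fun d hd => (kap_tri q _ _ _ (hG.good d hd)).1
  have t1 : 1 ≤ tk P q d := (kap_tri q _ _ _ (hG.good d hb)).2 h.1 h.2.1 h.2.2
  have t2 : 1 ≤ tk P q d' := (kap_tri q _ _ _ (hG.good d' hb')).2 h'.1 h'.2.1 h'.2.2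
  have : ∑ x ∈ ({d, d'} : Finset G.Dart), tk P q x ≤
      ∑ d ∈ Finset.univ.filter (fun d => E.angleFace d ≠ E.outer), tk P q d := by
    refine Finset.sum_le_sum_of_subset_of_nonneg ?_ ?_
    · intro x hx
      simp only [Finset.mem_insert, Finset.mem_singleton] at hx
      rcases hx with rfl | rfl <;> simpa
    · intro x hx _; exact hpos x (by simpa using hx)
  rw [Finset.sum_pair hne] at this
  omega

theorem ext_tri {P : XT E → ℝ × ℝ} {τ : V → ℕ} (hG : Geo E big P τ) (e : G.Dart)
    (he : E.angleFace e = E.outer) (s t : ℝ) (hs : 0 ≤ s) (hs1 : s < 1) (ht : 0 < t) (d : G.Dart)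
    (hb : E.angleFace d ≠ E.outer)
    (h : InT P ((P (XT.vx e.fst)).1 + s, (P (XT.vx e.fst)).2 - t) d) : False := by
  classical
  set q : ℝ × ℝ := ((P (XT.vx e.fst)).1 + s, (P (XT.vx e.fst)).2 - t) with hq
  have hk := kap_sum P q
  have hle : ∑ e ∈ Finset.univ.filter (fun d => E.angleFace d = E.outer),
      kap q (P (XT.vx e.snd)) (P (XT.vx e.fst)) ≤ 0 := by
    refine Finset.sum_nonpos (fun a ha => (kap_le q _ _).trans ?_)
    have ha : E.angleFace a = E.outer := by simpa using ha
    rw [ind_false]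
    rintro ⟨p1, p2, p3⟩
    obtain ⟨a1, a2, a3⟩ := outer_edge hG q.1 a ha p1 p2
    rw [par_snd hG a ha, hG.par a ha, a3] at p3
    have hq1 : q.1 = τ e.fst + s := by rw [hq, hG.par e he]
    have hq2 : q.2 = (τ e.fst : ℝ) ^ 2 - t := by rw [hq, hG.par e he]
    have := nat_floor_eq a1 a2 (b := τ e.fst) (by linarith) (by linarith)
    rw [this] at p3
    unfold det3 at p3
    rw [hq1, hq2] at p3
    push_cast at p3
    have : (0 : ℝ) ≤ (τ e.fst : ℝ) * s := by positivity
    nlinarith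
  have hpos : ∀ d, E.angleFace d ≠ E.outer → 0 ≤ tk P q d := fun d hd => (kap_tri q _ _ _ (hG.good d hd)).1
  have t1 : 1 ≤ tk P q d := (kap_tri q _ _ _ (hG.good d hb)).2 h.1 h.2.1 h.2.2
  have := Finset.single_le_sum (f := fun d => tk P q d)
    (s := Finset.univ.filter (fun d => E.angleFace d ≠ E.outer))
    (fun x hx => hpos x (by simpa using hx)) (a := d) (by simpa using hb)
  omega

end R6


set_option linter.unusedSectionVars false
set_option linter.unusedSimpArgs false
set_option linter.unusedVariables false

section Ang

def det2 (u w : ℝ × ℝ) : ℝ := u.1 * w.2 - u.2 * w.1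

theorem det2_sub (v a b : ℝ × ℝ) : det2 (a - v) (b - v) = det3 v a b := by
  simp [det2, det3]

theorem det2_anti (u w : ℝ × ℝ) : det2 w u = - det2 u w := by unfold det2; ring

theorem ccw_pos (u w : ℝ × ℝ) : 0 < ccwAngle u w := by
  unfold ccwAngle
  have := Complex.neg_pi_lt_arg ((⟨w.1, w.2⟩ : ℂ) / (⟨u.1, u.2⟩ : ℂ))
  split_ifs with h
  · exact h
  · linarith [Real.pi_pos]

theorem ccw_le (u w : ℝ × ℝ) : ccwAngle u w ≤ 2 * Real.pi := by
  unfold ccwAngle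
  have := Complex.arg_le_pi ((⟨w.1, w.2⟩ : ℂ) / (⟨u.1, u.2⟩ : ℂ))
  split_ifs with h
  · linarith [Real.pi_pos]
  · linarith

theorem ccw_sin (u w : ℝ × ℝ) : Real.sin (ccwAngle u w) =
    det2 u w / Complex.normSq (⟨u.1, u.2⟩ : ℂ) / ‖((⟨w.1, w.2⟩ : ℂ) / (⟨u.1, u.2⟩ : ℂ))‖ := by
  have h1 : Real.sin (ccwAngle u w) = Real.sin (Complex.arg ((⟨w.1, w.2⟩ : ℂ) / (⟨u.1, u.2⟩ : ℂ))) := by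
    unfold ccwAngle
    split_ifs
    · rfl
    · rw [Real.sin_add_two_pi]
  rw [h1, Complex.sin_arg]
  congr 1
  rw [Complex.div_im]
  simp only [det2]
  ring

theorem toC_ne {u : ℝ × ℝ} (h : u ≠ 0) : (⟨u.1, u.2⟩ : ℂ) ≠ 0 := by
  intro hc
  apply h
  have h1 := congrArg Complex.re hc
  have h2 := congrArg Complex.im hc
  exact Prod.ext h1 h2

theorem det2_ne_left {u w : ℝ × ℝ} (h : det2 u w ≠ 0) : u ≠ 0 := by
  rintro rfl; simp [det2] at h

theorem det2_ne_right {u w : ℝ × ℝ} (h : det2 u w ≠ 0) : w ≠ 0 := by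
  rintro rfl; simp [det2] at h

theorem den_pos {u w : ℝ × ℝ} (h : det2 u w ≠ 0) : 0 < Complex.normSq (⟨u.1, u.2⟩ : ℂ) ∧
    0 < ‖((⟨w.1, w.2⟩ : ℂ) / (⟨u.1, u.2⟩ : ℂ))‖ :=
  ⟨Complex.normSq_pos.2 (toC_ne (det2_ne_left h)),
    norm_pos_iff.2 (div_ne_zero (toC_ne (det2_ne_right h)) (toC_ne (det2_ne_left h)))⟩

theorem ccw_lt_pi {u w : ℝ × ℝ} (h : 0 < det2 u w) : ccwAngle u w < Real.pi := by
  by_contra hc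
  obtain ⟨h1, h2⟩ := den_pos h.ne'
  have hs : 0 < Real.sin (ccwAngle u w) := by rw [ccw_sin]; positivity
  have : Real.sin (ccwAngle u w - Real.pi) = - Real.sin (ccwAngle u w) := Real.sin_sub_pi _
  have h3 := Real.sin_nonneg_of_nonneg_of_le_pi (x := ccwAngle u w - Real.pi) (by linarith)
    (by linarith [ccw_le u w])
  linarith

theorem ccw_gt_pi {u w : ℝ × ℝ} (h : det2 u w < 0) : Real.pi < ccwAngle u w := by
  by_contra hc
  obtain ⟨h1, h2⟩ := den_pos h.ne
  have hs : Real.sin (ccwAngle u w) < 0 := by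
    rw [ccw_sin]
    exact div_neg_of_neg_of_pos (div_neg_of_neg_of_pos h h1) h2
  have h3 := Real.sin_nonneg_of_nonneg_of_le_pi (x := ccwAngle u w) (ccw_pos u w).le
    (by linarith)
  linarith

theorem det2_pos_of {u w : ℝ × ℝ} (h : ccwAngle u w < Real.pi) : 0 < det2 u w := by
  have hs := Real.sin_pos_of_pos_of_lt_pi (ccw_pos u w) h
  rw [ccw_sin] at hs
  by_contra hc
  have : det2 u w / Complex.normSq (⟨u.1, u.2⟩ : ℂ) / ‖((⟨w.1, w.2⟩ : ℂ) / (⟨u.1, u.2⟩ : ℂ))‖ ≤ 0 :=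
    div_nonpos_of_nonpos_of_nonneg (div_nonpos_of_nonpos_of_nonneg (not_lt.1 hc) (Complex.normSq_nonneg _))
      (norm_nonneg _)
  linarith

theorem ccw_mod {u w : ℝ × ℝ} (hu : u ≠ 0) (hw : w ≠ 0) : (ccwAngle u w : Real.Angle) =
    (Complex.arg (⟨w.1, w.2⟩ : ℂ) : Real.Angle) - (Complex.arg (⟨u.1, u.2⟩ : ℂ) : Real.Angle) := by
  rw [← Complex.arg_div_coe_angle (toC_ne hw) (toC_ne hu)]
  unfold ccwAngle
  split_ifs
  · rfl
  · rw [Real.Angle.coe_add, Real.Angle.coe_two_pi, add_zero]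

theorem ccw_split {g u w : ℝ × ℝ} (hg : g ≠ 0) (hu : u ≠ 0) (hw : w ≠ 0) :
    ccwAngle u w = ccwAngle g w - ccwAngle g u + 2 * Real.pi * (ind (ccwAngle g w ≤ ccwAngle g u) : ℤ) := by
  have h : ((ccwAngle u w : ℝ) : Real.Angle) = ((ccwAngle g w - ccwAngle g u : ℝ) : Real.Angle) := by
    rw [Real.Angle.coe_sub, ccw_mod hu hw, ccw_mod hg hw, ccw_mod hg hu]; abel
  obtain ⟨k, hk⟩ := Real.Angle.angle_eq_iff_two_pi_dvd_sub.1 h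
  have hp := Real.pi_pos
  have a1 := ccw_pos u w
  have a2 := ccw_le u w
  have b1 := ccw_pos g u
  have b2 := ccw_le g u
  have c1 := ccw_pos g w
  have c2 := ccw_le g w
  have k1 : (-1 : ℝ) < k := by
    by_contra hc
    have : 2 * Real.pi * (k : ℝ) ≤ 2 * Real.pi * (-1) := by
      apply mul_le_mul_of_nonneg_left (not_lt.1 hc); positivity
    by_cases hle : ccwAngle g w ≤ ccwAngle g u
    · linarith
    · linarith
  have k2 : (k : ℝ) < 2 := by
    by_contra hc
    have : 2 * Real.pi * 2 ≤ 2 * Real.pi * (k : ℝ) := by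
      apply mul_le_mul_of_nonneg_left (not_lt.1 hc); positivity
    linarith
  have k1' : -1 < k := by exact_mod_cast k1
  have k2' : k < 2 := by exact_mod_cast k2
  have hk01 : k = 0 ∨ k = 1 := by omega
  by_cases hle : ccwAngle g w ≤ ccwAngle g u
  · rw [ind_true hle]
    rcases hk01 with rfl | rfl
    · simp at hk; linarith
    · push_cast at hk ⊢; linarith
  · rw [ind_false hle]
    rcases hk01 with rfl | rfl
    · simp at hk ⊢; linarith
    · push_cast at hk; linarith

theorem ccw_add {u z w : ℝ × ℝ} (h1 : 0 < det2 u z) (h2 : 0 < det2 z w) :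
    ccwAngle u w = ccwAngle u z + ccwAngle z w := by
  have h := ccw_split (det2_ne_left h1.ne') (det2_ne_right h1.ne') (det2_ne_right h2.ne')
  have a := ccw_lt_pi h1
  have b := ccw_lt_pi h2
  by_cases hle : ccwAngle u w ≤ ccwAngle u z
  · rw [ind_true hle] at h
    push_cast at h
    linarith [ccw_pos u w]
  · rw [ind_false hle] at h
    push_cast at h
    linarith

theorem desc_cone {g u z : ℝ × ℝ} (h : 0 < det2 u z) (hu : det2 g u ≠ 0)
    (hd : ccwAngle g z ≤ ccwAngle g u) : 0 < det2 u g ∧ 0 < det2 g z := by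
  have hs := ccw_split (det2_ne_left hu) (det2_ne_left h.ne') (det2_ne_right h.ne')
  rw [ind_true hd] at hs
  push_cast at hs
  have a := ccw_lt_pi h
  have := ccw_le g u
  have := ccw_pos g z
  constructor
  · rw [det2_anti]
    rcases lt_or_gt_of_ne hu with h' | h'
    · linarith
    · have := ccw_lt_pi h'; linarith
  · exact det2_pos_of (by linarith)

theorem ev_lin (A B : ℝ) (h : 0 < A) : ∀ᶠ t in nhdsWithin (0 : ℝ) (Set.Ioi 0), 0 < A + t * B := by
  have hc : Continuous (fun t : ℝ => A + t * B) := by fun_prop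
  have h0 : 0 < A + 0 * B := by simpa using h
  exact ((hc.tendsto 0).eventually_const_lt h0).filter_mono nhdsWithin_le_nhds

theorem ev_pos : ∀ᶠ t in nhdsWithin (0 : ℝ) (Set.Ioi 0), 0 < t := eventually_mem_nhdsWithin

theorem ev_lin_ne (y : ℝ × ℝ) (h : y ≠ 0) :
    ∀ᶠ t in nhdsWithin (0 : ℝ) (Set.Ioi 0), det2 (t, -1) y ≠ 0 := by
  by_cases h1 : y.1 = 0
  · filter_upwards [ev_pos] with t ht
    have : y.2 ≠ 0 := fun h2 => h (Prod.ext h1 h2)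
    simp [det2, h1, this, ht.ne']
  · have hc : Continuous (fun t : ℝ => det2 (t, -1) y) := by unfold det2; fun_prop
    exact (hc.continuousAt.eventually_ne (by simpa [det2] using h1)).filter_mono nhdsWithin_le_nhds

theorem ev_cone (v a b g : ℝ × ℝ) (h : 0 < det3 v a b) (h1 : 0 < det2 (a - v) g) (h2 : 0 < det2 g (b - v)) :
    ∀ᶠ t in nhdsWithin (0 : ℝ) (Set.Ioi 0), 0 < det3 v a (v + t • g) ∧ 0 < det3 a b (v + t • g) ∧
      0 < det3 b v (v + t • g) := by
  filter_upwards [ev_pos, ev_lin _ (det2 (b - a) g) h] with t ht hl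
  refine ⟨?_, ?_, ?_⟩
  · have : det3 v a (v + t • g) = t * det2 (a - v) g := by simp [det3, det2]; ring
    rw [this]; positivity
  · have : det3 a b (v + t • g) = det3 v a b + t * det2 (b - a) g := by simp [det3, det2]; ring
    rw [this]; exact hl
  · have : det3 b v (v + t • g) = t * det2 g (b - v) := by simp [det3, det2]; ring
    rw [this]; positivity

end Ang

section AngSum
variable {V : Type} [Fintype V] [DecidableEq V] {G : SimpleGraph V} [DecidableRel G.Adj]
variable {E : PlaneEmb G} {big : G.Dart → Prop} {P : XT E → ℝ × ℝ} {τ : V → ℕ}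

theorem geo_ne (hG : Geo E big P τ) (u v : V) (h : u ≠ v) : P (XT.vx u) ≠ P (XT.vx v) := by
  obtain ⟨d, hd⟩ := exists_dart_at E u
  have hex : ∃ w, w ≠ u ∧ w ≠ v := by
    by_cases h1 : d.snd = v
    · refine ⟨(E.rot d).snd, ?_, ?_⟩
      · have := (E.rot d).adj.ne
        rw [E.rot_fst, hd] at this; exact this.symm
      · rw [← h1]; exact rot_snd_ne hG.nd d
    · exact ⟨d.snd, by rw [← hd]; exact d.adj.ne.symm, h1⟩
  obtain ⟨w, h1, h2⟩ := hex
  intro he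
  apply hG.gen u v w h h1.symm h2.symm
  rw [he]; unfold det3; ring

theorem geo_snd (hG : Geo E big P τ) (d : G.Dart) (hb : E.angleFace d ≠ E.outer) :
    0 < det3 (P (XT.vx d.fst)) (P (zX E d)) (P (XT.vx (E.rot d).snd)) := by
  have := hG.good (psi E d) (by rw [angleFace_psi]; exact hb)
  unfold gd at this
  rwa [zX_psi hb, psi_fst, psi_snd, ← det3_cyc] at this

theorem ang_sum (hG : Geo E big P τ) (v : V) :
    ∑ d ∈ Finset.univ.filter (fun d : G.Dart => d.fst = v), dartAngle E (fun v => P (XT.vx v)) d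
      = 2 * Real.pi := by
  classical
  set D := Finset.univ.filter (fun d : G.Dart => d.fst = v) with hD
  have mD : ∀ d, d ∈ D ↔ d.fst = v := by intro d; simp [hD]
  set o := P (XT.vx v) with ho
  have hsn : ∀ d : G.Dart, d.fst = v → P (XT.vx d.snd) - o ≠ 0 := by
    intro d hd hc
    exact geo_ne hG d.snd v (by rw [← hd]; exact d.adj.ne.symm) (sub_eq_zero.1 hc)
  have hzn : ∀ d : G.Dart, d.fst = v → E.angleFace d ≠ E.outer → 0 < det2 (P (XT.vx d.snd) - o) (P (zX E d) - o) := by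
    intro d hd hb
    rw [det2_sub, ho, ← hd]; exact hG.good d hb
  have hzn2 : ∀ d : G.Dart, d.fst = v → E.angleFace d ≠ E.outer →
      0 < det2 (P (zX E d) - o) (P (XT.vx (E.rot d).snd) - o) := by
    intro d hd hb
    rw [det2_sub, ho, ← hd]; exact geo_snd hG d hb
  have e1 : ∀ᶠ t in nhdsWithin (0 : ℝ) (Set.Ioi 0), ∀ d : G.Dart, d.fst = v →
      det2 (t, -1) (P (XT.vx d.snd) - o) ≠ 0 := by
    rw [Filter.eventually_all]; intro d
    by_cases h : d.fst = v
    · filter_upwards [ev_lin_ne _ (hsn d h)] with t ht _ using ht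
    · exact Filter.Eventually.of_forall (fun _ h' => absurd h' h)
  have e2 : ∀ᶠ t in nhdsWithin (0 : ℝ) (Set.Ioi 0), ∀ d : G.Dart, d.fst = v → E.angleFace d ≠ E.outer →
      det2 (t, -1) (P (zX E d) - o) ≠ 0 := by
    rw [Filter.eventually_all]; intro d
    by_cases h : d.fst = v ∧ E.angleFace d ≠ E.outer
    · filter_upwards [ev_lin_ne _ (det2_ne_right (hzn d h.1 h.2).ne')] with t ht _ _ using ht
    · exact Filter.Eventually.of_forall (fun _ h1 h2 => absurd ⟨h1, h2⟩ h)
  obtain ⟨δ, hδ, g1, g2⟩ := (ev_pos.and (e1.and e2)).exists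
  set g : ℝ × ℝ := (δ, -1) with hg
  have hg0 : g ≠ 0 := by intro h; have := congrArg Prod.snd h; simp [hg] at this
  let α : XT E → ℝ := fun x => ccwAngle g (P x - o)
  let ev : G.Dart × Bool → Prop := fun r => match r with
    | (d, false) => (E.angleFace d ≠ E.outer ∧ α (zX E d) ≤ α (XT.vx d.snd)) ∨
        (E.angleFace d = E.outer ∧ α (XT.vx (E.rot d).snd) ≤ α (XT.vx d.snd))
    | (d, true) => E.angleFace d ≠ E.outer ∧ α (XT.vx (E.rot d).snd) ≤ α (zX E d)
  have hda : ∀ d ∈ D, dartAngle E (fun v => P (XT.vx v)) d = α (XT.vx (E.rot d).snd) - α (XT.vx d.snd)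
      + 2 * Real.pi * ((ind (ev (d, false)) + ind (ev (d, true)) : ℤ) : ℝ) := by
    intro d hd
    have hd := (mD d).1 hd
    have hrf : (E.rot d).fst = v := by rw [E.rot_fst, hd]
    unfold dartAngle
    rw [hrf, hd]
    by_cases hb : E.angleFace d = E.outer
    · rw [ccw_split hg0 (hsn d hd) (hsn (E.rot d) hrf)]
      have h1 : ev (d, false) ↔ ccwAngle g (P (XT.vx (E.rot d).snd) - o) ≤ ccwAngle g (P (XT.vx d.snd) - o) := by
        simp [ev, hb, α]
      have h2 : ¬ ev (d, true) := by simp [ev, hb]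
      rw [ind_false h2, add_zero]
      simp only [h1]
      rfl
    · have a := hzn d hd hb
      have b := hzn2 d hd hb
      have hz := det2_ne_right a.ne'
      have h1 : ev (d, false) ↔ ccwAngle g (P (zX E d) - o) ≤ ccwAngle g (P (XT.vx d.snd) - o) := by
        simp [ev, hb, α]
      have h2 : ev (d, true) ↔ ccwAngle g (P (XT.vx (E.rot d).snd) - o) ≤ ccwAngle g (P (zX E d) - o) := by
        simp [ev, hb, α]
      show ccwAngle (P (XT.vx d.snd) - o) (P (XT.vx (E.rot d).snd) - o) = _
      rw [ccw_add a b, ccw_split hg0 (hsn d hd) hz, ccw_split hg0 hz (hsn (E.rot d) hrf)]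
      simp only [h1, h2, α]
      push_cast
      ring
  have htel : ∑ d ∈ D, α (XT.vx (E.rot d).snd) = ∑ d ∈ D, α (XT.vx d.snd) :=
    Finset.sum_equiv E.rot (fun d => by rw [mD, mD, E.rot_fst]) (fun d _ => rfl)
  have hsum : ∑ d ∈ D, dartAngle E (fun v => P (XT.vx v)) d =
      2 * Real.pi * ((∑ d ∈ D, (ind (ev (d, false)) + ind (ev (d, true))) : ℤ) : ℝ) := by
    rw [Finset.sum_congr rfl hda, Finset.sum_add_distrib, Finset.sum_sub_distrib, htel, sub_self, zero_add,
      ← Finset.mul_sum]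
    push_cast; rfl
  have hN : ∑ d ∈ D, (ind (ev (d, false)) + ind (ev (d, true))) =
      ∑ r ∈ D ×ˢ (Finset.univ : Finset Bool), ind (ev r) := by
    rw [Finset.sum_product]
    refine Finset.sum_congr rfl (fun d _ => ?_)
    rw [Fintype.sum_bool, add_comm]
  -- triangles containing points near o in direction g
  let td : G.Dart × Bool → G.Dart := fun r => match r with
    | (d, false) => d
    | (d, true) => psi E d
  have htd : ∀ r, E.angleFace (td r) = E.angleFace r.1 := by
    rintro ⟨d, b⟩; cases b
    · rfl
    · exact angleFace_psi E d
  have hev : ∀ r : G.Dart × Bool, r.1.fst = v → E.angleFace r.1 ≠ E.outer → ev r →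
      ∀ᶠ t in nhdsWithin (0 : ℝ) (Set.Ioi 0), InT P (o + t • g) (td r) := by
    rintro ⟨d, b⟩ hd hb hr
    simp only at hd hb
    cases b
    · simp only [ev, hb, ne_eq, not_false_iff, true_and, false_and, or_false] at hr
      obtain ⟨c1, c2⟩ := desc_cone (hzn d hd hb) (g1 d hd) hr
      have := hzn d hd hb
      rw [det2_sub] at this
      filter_upwards [ev_cone o _ _ g this c1 c2] with t ht
      simp only [InT, td, hd]
      exact ht
    · simp only [ev, hb, ne_eq, not_false_iff, true_and] at hr
      obtain ⟨c1, c2⟩ := desc_cone (hzn2 d hd hb) (g2 d hd hb) hr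
      have := hzn2 d hd hb
      rw [det2_sub] at this
      filter_upwards [ev_cone o _ _ g this c1 c2] with t ht
      simp only [InT, td]
      rw [zX_psi hb, psi_snd, psi_fst, hd]
      exact ⟨ht.2.2, ht.1, ht.2.1⟩
  have hle : ∑ r ∈ D ×ˢ (Finset.univ : Finset Bool), ind (ev r) ≤ 1 := by
    apply sum_ind_le
    intro r hr r' hr' er er'
    have fr : r.1.fst = v := (mD _).1 (Finset.mem_product.1 hr).1
    have fr' : r'.1.fst = v := (mD _).1 (Finset.mem_product.1 hr').1
    clear hr hr'
    have hext : ∀ r r' : G.Dart × Bool, r.1.fst = v → r'.1.fst = v → E.angleFace r.1 = E.outer →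
        E.angleFace r'.1 ≠ E.outer → ev r' → False := by
      intro r r' hr hr' ho1 ho2 er'
      obtain ⟨t, h1, h2, h3⟩ := (ev_pos.and ((ev_lin 1 (-δ) one_pos).and (hev r' hr' ho2 er'))).exists
      refine ext_tri hG r.1 ho1 (t * δ) t (by positivity) (by linarith) h1 (td r') (by rw [htd]; exact ho2) ?_
      rw [hr]
      convert h3 using 1
      ext <;> simp [hg, ho] <;> ring
    by_cases o1 : E.angleFace r.1 = E.outer <;> by_cases o2 : E.angleFace r'.1 = E.outer
    · obtain ⟨d, b⟩ := r
      obtain ⟨d', b'⟩ := r'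
      have : d = d' := hG.cpt.one_big d d' (hG.cpt.outer_big d o1) (hG.cpt.outer_big d' o2) (fr.trans fr'.symm)
      subst this
      simp only at o1
      cases b
      · cases b'
        · rfl
        · simp [ev, o1] at er'
      · simp [ev, o1] at er
    · exact (hext r r' fr fr' o1 o2 er').elim
    · exact (hext r' r fr' fr o2 o1 er).elim
    · obtain ⟨t, h1, h2⟩ := ((hev r fr o1 er).and (hev r' fr' o2 er')).exists
      have heq := two_tri hG _ _ _ (by rw [htd]; exact o1) (by rw [htd]; exact o2) h1 h2
      obtain ⟨d, b⟩ := r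
      obtain ⟨d', b'⟩ := r'
      simp only at fr fr'
      have key : ∀ d d' : G.Dart, d.fst = v → d'.fst = v → d ≠ psi E d' := by
        intro d d' h h' hc
        have := (E.rot d').adj.ne
        rw [E.rot_fst, h', ← psi_fst, ← hc, h] at this
        exact this rfl
      cases b <;> cases b' <;> simp only [td] at heq
      · rw [heq]
      · exact (key d d' fr fr' heq).elim
      · exact (key d' d fr' fr heq.symm).elim
      · rw [(psi E).injective heq]
  have hpos : 0 < ∑ d ∈ D, dartAngle E (fun v => P (XT.vx v)) d := by
    obtain ⟨d, hd⟩ := exists_dart_at E v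
    exact Finset.sum_pos (fun d _ => ccw_pos _ _) ⟨d, (mD d).2 hd⟩
  rw [hN] at hsum
  rw [hsum] at hpos ⊢
  have : (0 : ℝ) < ((∑ r ∈ D ×ˢ (Finset.univ : Finset Bool), ind (ev r) : ℤ) : ℝ) := by
    by_contra hc
    have := mul_nonpos_of_nonneg_of_nonpos (a := 2 * Real.pi) (by positivity) (not_lt.1 hc)
    linarith
  have h0 : 0 < ∑ r ∈ D ×ˢ (Finset.univ : Finset Bool), ind (ev r) := by exact_mod_cast this
  have h1 : ∑ r ∈ D ×ˢ (Finset.univ : Finset Bool), ind (ev r) = 1 := by omega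
  rw [h1]; simp

end AngSum


set_option linter.unusedSectionVars false
set_option linter.unusedSimpArgs false
set_option linter.unusedVariables false

theorem collinear_det3 {a b c : ℝ × ℝ} (h : Collinear ℝ ({a, b, c} : Set (ℝ × ℝ))) : det3 a b c = 0 := by
  obtain ⟨v, hv⟩ := (collinear_iff_of_mem (p₀ := a) (by simp)).1 h
  obtain ⟨r, hr⟩ := hv b (by simp)
  obtain ⟨s, hs⟩ := hv c (by simp)
  rw [hr, hs]
  simp [det3]; ring

theorem det3_collinear {a b c : ℝ × ℝ} (h : det3 a b c = 0) : Collinear ℝ ({a, b, c} : Set (ℝ × ℝ)) := by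
  by_cases hab : b = a
  · subst hab; simpa using collinear_pair ℝ b c
  rw [collinear_iff_of_mem (p₀ := a) (by simp)]
  refine ⟨b - a, ?_⟩
  have hn : b.1 - a.1 ≠ 0 ∨ b.2 - a.2 ≠ 0 := by
    by_contra hc
    push Not at hc
    exact hab (Prod.ext (by linarith [hc.1]) (by linarith [hc.2]))
  unfold det3 at h
  simp only [Set.mem_insert_iff, Set.mem_singleton_iff]
  rintro x (rfl | rfl | rfl)
  · exact ⟨0, by simp⟩
  · exact ⟨1, by simp⟩
  · rcases hn with hn | hn
    · refine ⟨(x.1 - a.1) / (b.1 - a.1), ?_⟩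
      ext <;> simp <;> field_simp <;> linarith
    · refine ⟨(x.2 - a.2) / (b.2 - a.2), ?_⟩
      ext <;> simp <;> field_simp <;> linarith

section Str

variable {V : Type} [Fintype V] [DecidableEq V] {G : SimpleGraph V} [DecidableRel G.Adj]
  {E : PlaneEmb G} {big : G.Dart → Prop} {P : XT E → ℝ × ℝ} {τ : V → ℕ}

theorem ev_side (a b z w X : ℝ × ℝ) (s : ℝ) (h0 : 0 < s) (h1 : s < 1) (hX : X = a + s • (b - a))
    (h : 0 < det3 a b z) (hw : det2 (b - a) w = 1) :
    ∀ᶠ t in nhdsWithin (0 : ℝ) (Set.Ioi 0), 0 < det3 a b (X + t • w) ∧ 0 < det3 b z (X + t • w) ∧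
      0 < det3 z a (X + t • w) := by
  filter_upwards [ev_pos, ev_lin ((1 - s) * det3 a b z) (det2 (z - b) w) (mul_pos (by linarith) h),
    ev_lin (s * det3 a b z) (det2 (a - z) w) (mul_pos h0 h)] with t ht h2 h3
  refine ⟨?_, ?_, ?_⟩
  · have : det3 a b (X + t • w) = t * det2 (b - a) w := by
      rw [hX]; simp [det3, det2]; ring
    rw [this, hw]; linarith
  · convert h2 using 1
    rw [hX]; simp [det3, det2]; ring
  · convert h3 using 1
    rw [hX]; simp [det3, det2]; ring

theorem geo_inner (hG : Geo E big P τ) (d d' : G.Dart) (X : ℝ × ℝ) (s s' : ℝ) (h0 : 0 < s) (h1 : s < 1)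
    (h0' : 0 < s') (h1' : s' < 1)
    (hX : X = P (XT.vx d.fst) + s • (P (XT.vx d.snd) - P (XT.vx d.fst)))
    (hX' : X = P (XT.vx d'.fst) + s' • (P (XT.vx d'.snd) - P (XT.vx d'.fst)))
    (hb : E.angleFace d ≠ E.outer) (hb' : E.angleFace d' ≠ E.outer) (n1 : d.fst ≠ d'.fst) (n2 : d.snd ≠ d'.fst) :
    d = d' := by
  set a := P (XT.vx d.fst) with ha
  set b := P (XT.vx d.snd) with hbb
  set c := P (XT.vx d'.fst) with hc
  set e := P (XT.vx d'.snd) with he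
  have hD : det2 (b - a) (e - c) ≠ 0 := by
    intro hD
    apply hG.gen d.fst d.snd d'.fst d.adj.ne n1 n2
    have e1 := congrArg Prod.fst (hX.symm.trans hX')
    have e2 := congrArg Prod.snd (hX.symm.trans hX')
    simp only [det2, Prod.fst_sub, Prod.snd_sub, Prod.fst_add, Prod.snd_add, Prod.smul_fst, Prod.smul_snd,
      smul_eq_mul] at hD e1 e2
    rw [← ha, ← hbb, ← hc]
    unfold det3
    linear_combination (b.1 - a.1) * (-e2) + (b.2 - a.2) * e1 - s' * hD
  have w1 : det2 (b - a) ((det2 (b - a) (e - c))⁻¹ • ((e - c) - (b - a))) = 1 := by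
    have : det2 (b - a) ((det2 (b - a) (e - c))⁻¹ • ((e - c) - (b - a))) =
      (det2 (b - a) (e - c))⁻¹ * det2 (b - a) (e - c) := by
      generalize (det2 (b - a) (e - c))⁻¹ = k
      simp [det2]; ring
    rw [this, inv_mul_cancel₀ hD]
  have w2 : det2 (e - c) ((det2 (b - a) (e - c))⁻¹ • ((e - c) - (b - a))) = 1 := by
    have : det2 (e - c) ((det2 (b - a) (e - c))⁻¹ • ((e - c) - (b - a))) =
      (det2 (b - a) (e - c))⁻¹ * det2 (b - a) (e - c) := by
      generalize (det2 (b - a) (e - c))⁻¹ = k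
      simp [det2]; ring
    rw [this, inv_mul_cancel₀ hD]
  obtain ⟨t, i1, i2⟩ := ((ev_side a b (P (zX E d)) _ X s h0 h1 hX (hG.good d hb) w1).and
    (ev_side c e (P (zX E d')) _ X s' h0' h1' hX' (hG.good d' hb') w2)).exists
  exact two_tri hG _ d d' hb hb' i1 i2

theorem orient (hnd : NonDegenerateFaces E) (P : XT E → ℝ × ℝ) {a b : V} (h : G.Adj a b) (X : ℝ × ℝ) (s : ℝ)
    (h0 : 0 < s) (h1 : s < 1) (hX : X = P (XT.vx a) + s • (P (XT.vx b) - P (XT.vx a))) :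
    ∃ d : G.Dart, ((d.fst = a ∧ d.snd = b) ∨ (d.fst = b ∧ d.snd = a)) ∧ E.angleFace d ≠ E.outer ∧
      ∃ r : ℝ, 0 < r ∧ r < 1 ∧ X = P (XT.vx d.fst) + r • (P (XT.vx d.snd) - P (XT.vx d.fst)) := by
  by_cases ho : E.angleFace (⟨(a, b), h⟩ : G.Dart) = E.outer
  · refine ⟨(⟨(a, b), h⟩ : G.Dart).symm, Or.inr ⟨rfl, rfl⟩, ?_, 1 - s, by linarith, by linarith, ?_⟩
    · rw [← ho]; exact (sides_ne hnd _).symm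
    · rw [hX]; simp only [SimpleGraph.Dart.symm, Prod.fst_swap, Prod.snd_swap]
      module
  · exact ⟨⟨(a, b), h⟩, Or.inl ⟨rfl, rfl⟩, ho, s, h0, h1, hX⟩

theorem on_seg {a b X : ℝ × ℝ} (h : X ∈ segment ℝ a b) : ∃ s : ℝ, 0 ≤ s ∧ s ≤ 1 ∧ X = a + s • (b - a) := by
  rw [segment_eq_image'] at h
  obtain ⟨s, ⟨h0, h1⟩, rfl⟩ := h
  exact ⟨s, h0, h1, rfl⟩

theorem geo_not_on (hG : Geo E big P τ) (x a b : V) (hab : a ≠ b) (h1 : x ≠ a) (h2 : x ≠ b) (X : ℝ × ℝ)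
    (hX : X ∈ segment ℝ (P (XT.vx a)) (P (XT.vx b))) : P (XT.vx x) ≠ X := by
  intro hc
  obtain ⟨s, -, -, hs⟩ := on_seg hX
  apply hG.gen a b x hab h1.symm h2.symm
  rw [hc, hs]
  simp [det3]; ring

theorem share (hG : Geo E big P τ) (a b d : V) (hab : a ≠ b) (had : a ≠ d) (hbd : b ≠ d) (X : ℝ × ℝ)
    (h : X ∈ segment ℝ (P (XT.vx a)) (P (XT.vx b))) (h' : X ∈ segment ℝ (P (XT.vx a)) (P (XT.vx d))) :
    P (XT.vx a) = X := by
  obtain ⟨s, -, -, hs⟩ := on_seg h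
  obtain ⟨r, -, -, hr⟩ := on_seg h'
  have hg := hG.gen a b d hab had hbd
  have e1 := congrArg Prod.fst (hs.symm.trans hr)
  have e2 := congrArg Prod.snd (hs.symm.trans hr)
  simp only [Prod.fst_sub, Prod.snd_sub, Prod.fst_add, Prod.snd_add, Prod.smul_fst, Prod.smul_snd,
      smul_eq_mul] at e1 e2
  have : s * det3 (P (XT.vx a)) (P (XT.vx b)) (P (XT.vx d)) = 0 := by
    unfold det3
    linear_combination ((P (XT.vx d)).2 - (P (XT.vx a)).2) * e1 - ((P (XT.vx d)).1 - (P (XT.vx a)).1) * e2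
  rcases mul_eq_zero.1 this with h | h
  · rw [hs, h]; simp
  · exact (hg h).elim

theorem geo_nc (hG : Geo E big P τ) : NonCrossing G (fun v => P (XT.vx v)) := by
  constructor
  · rintro a b c d hab hcd hne X ⟨hX, hX'⟩
    simp only at hX hX'
    by_cases h1 : a = c
    · subst h1
      have : b ≠ d := by rintro rfl; exact hne rfl
      exact ⟨a, by simp, share hG a b d hab.ne hcd.ne this X hX hX'⟩
    by_cases h2 : a = d
    · subst h2
      have : b ≠ c := by rintro rfl; exact hne (Set.pair_comm _ _)
      exact ⟨a, by simp, share hG a b c hab.ne hcd.ne.symm this X hX (by rwa [segment_symm])⟩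
    by_cases h3 : b = c
    · subst h3
      exact ⟨b, by simp, share hG b a d hab.ne.symm hcd.ne h2 X (by rwa [segment_symm]) hX'⟩
    by_cases h4 : b = d
    · subst h4
      exact ⟨b, by simp, share hG b a c hab.ne.symm hcd.ne.symm h1 X (by rwa [segment_symm]) (by rwa [segment_symm])⟩
    exfalso
    have na := geo_not_on hG a c d hcd.ne h1 h2 X hX'
    have nb := geo_not_on hG b c d hcd.ne h3 h4 X hX'
    have nc := geo_not_on hG c a b hab.ne (Ne.symm h1) (Ne.symm h3) X hX
    have nd := geo_not_on hG d a b hab.ne (Ne.symm h2) (Ne.symm h4) X hX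
    have strict : ∀ u v : V, P (XT.vx u) ≠ X → P (XT.vx v) ≠ X → X ∈ segment ℝ (P (XT.vx u)) (P (XT.vx v)) →
        ∃ s : ℝ, 0 < s ∧ s < 1 ∧ X = P (XT.vx u) + s • (P (XT.vx v) - P (XT.vx u)) := by
      intro u v hu hv h
      obtain ⟨s, h0, h1, hs⟩ := on_seg h
      refine ⟨s, lt_of_le_of_ne h0 ?_, lt_of_le_of_ne h1 ?_, hs⟩
      · rintro rfl; apply hu; rw [hs]; simp
      · rintro rfl; apply hv; rw [hs]; simp
    obtain ⟨s, s0, s1, hs⟩ := strict a b na nb hX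
    obtain ⟨r, r0, r1, hr⟩ := strict c d nc nd hX'
    obtain ⟨e, he, heb, s', s0', s1', hs'⟩ := orient hG.nd P hab X s s0 s1 hs
    obtain ⟨f, hf, hfb, r', r0', r1', hr'⟩ := orient hG.nd P hcd X r r0 r1 hr
    have n1 : e.fst ≠ f.fst := by
      rcases he with ⟨p, -⟩ | ⟨p, -⟩ <;> rcases hf with ⟨q, -⟩ | ⟨q, -⟩ <;> rw [p, q] <;> assumption
    have n2 : e.snd ≠ f.fst := by
      rcases he with ⟨-, p⟩ | ⟨-, p⟩ <;> rcases hf with ⟨q, -⟩ | ⟨q, -⟩ <;> rw [p, q] <;> assumption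
    have := geo_inner hG e f X s' r' s0' s1' r0' r1' hs' hr' heb hfb n1 n2
    exact n1 (by rw [this])
  · intro x a b hab h1 h2 hX
    exact geo_not_on hG x a b hab.ne h1 h2 _ hX rfl

theorem geo_stretch (hG : Geo E big P τ) : Stretches G E big (fun v => P (XT.vx v)) := by
  refine ⟨⟨?_, geo_nc hG, fun v _ => ang_sum hG v⟩, ?_, ?_⟩
  · intro u v h
    by_contra hc
    exact geo_ne hG u v hc h
  · intro u v w h1 h2 h3 hc
    exact hG.gen u v w h1 h2 h3 (collinear_det3 hc)
  · have hbig : ∀ d, big d → Real.pi < dartAngle E (fun v => P (XT.vx v)) d := by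
      intro d hd
      apply ccw_gt_pi
      rw [E.rot_fst, det2_sub]
      exact hG.bg d hd
    intro d
    refine ⟨hbig d, ?_⟩
    intro hs
    by_cases hp : PointedVx big d.fst
    · obtain ⟨e, he, hef⟩ := hp
      have hne : e ≠ d := by rintro rfl; exact hs he
      have hsum := ang_sum hG d.fst
      have hle : ∑ x ∈ {e, d}, dartAngle E (fun v => P (XT.vx v)) x ≤
          ∑ d' ∈ Finset.univ.filter (fun d' : G.Dart => d'.fst = d.fst), dartAngle E (fun v => P (XT.vx v)) d' := by
        apply Finset.sum_le_sum_of_subset_of_nonneg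
        · intro x hx
          simp only [Finset.mem_insert, Finset.mem_singleton] at hx
          rcases hx with rfl | rfl <;> simp [hef]
        · intro x _ _; exact (ccw_pos _ _).le
      rw [hsum, Finset.sum_pair hne] at hle
      linarith [hbig e he]
    · apply ccw_lt_pi
      rw [E.rot_fst, det2_sub]
      exact hG.np d hp

theorem rev_dir (hcpt : IsCPTLabelling E big) (hnd : NonDegenerateFaces E)
    (hH : ∀ H : G.Subgraph, 3 ≤ Nat.card H.verts → 3 ≤ Nat.card {v : V | IsCPTCorner E big H v}) :
    ∃ p : V → ℝ × ℝ, Stretches G E big p := by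
  obtain ⟨P, τ, hG⟩ := geo_exists hcpt hnd (triP_of_corners hcpt hnd hH)
  exact ⟨_, geo_stretch hG⟩

end Str


set_option linter.unusedSectionVars false
set_option linter.unusedSimpArgs false
set_option linter.unusedVariables false

theorem chain_le {θ : ℕ → ℝ} {a b : ℕ} (h : ∀ k, a ≤ k → k + 1 < b → θ (k + 1) ≤ θ k) :
    ∀ i j, a ≤ i → i ≤ j → j < b → θ j ≤ θ i := by
  intro i j hi hij hj
  induction j, hij using Nat.le_induction with
  | base => exact le_rfl
  | succ j hij ih => exact (h j (hi.trans hij) hj).trans (ih (by omega))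

/-- A closed polygon with lifted directions `θ`, three left turns at `i1 < i2 < i3`, and all
other turns to the right: the middle left turn is above the starting point. -/
theorem turn_core {N i1 i2 i3 : ℕ} {θ r : ℕ → ℝ} (h1 : 0 < i1) (h12 : i1 < i2) (h23 : i2 < i3) (h3 : i3 < N)
    (hr : ∀ k, k < N → 0 < r k)
    (hR : ∀ k, k + 1 < N → k + 1 ≠ i1 → k + 1 ≠ i2 → k + 1 ≠ i3 → θ (k + 1) ≤ θ k)
    (hL : ∀ k, k + 1 < N → θ (k + 1) < θ k + Real.pi)
    (h0 : θ 0 ≤ 0) (hN : 2 * Real.pi ≤ θ (N - 1))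
    (sx : ∑ j ∈ Finset.range N, r j * Real.cos (θ j) = 0)
    (sy : ∑ j ∈ Finset.range N, r j * Real.sin (θ j) = 0) :
    0 < ∑ j ∈ Finset.range i2, r j * Real.sin (θ j) := by
  have hpi := Real.pi_pos
  have cA := chain_le (θ := θ) (a := 0) (b := i1) (fun k _ hk => hR k (by omega) (by omega) (by omega) (by omega))
  have cB := chain_le (θ := θ) (a := i1) (b := i2) (fun k _ hk => hR k (by omega) (by omega) (by omega) (by omega))
  have cC := chain_le (θ := θ) (a := i2) (b := i3) (fun k _ hk => hR k (by omega) (by omega) (by omega) (by omega))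
  have cD := chain_le (θ := θ) (a := i3) (b := N) (fun k _ hk => hR k (by omega) (by omega) (by omega) (by omega))
  have l1 := hL (i1 - 1) (by omega)
  have l2 := hL (i2 - 1) (by omega)
  have l3 := hL (i3 - 1) (by omega)
  rw [Nat.sub_add_cancel (by omega)] at l1 l2 l3
  have a1 := cA 0 (i1 - 1) (by omega) (by omega) (by omega)
  have b1 := cB i1 (i2 - 1) (by omega) (by omega) (by omega)
  have c1 := cC i2 (i3 - 1) (by omega) (by omega) (by omega)
  have d1 := cD i3 (N - 1) (by omega) (by omega) (by omega)
  set β := θ (i1 - 1) with hβ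
  set γ := θ i3 - 2 * Real.pi with hγ
  have comb : ∀ S : Finset ℕ, ∀ b : ℝ, ∑ j ∈ S, r j * Real.sin (θ j - b) =
      Real.cos b * ∑ j ∈ S, r j * Real.sin (θ j) - Real.sin b * ∑ j ∈ S, r j * Real.cos (θ j) := by
    intro S b
    rw [Finset.mul_sum, Finset.mul_sum, ← Finset.sum_sub_distrib]
    apply Finset.sum_congr rfl
    intro j _
    rw [Real.sin_sub]; ring
  have A1 : 0 < ∑ j ∈ Finset.range i2, r j * Real.sin (θ j - β) := by
    apply Finset.sum_pos'
    · intro j hj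
      rw [Finset.mem_range] at hj
      apply mul_nonneg (hr j (by omega)).le
      apply Real.sin_nonneg_of_nonneg_of_le_pi
      · by_cases hji : j < i1
        · have := cA j (i1 - 1) (by omega) (by omega) (by omega); linarith
        · have := cB j (i2 - 1) (by omega) (by omega) (by omega); linarith
      · by_cases hji : j < i1
        · have := cA 0 j (by omega) (by omega) (by omega); linarith
        · have := cB i1 j (by omega) (by omega) (by omega); linarith
    · refine ⟨i1, Finset.mem_range.2 h12, mul_pos (hr _ (by omega)) ?_⟩
      apply Real.sin_pos_of_pos_of_lt_pi <;> linarith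
  have A0' : ∑ j ∈ Finset.Ico i2 N, r j * Real.sin (θ j - γ) < 0 := by
    rw [← neg_pos, ← Finset.sum_neg_distrib]
    have neg : ∀ j, -(r j * Real.sin (θ j - γ)) = r j * Real.sin (θ j - γ - Real.pi) := by
      intro j; rw [Real.sin_sub_pi]; ring
    simp only [neg]
    apply Finset.sum_pos'
    · intro j hj
      rw [Finset.mem_Ico] at hj
      apply mul_nonneg (hr j (by omega)).le
      apply Real.sin_nonneg_of_nonneg_of_le_pi
      · by_cases hji : j < i3
        · have := cC j (i3 - 1) (by omega) (by omega) (by omega); linarith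
        · have := cD j (N - 1) (by omega) (by omega) (by omega); linarith
      · by_cases hji : j < i3
        · have := cC i2 j (by omega) (by omega) (by omega); linarith
        · have := cD i3 j (by omega) (by omega) (by omega); linarith
    · refine ⟨i2, Finset.mem_Ico.2 ⟨le_rfl, by omega⟩, mul_pos (hr _ (by omega)) ?_⟩
      apply Real.sin_pos_of_pos_of_lt_pi <;> linarith
  have A0 : 0 < ∑ j ∈ Finset.range i2, r j * Real.sin (θ j - γ) := by
    have := Finset.sum_range_add_sum_Ico (fun j => r j * Real.sin (θ j - γ)) (show i2 ≤ N by omega)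
    rw [comb (Finset.range N), sx, sy] at this
    linarith
  rw [comb] at A1 A0
  set Y := ∑ j ∈ Finset.range i2, r j * Real.sin (θ j)
  set X := ∑ j ∈ Finset.range i2, r j * Real.cos (θ j)
  have s0 : 0 ≤ Real.sin γ := Real.sin_nonneg_of_nonneg_of_le_pi (by linarith) (by linarith)
  have s1 : 0 ≤ Real.sin (-β) := Real.sin_nonneg_of_nonneg_of_le_pi (by linarith) (by linarith)
  by_cases hz : γ = 0 ∧ β = 0
  · rw [hz.2] at A1; simpa using A1
  have hs : 0 < Real.sin (γ - β) := by
    apply Real.sin_pos_of_pos_of_lt_pi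
    · by_contra hc
      apply hz
      constructor <;> linarith
    · linarith
  have hid : Real.sin γ * (Real.cos β * Y - Real.sin β * X) + Real.sin (-β) * (Real.cos γ * Y - Real.sin γ * X)
      = Real.sin (γ - β) * Y := by
    rw [Real.sin_sub γ β, Real.sin_neg]; ring
  have hpos : 0 < Real.sin (γ - β) * Y := by
    rw [← hid]
    by_cases hg : γ = 0
    · have : 0 < Real.sin (-β) := by
        apply Real.sin_pos_of_pos_of_lt_pi
        · by_contra hc
          exact hz ⟨hg, by linarith⟩
        · linarith
      have := mul_pos this A0
      have := mul_nonneg s0 A1.le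
      linarith
    · have : 0 < Real.sin γ := by
        apply Real.sin_pos_of_pos_of_lt_pi
        · exact lt_of_le_of_ne (by linarith) (Ne.symm hg)
        · linarith
      have := mul_pos this A1
      have := mul_nonneg s1 A0.le
      linarith
  exact (mul_pos_iff_of_pos_left hs).1 hpos

/-- `θ` is a lift of the direction of `u` relative to `g`. -/
def Lf (g u : ℝ × ℝ) (θ : ℝ) : Prop :=
  (θ : Real.Angle) = (Complex.arg (⟨u.1, u.2⟩ : ℂ) : Real.Angle) - (Complex.arg (⟨g.1, g.2⟩ : ℂ) : Real.Angle)

theorem Lf_polar {g u : ℝ × ℝ} {θ : ℝ} (hg : g ≠ 0) (hu : u ≠ 0) (h : Lf g u θ) :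
    ∃ r : ℝ, 0 < r ∧ dot2 g u = r * Real.cos θ ∧ det2 g u = r * Real.sin θ := by
  unfold Lf at h
  rw [← Complex.arg_div_coe_angle (toC_ne hu) (toC_ne hg)] at h
  have hc := congrArg Real.Angle.cos h
  have hs := congrArg Real.Angle.sin h
  have hne : ((⟨u.1, u.2⟩ : ℂ) / (⟨g.1, g.2⟩ : ℂ)) ≠ 0 := div_ne_zero (toC_ne hu) (toC_ne hg)
  simp only [Real.Angle.cos_coe, Real.Angle.sin_coe] at hc hs
  rw [Complex.cos_arg hne] at hc
  rw [Complex.sin_arg] at hs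
  have n1 : 0 < ‖((⟨u.1, u.2⟩ : ℂ) / (⟨g.1, g.2⟩ : ℂ))‖ := norm_pos_iff.2 hne
  have n2 : 0 < Complex.normSq (⟨g.1, g.2⟩ : ℂ) := Complex.normSq_pos.2 (toC_ne hg)
  refine ⟨Complex.normSq (⟨g.1, g.2⟩ : ℂ) * ‖((⟨u.1, u.2⟩ : ℂ) / (⟨g.1, g.2⟩ : ℂ))‖, by positivity, ?_, ?_⟩
  · rw [hc, mul_assoc, mul_div_cancel₀ _ n1.ne', Complex.div_re]
    simp only [dot2]
    field_simp
  · rw [hs, mul_assoc, mul_div_cancel₀ _ n1.ne', Complex.div_im]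
    simp only [det2]
    field_simp

theorem toC_neg (u : ℝ × ℝ) : (⟨(-u).1, (-u).2⟩ : ℂ) = -(⟨u.1, u.2⟩ : ℂ) := by
  apply Complex.ext <;> simp

theorem arg_turn {u u' : ℝ × ℝ} (hu : u ≠ 0) (hu' : u' ≠ 0) :
    ((Real.pi - ccwAngle u' (-u) : ℝ) : Real.Angle) =
    (Complex.arg (⟨u'.1, u'.2⟩ : ℂ) : Real.Angle) - (Complex.arg (⟨u.1, u.2⟩ : ℂ) : Real.Angle) := by
  rw [Real.Angle.coe_sub, ccw_mod hu' (neg_ne_zero.2 hu), toC_neg, Complex.arg_neg_coe_angle (toC_ne hu)]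
  abel

theorem Lf_step {g u u' : ℝ × ℝ} {θ : ℝ} (hu : u ≠ 0) (hu' : u' ≠ 0) (h : Lf g u θ) :
    Lf g u' (θ + (Real.pi - ccwAngle u' (-u))) := by
  unfold Lf at h ⊢
  rw [Real.Angle.coe_add, h, arg_turn hu hu']
  abel

theorem ccw_ge_pi {g u : ℝ × ℝ} (h : det2 g u ≤ 0) : Real.pi ≤ ccwAngle g u := by
  by_contra hc
  linarith [det2_pos_of (not_le.1 hc)]


set_option linter.unusedSectionVars false
set_option linter.unusedSimpArgs false
set_option linter.unusedVariables false

section Fwd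

variable {V : Type} [Fintype V] [DecidableEq V] {G : SimpleGraph V} [DecidableRel G.Adj]
  {E : PlaneEmb G} {big : G.Dart → Prop} {p : V → ℝ × ℝ}

theorem dir_ne (hS : Stretches G E big p) (d : G.Dart) : p d.snd - p d.fst ≠ 0 :=
  sub_ne_zero.2 fun h => d.adj.ne (hS.1.1 h).symm

theorem dang (d : G.Dart) : dartAngle E p d =
    ccwAngle (p d.snd - p d.fst) (-(p (psi E d).snd - p (psi E d).fst)) := by
  unfold dartAngle
  rw [neg_sub, psi_fst, psi_snd, E.rot_fst]

open Classical in
theorem face_turn (hS : Stretches G E big p) (F : E.Face) :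
    ∃ n : ℤ, ∑ d ∈ Finset.univ.filter (fun d : G.Dart => E.angleFace d = F), (Real.pi - dartAngle E p d) =
      n * (2 * Real.pi) := by
  set T := Finset.univ.filter (fun d : G.Dart => E.angleFace d = F)
  let a : G.Dart → Real.Angle := fun d =>
    (Complex.arg (⟨(p d.snd - p d.fst).1, (p d.snd - p d.fst).2⟩ : ℂ) : Real.Angle)
  have h : ((∑ d ∈ T, (Real.pi - dartAngle E p d) : ℝ) : Real.Angle) = 0 := by
    have h1 : ((∑ d ∈ T, (Real.pi - dartAngle E p d) : ℝ) : Real.Angle) = ∑ d ∈ T, (a d - a (psi E d)) := by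
      rw [← Real.Angle.coe_coeHom, map_sum]
      apply Finset.sum_congr rfl
      intro d _
      rw [Real.Angle.coe_coeHom, dang, arg_turn (dir_ne hS _) (dir_ne hS _)]
    rw [h1, Finset.sum_sub_distrib, sub_eq_zero]
    symm
    apply Finset.sum_equiv (psi E)
    · intro d; simp [T, angleFace_psi]
    · intro d _; rfl
  rw [Real.Angle.coe_eq_zero_iff] at h
  obtain ⟨n, hn⟩ := h
  exact ⟨n, by rw [← hn]; simp⟩

open Classical in
theorem turn_bdd (hcpt : IsCPTLabelling E big) (hS : Stretches G E big p) (F : E.Face) (hF : F ≠ E.outer) :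
    ∑ d ∈ Finset.univ.filter (fun d : G.Dart => E.angleFace d = F), (Real.pi - dartAngle E p d) ≤ 2 * Real.pi := by
  obtain ⟨n, hn⟩ := face_turn hS F
  have hpi := Real.pi_pos
  have hlt : ∑ d ∈ Finset.univ.filter (fun d : G.Dart => E.angleFace d = F), (Real.pi - dartAngle E p d)
      < 3 * Real.pi := by
    rw [← Finset.sum_filter_add_sum_filter_not _ (fun d => ¬ big d), Finset.filter_filter]
    have h1 : ∑ d ∈ Finset.univ.filter (fun d : G.Dart => E.angleFace d = F ∧ ¬ big d), (Real.pi - dartAngle E p d)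
      < ∑ d ∈ Finset.univ.filter (fun d : G.Dart => E.angleFace d = F ∧ ¬ big d), Real.pi := by
      apply Finset.sum_lt_sum_of_nonempty
      · rw [← Finset.card_pos, small_card hcpt F hF]; norm_num
      · intro d _
        have := ccw_pos (p d.snd - p d.fst) (p (E.rot d).snd - p (E.rot d).fst)
        unfold dartAngle; linarith
    rw [Finset.sum_const, small_card hcpt F hF] at h1
    have h2 : ∑ d ∈ (Finset.univ.filter (fun d : G.Dart => E.angleFace d = F)).filter (fun d => ¬ ¬ big d),
        (Real.pi - dartAngle E p d) ≤ 0 := by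
      apply Finset.sum_nonpos
      intro d hd
      simp only [Finset.mem_filter, not_not] at hd
      linarith [(hS.2.2 d).1 hd.2]
    simp only [nsmul_eq_mul] at h1
    push_cast at h1
    linarith
  rw [hn] at hlt ⊢
  have : n < 2 := by
    by_contra hc
    have : (2 : ℝ) ≤ n := by exact_mod_cast not_lt.1 hc
    nlinarith
  have : (n : ℝ) ≤ 1 := by exact_mod_cast (by omega : n ≤ 1)
  nlinarith

open Classical in
theorem turn_out (hcpt : IsCPTLabelling E big) (hS : Stretches G E big p) :
    ∑ d ∈ Finset.univ.filter (fun d : G.Dart => E.angleFace d = E.outer), (Real.pi - dartAngle E p d)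
      ≤ - (2 * Real.pi) := by
  obtain ⟨n, hn⟩ := face_turn hS E.outer
  have hpi := Real.pi_pos
  have hlt : ∑ d ∈ Finset.univ.filter (fun d : G.Dart => E.angleFace d = E.outer), (Real.pi - dartAngle E p d)
      < 0 := by
    apply Finset.sum_neg
    · intro d hd
      simp only [Finset.mem_filter, Finset.mem_univ, true_and] at hd
      linarith [(hS.2.2 d).1 (hcpt.outer_big d hd)]
    · obtain ⟨d, hd⟩ := face_surj E E.outer
      exact ⟨d, by simp [hd]⟩
  rw [hn] at hlt ⊢
  have : n < 0 := by
    by_contra hc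
    have : (0 : ℝ) ≤ n := by exact_mod_cast not_lt.1 hc
    nlinarith
  have : (n : ℝ) ≤ -1 := by exact_mod_cast (by omega : n ≤ -1)
  nlinarith

open Classical in
theorem turn_eq (hcpt : IsCPTLabelling E big) (hS : Stretches G E big p) (F : E.Face) (hF : F ≠ E.outer) :
    ∑ d ∈ Finset.univ.filter (fun d : G.Dart => E.angleFace d = F), (Real.pi - dartAngle E p d) = 2 * Real.pi := by
  haveI : Fintype E.Face := Fintype.ofFinite _
  set T : E.Face → ℝ := fun F => ∑ d ∈ Finset.univ.filter (fun d : G.Dart => E.angleFace d = F),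
    (Real.pi - dartAngle E p d) with hT
  have tot : ∑ F, T F = ∑ d : G.Dart, (Real.pi - dartAngle E p d) :=
    Finset.sum_fiberwise (Finset.univ : Finset G.Dart) E.angleFace (fun d => Real.pi - dartAngle E p d)
  have hv : ∑ d : G.Dart, dartAngle E p d = Fintype.card V * (2 * Real.pi) := by
    rw [← Finset.sum_fiberwise (Finset.univ : Finset G.Dart) (fun d => d.fst) (fun d => dartAngle E p d)]
    rw [Finset.sum_congr rfl (fun v _ => hS.1.2.2 v (exists_dart_at E v))]
    simp
  have he : (Fintype.card G.Dart : ℝ) = 2 * (Nat.card G.edgeSet : ℝ) := by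
    rw [SimpleGraph.dart_card_eq_twice_card_edges, Nat.card_eq_fintype_card, ← SimpleGraph.edgeFinset_card]
    push_cast; rfl
  have heu : (Fintype.card V : ℝ) + Fintype.card E.Face = Nat.card G.edgeSet + 2 := by
    have := E.euler
    rw [Nat.card_eq_fintype_card (α := V), Nat.card_eq_fintype_card (α := Quotient _)] at this
    exact_mod_cast this
  rw [Finset.sum_sub_distrib, hv, Finset.sum_const, Finset.card_univ, nsmul_eq_mul, he] at tot
  have hle : ∀ F', T F' ≤ if F' = E.outer then - (2 * Real.pi) else 2 * Real.pi := by
    intro F'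
    split_ifs with h
    · rw [h]; exact turn_out hcpt hS
    · exact turn_bdd hcpt hS F' h
  have hs : ∑ F' : E.Face, (if F' = E.outer then - (2 * Real.pi) else 2 * Real.pi) =
      Fintype.card E.Face * (2 * Real.pi) - 4 * Real.pi := by
    have : ∀ F' : E.Face, (if F' = E.outer then - (2 * Real.pi) else 2 * Real.pi) =
      2 * Real.pi - (if F' = E.outer then 4 * Real.pi else 0) := by
      intro F'; split_ifs <;> ring
    rw [Finset.sum_congr rfl (fun F' _ => this F'), Finset.sum_sub_distrib]
    simp
  have heq : ∑ F', T F' = ∑ F' : E.Face, (if F' = E.outer then - (2 * Real.pi) else 2 * Real.pi) := by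
    rw [hs, tot]
    linear_combination (-2 * Real.pi) * heu
  have := (Finset.sum_eq_sum_iff_of_le (fun F' _ => hle F')).1 heq F (Finset.mem_univ _)
  rw [if_neg hF] at this
  exact this

end Fwd


set_option linter.unusedSectionVars false
set_option linter.unusedSimpArgs false
set_option linter.unusedVariables false

section Fwd2

variable {V : Type} [Fintype V] [DecidableEq V] {G : SimpleGraph V} [DecidableRel G.Adj]
  {E : PlaneEmb G} {big : G.Dart → Prop} {p : V → ℝ × ℝ}

theorem face_seq (E : PlaneEmb G) (d0 : G.Dart) : ∃ (N : ℕ) (D : ℕ → G.Dart), 0 < N ∧ D 0 = d0 ∧ D N = d0 ∧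
    (∀ k, psi E (D (k + 1)) = D k) ∧ (∀ k, E.angleFace (D k) = E.angleFace d0) ∧
    (∀ i j, i < N → j < N → D i = D j → i = j) ∧
    (∀ d, E.angleFace d = E.angleFace d0 → ∃ k, k < N ∧ D k = d) := by
  have hper : d0 ∈ Function.periodicPts (psi E).symm :=
    (psi E).symm.injective.mem_periodicPts d0
  refine ⟨Function.minimalPeriod (psi E).symm d0, fun k => (psi E).symm^[k] d0,
    Function.minimalPeriod_pos_of_mem_periodicPts hper, rfl, Function.iterate_minimalPeriod, ?_, ?_, ?_, ?_⟩
  · intro k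
    simp only [Function.iterate_succ_apply', Equiv.apply_symm_apply]
  · intro k
    induction k with
    | zero => rfl
    | succ k ih =>
      simp only [Function.iterate_succ_apply'] at ih ⊢
      rw [angleFace_psi_symm, ih]
  · intro i j hi hj h
    exact (Function.iterate_eq_iterate_iff_of_lt_minimalPeriod hi hj).1 h
  · intro d hd
    have hc := ((angleFace_eq_iff E d0 d).1 hd.symm)
    rw [← Equiv.Perm.sameCycle_inv] at hc
    obtain ⟨n, hn⟩ := hc.exists_nat_pow_eq
    refine ⟨n % Function.minimalPeriod (psi E).symm d0,
      Nat.mod_lt _ (Function.minimalPeriod_pos_of_mem_periodicPts hper), ?_⟩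
    simp only []
    rw [Function.iterate_mod_minimalPeriod_eq, ← hn, Equiv.Perm.coe_pow]
    rfl

theorem three_sorted {I : Finset ℕ} (h : I.card = 3) :
    ∃ a b c, a < b ∧ b < c ∧ I = {a, b, c} := by
  obtain ⟨x, y, z, hxy, hxz, hyz, rfl⟩ := Finset.card_eq_three.1 h
  rcases lt_or_gt_of_ne hxy with h1 | h1 <;> rcases lt_or_gt_of_ne hxz with h2 | h2 <;>
    rcases lt_or_gt_of_ne hyz with h3 | h3
  · exact ⟨x, y, z, h1, h3, rfl⟩
  · exact ⟨x, z, y, h2, h3, by ext; simp; tauto⟩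
  · omega
  · exact ⟨z, x, y, h2, h1, by ext; simp; tauto⟩
  · exact ⟨y, x, z, h1, h2, by ext; simp; tauto⟩
  · omega
  · exact ⟨y, z, x, h3, h2, by ext; simp; tauto⟩
  · exact ⟨z, y, x, h3, h1, by ext; simp; tauto⟩

theorem higher_face0 (hcpt : IsCPTLabelling E big) (hS : Stretches G E big p) (g : ℝ × ℝ) (hg : g ≠ 0)
    (d0 : G.Dart) (hb : big d0) (hF : E.angleFace d0 ≠ E.outer)
    (hu : det2 g (p d0.snd - p d0.fst) ≤ 0) (hv : det2 g (p (E.rot d0).snd - p d0.fst) ≤ 0) :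
    ∃ e : G.Dart, E.angleFace e = E.angleFace d0 ∧ 0 < det2 g (p e.fst - p d0.fst) := by
  classical
  have hpi := Real.pi_pos
  obtain ⟨N, D, hN, D0, DN, hpsi, hface, hinj, hsurj⟩ := face_seq E d0
  have sumF : ∀ f : G.Dart → ℝ, ∑ d ∈ Finset.univ.filter (fun d : G.Dart => E.angleFace d = E.angleFace d0), f d =
      ∑ k ∈ Finset.range N, f (D k) := by
    intro f
    symm
    apply Finset.sum_nbij D
    · intro k _; simp [hface]
    · intro i hi j hj h
      exact hinj i j (by simpa using hi) (by simpa using hj) h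
    · intro d hd
      obtain ⟨k, hk, rfl⟩ := hsurj d (by simpa using hd)
      exact ⟨k, by simpa using hk, rfl⟩
    · intro k _; rfl
  have hturn := turn_eq hcpt hS _ hF
  rw [sumF] at hturn
  have hI : ((Finset.range N).filter (fun k => ¬ big (D k))).card = 3 := by
    rw [← small_card hcpt _ hF]
    apply Finset.card_nbij D
    · intro k hk; simp at hk; simp [hface, hk.2]
    · intro i hi j hj h
      simp at hi hj
      exact hinj i j hi.1 hj.1 h
    · intro d hd
      simp at hd
      obtain ⟨k, hk, rfl⟩ := hsurj d hd.1
      exact ⟨k, by simp [hk, hd.2], rfl⟩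
  obtain ⟨i1, i2, i3, h12, h23, hI3⟩ := three_sorted hI
  have hmem : ∀ k, (k < N ∧ ¬ big (D k)) ↔ (k = i1 ∨ k = i2 ∨ k = i3) := by
    intro k
    have := Finset.ext_iff.1 hI3 k
    simpa using this
  have m1 := (hmem i1).2 (by simp)
  have m3 := (hmem i3).2 (by simp)
  have h1 : 0 < i1 := by
    rcases Nat.eq_zero_or_pos i1 with h | h
    · rw [h, D0] at m1; exact (m1.2 hb).elim
    · exact h
  let u : ℕ → ℝ × ℝ := fun k => p (D k).snd - p (D k).fst
  have hune : ∀ k, u k ≠ 0 := fun k => dir_ne hS _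
  have hfst : ∀ k, (D (k + 1)).fst = (D k).snd := by
    intro k; rw [← hpsi k, psi_snd]
  have hang : ∀ k, dartAngle E p (D (k + 1)) = ccwAngle (u (k + 1)) (-(u k)) := by
    intro k; rw [dang, hpsi]
  let a := ccwAngle g (u 0)
  let θ : ℕ → ℝ := fun k => (a - 2 * Real.pi) + ∑ j ∈ Finset.range k, (Real.pi - dartAngle E p (D (j + 1)))
  have θs : ∀ k, θ (k + 1) = θ k + (Real.pi - dartAngle E p (D (k + 1))) := by
    intro k; simp only [θ, Finset.sum_range_succ]; ring
  have hlf : ∀ k, Lf g (u k) (θ k) := by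
    intro k
    induction k with
    | zero =>
      simp only [θ, Finset.range_zero, Finset.sum_empty, add_zero]
      unfold Lf
      rw [Real.Angle.coe_sub, Real.Angle.coe_two_pi, sub_zero]
      exact ccw_mod hg (hune 0)
    | succ k ih =>
      rw [θs, hang]
      exact Lf_step (hune k) (hune _) ih
  choose r hr0 hrx hry using fun k => Lf_polar hg (hune k) (hlf k)
  -- positions
  have hpos : ∀ k, p (D k).fst - p d0.fst = ∑ j ∈ Finset.range k, u j := by
    intro k
    induction k with
    | zero => simp [D0]
    | succ k ih => rw [Finset.sum_range_succ, ← ih, hfst]; simp [u]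
  have hdet : ∀ k, det2 g (p (D k).fst - p d0.fst) = ∑ j ∈ Finset.range k, r j * Real.sin (θ j) := by
    intro k
    rw [hpos, ← Finset.sum_congr rfl (fun j _ => hry j)]
    simp only [det2, Prod.fst_sum, Prod.snd_sum, Finset.mul_sum, Finset.sum_sub_distrib]
  have hdot : ∀ k, dot2 g (p (D k).fst - p d0.fst) = ∑ j ∈ Finset.range k, r j * Real.cos (θ j) := by
    intro k
    rw [hpos, ← Finset.sum_congr rfl (fun j _ => hrx j)]
    simp only [dot2, Prod.fst_sum, Prod.snd_sum, Finset.mul_sum, Finset.sum_add_distrib]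
  refine ⟨D i2, hface _, ?_⟩
  rw [hdet]
  refine turn_core (N := N) (i1 := i1) (i3 := i3) h1 h12 h23 m3.1 (fun k _ => hr0 k) ?_ ?_ ?_ ?_ ?_ ?_
  · intro k hk n1 n2 n3
    have : big (D (k + 1)) := by
      by_contra hc
      rcases (hmem (k + 1)).1 ⟨hk, hc⟩ with h | h | h <;> contradiction
    rw [θs]
    linarith [(hS.2.2 _).1 this]
  · intro k hk
    rw [θs]
    have : 0 < dartAngle E p (D (k + 1)) := ccw_pos _ _
    linarith
  · simp only [θ, Finset.range_zero, Finset.sum_empty, add_zero]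
    have : a ≤ 2 * Real.pi := ccw_le _ _
    linarith
  · have hsum : ∑ j ∈ Finset.range (N - 1), (Real.pi - dartAngle E p (D (j + 1))) =
        2 * Real.pi - (Real.pi - dartAngle E p d0) := by
      have := Finset.sum_range_succ' (fun k => Real.pi - dartAngle E p (D k)) (N - 1)
      rw [Nat.sub_add_cancel (by omega), hturn, D0] at this
      linarith
    simp only [θ]
    rw [hsum]
    have ha : Real.pi ≤ a := by
      apply ccw_ge_pi
      simp only [u, D0]; exact hu
    have hvne : p (E.rot d0).snd - p d0.fst ≠ 0 := by
      have := dir_ne hS (E.rot d0)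
      rwa [E.rot_fst] at this
    have hb' := ccw_ge_pi hv
    have hbl := ccw_le g (p (E.rot d0).snd - p d0.fst)
    have hsp := ccw_split hg (hune 0) hvne
    have hα : dartAngle E p d0 = ccwAngle (u 0) (p (E.rot d0).snd - p d0.fst) := by
      simp only [u, D0]; unfold dartAngle; rw [E.rot_fst]
    have hbig := (hS.2.2 d0).1 hb
    rw [hα] at hbig ⊢
    rw [hsp] at hbig ⊢
    by_cases hle : ccwAngle g (p (E.rot d0).snd - p d0.fst) ≤ ccwAngle g (u 0)
    · rw [ind_true hle]; push_cast
      simp only [a]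
      linarith
    · rw [ind_false hle] at hbig; push_cast at hbig
      have : ccwAngle g (u 0) = a := rfl
      linarith
  · rw [← hdot, DN]; simp [dot2]
  · rw [← hdet, DN]; simp [det2]

theorem higher_face (hcpt : IsCPTLabelling E big) (hS : Stretches G E big p) (g : ℝ × ℝ) (hg : g ≠ 0)
    (d0 : G.Dart) (hb : big d0) (hF : E.angleFace d0 ≠ E.outer) :
    ∃ e : G.Dart, E.angleFace e = E.angleFace d0 ∧ 0 < det2 g (p e.fst - p d0.fst) := by
  by_cases hu : det2 g (p d0.snd - p d0.fst) ≤ 0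
  · by_cases hv : det2 g (p (E.rot d0).snd - p d0.fst) ≤ 0
    · exact higher_face0 hcpt hS g hg d0 hb hF hu hv
    · exact ⟨psi E d0, angleFace_psi E d0, by rw [psi_fst]; exact not_le.1 hv⟩
  · exact ⟨(psi E).symm d0, angleFace_psi_symm E d0, by rw [psi_symm_fst]; exact not_le.1 hu⟩

theorem higher_nbr (hS : Stretches G E big p) (g : ℝ × ℝ) (hg : g ≠ 0) (v : V) (hv : ¬ PointedVx big v) :
    ∃ d : G.Dart, d.fst = v ∧ 0 < det2 g (p d.snd - p v) := by
  classical
  by_contra hc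
  push Not at hc
  obtain ⟨d1, hd1⟩ := exists_dart_at E v
  obtain ⟨d, hd, hmax⟩ := Finset.exists_max_image (Finset.univ.filter (fun d : G.Dart => d.fst = v))
    (fun d => ccwAngle g (p d.snd - p v)) ⟨d1, by simp [hd1]⟩
  simp only [Finset.mem_filter, Finset.mem_univ, true_and] at hd hmax
  have hle := hmax (E.rot d) (by rw [E.rot_fst, hd])
  have hsm := (hS.2.2 d).2 (fun h => hv ⟨d, h, hd⟩)
  have n1 := dir_ne hS d
  have n2 := dir_ne hS (E.rot d)
  unfold dartAngle at hsm
  rw [E.rot_fst] at hsm n2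
  rw [hd] at hsm n1 n2
  rw [ccw_split hg n1 n2, ind_true hle] at hsm
  have b1 := ccw_ge_pi (hc (E.rot d) (by rw [E.rot_fst, hd]))
  have b2 := ccw_le g (p d.snd - p v)
  push_cast at hsm
  linarith

theorem det2_sub_right (g x y : ℝ × ℝ) : det2 g (x - y) = det2 g x - det2 g y := by
  simp [det2]; ring

theorem not_mem_edge {H : G.Subgraph} {d : G.Dart} (h : d.fst ∉ H.verts) : d.edge ∉ H.edgeSet := by
  intro hc
  exact h (H.edge_vert (show H.Adj d.fst d.snd from hc))

theorem claim_up (hcpt : IsCPTLabelling E big) (hS : Stretches G E big p) (g : ℝ × ℝ) (hg : g ≠ 0)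
    (H : G.Subgraph) (m : ℝ) (hm : ∀ y ∈ H.verts, det2 g (p y) ≤ m) (x : V) (hx : m < det2 g (p x))
    (d : G.Dart) (hd : d.fst = x) : InOuterOf E H.edgeSet (E.angleFace d) := by
  classical
  by_contra hcon
  obtain ⟨z, hz, hmax⟩ := Finset.exists_max_image (Finset.univ.filter (fun z : V => m < det2 g (p z) ∧
    ∃ d : G.Dart, d.fst = z ∧ ¬ InOuterOf E H.edgeSet (E.angleFace d))) (fun z => det2 g (p z))
    ⟨x, by simp only [Finset.mem_filter, Finset.mem_univ, true_and]; exact ⟨hx, d, hd, hcon⟩⟩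
  simp only [Finset.mem_filter, Finset.mem_univ, true_and] at hz hmax
  obtain ⟨hzm, d1, hd1, hno⟩ := hz
  have hzH : z ∉ H.verts := fun h => by linarith [hm z h]
  have hnone : ∀ e : G.Dart, e.fst = z → ¬ InOuterOf E H.edgeSet (E.angleFace e) := by
    intro e he hin
    apply hno
    have := rot_pow_mem (E := E) {e : G.Dart | e.fst = z ∧ InOuterOf E H.edgeSet (E.angleFace e)} ?_ e d1 ⟨he, hin⟩
      (he.trans hd1.symm)
    · exact this.2
    · rintro e ⟨he, hin⟩
      have hf : (E.rot e).fst = z := by rw [E.rot_fst, he]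
      refine ⟨hf, Relation.ReflTransGen.head ⟨(E.rot e).symm, rfl, ?_, ?_⟩ hin⟩
      · rw [dartFace_symm]; exact angleFace_rot_symm E e
      · rw [SimpleGraph.Dart.edge_symm]
        exact not_mem_edge (by rw [hf]; exact hzH)
  have hhigh : ∀ e : G.Dart, det2 g (p z) < det2 g (p e.fst) → InOuterOf E H.edgeSet (E.angleFace e) := by
    intro e he
    by_contra hc
    have := hmax e.fst ⟨by linarith, e, rfl, hc⟩
    linarith
  by_cases hp : PointedVx big z
  · obtain ⟨e, heb, hez⟩ := hp
    by_cases ho : E.angleFace e = E.outer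
    · exact hnone e hez (by rw [ho]; exact Relation.ReflTransGen.refl)
    · obtain ⟨e', h1, h2⟩ := higher_face hcpt hS g hg e heb ho
      rw [det2_sub_right, hez] at h2
      exact hnone e hez (by rw [← h1]; exact hhigh e' (by linarith))
  · obtain ⟨e, he, h2⟩ := higher_nbr hS g hg z hp
    rw [det2_sub_right] at h2
    have := hhigh ((psi E).symm e) (by rw [psi_symm_fst]; linarith)
    rw [angleFace_psi_symm] at this
    exact hnone e he this

theorem max_corner (hcpt : IsCPTLabelling E big) (hS : Stretches G E big p) (g : ℝ × ℝ) (hg : g ≠ 0)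
    (H : G.Subgraph) (v : V) (hv : v ∈ H.verts) (hm : ∀ y ∈ H.verts, det2 g (p y) ≤ det2 g (p v)) :
    IsCPTCorner E big H v := by
  have hup := claim_up hcpt hS g hg H _ hm
  by_cases hp : PointedVx big v
  · obtain ⟨e, heb, hev⟩ := hp
    refine Or.inl ⟨hv, e, heb, hev, ?_⟩
    by_cases ho : E.angleFace e = E.outer
    · rw [ho]; exact Relation.ReflTransGen.refl
    · obtain ⟨e', h1, h2⟩ := higher_face hcpt hS g hg e heb ho
      rw [det2_sub_right, hev] at h2
      rw [← h1]
      exact hup _ (by linarith) e' rfl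
  · obtain ⟨e, he, h2⟩ := higher_nbr hS g hg v hp
    rw [det2_sub_right] at h2
    refine Or.inr ⟨hv, hp, E.rot.symm e, by rw [rot_symm_fst, he], ?_, ?_, ?_⟩
    · have := angleFace_rot_symm E (E.rot.symm e)
      rw [Equiv.apply_symm_apply] at this
      rw [← this]
      exact hup e.snd (by linarith) _ rfl
    · rw [Equiv.apply_symm_apply, ← angleFace_psi_symm]
      exact hup e.snd (by linarith) _ (psi_symm_fst E e)
    · rw [Equiv.apply_symm_apply, ← SimpleGraph.Dart.edge_symm]
      apply not_mem_edge
      intro hc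
      have := hm e.snd hc
      linarith

theorem fwd_dir (hcpt : IsCPTLabelling E big) (hS : Stretches G E big p) (H : G.Subgraph)
    (hH : 3 ≤ Nat.card H.verts) : 3 ≤ Nat.card {v : V | IsCPTCorner E big H v} := by
  classical
  set K : Finset V := Finset.univ.filter (fun v => v ∈ H.verts) with hK
  have mK : ∀ v, v ∈ K ↔ v ∈ H.verts := fun v => by simp [hK]
  have hKc : 2 < K.card := by
    have : Nat.card H.verts = K.card := by
      rw [Nat.card_eq_fintype_card, Fintype.card_subtype]
    omega
  obtain ⟨a, ha, b, hb, c, hc, hab, hac, hbc⟩ := Finset.two_lt_card.1 hKc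
  have ext : ∀ g : ℝ × ℝ, g ≠ 0 → ∃ v, IsCPTCorner E big H v ∧ ∀ y ∈ K, det2 g (p y) ≤ det2 g (p v) := by
    intro g hg
    obtain ⟨v, hv, hm⟩ := Finset.exists_max_image K (fun v => det2 g (p v)) ⟨a, ha⟩
    exact ⟨v, max_corner hcpt hS g hg H v ((mK v).1 hv) (fun y hy => hm y ((mK y).2 hy)), hm⟩
  set z := p b - p a with hz
  have hzne : z ≠ 0 := sub_ne_zero.2 fun h => hab (hS.1.1 h).symm
  have hzpos : 0 < z.2 * z.2 + z.1 * z.1 := by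
    by_contra hcon
    have h1 : z.1 = 0 := by nlinarith [mul_self_nonneg z.1, mul_self_nonneg z.2]
    have h2 : z.2 = 0 := by nlinarith [mul_self_nonneg z.1, mul_self_nonneg z.2]
    exact hzne (Prod.ext h1 h2)
  have hg0 : ((z.2, -z.1) : ℝ × ℝ) ≠ 0 := by
    intro h
    have h1 := congrArg Prod.fst h
    have h2 := congrArg Prod.snd h
    simp only [Prod.fst_zero, Prod.snd_zero, neg_eq_zero] at h1 h2
    exact hzne (Prod.ext h2 h1)
  obtain ⟨v1, c1, e1⟩ := ext _ hg0
  obtain ⟨v2, c2, e2⟩ := ext _ (neg_ne_zero.2 hg0)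
  have hneg : ∀ g x : ℝ × ℝ, det2 (-g) x = - det2 g x := by
    intro g x; simp [det2]; ring
  have hv12 : v1 ≠ v2 := by
    rintro rfl
    have i1 := e1 b hb
    have i2 := e2 a ha
    rw [hneg, hneg] at i2
    have : det2 (z.2, -z.1) (p b) - det2 (z.2, -z.1) (p a) = z.2 * z.2 + z.1 * z.1 := by
      rw [← det2_sub_right, ← hz]; simp [det2]
    linarith
  have hw : ∃ w ∈ K, w ≠ v1 ∧ w ≠ v2 := by
    by_contra hcon
    push Not at hcon
    have ha' := hcon a ha
    have hb' := hcon b hb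
    have hc' := hcon c hc
    by_cases x1 : a = v1
    · have y1 : b = v2 := hb' (fun h => hab (x1.trans h.symm))
      have y2 : c = v2 := hc' (fun h => hac (x1.trans h.symm))
      exact hbc (y1.trans y2.symm)
    · have y0 := ha' x1
      by_cases x2 : b = v1
      · exact hac (y0.trans (hc' (fun h => hbc (x2.trans h.symm))).symm)
      · exact hab (y0.trans (hb' x2).symm)
  obtain ⟨w, hwK, hw1, hw2⟩ := hw
  have hdet : det3 (p v1) (p v2) (p w) ≠ 0 := fun h =>
    hS.2.1 v1 v2 w hv12 hw1.symm hw2.symm (det3_collinear h)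
  have h3 : ∃ v3, IsCPTCorner E big H v3 ∧ v3 ≠ v1 ∧ v3 ≠ v2 := by
    have hne : p v2 - p v1 ≠ 0 := sub_ne_zero.2 fun h => hv12 (hS.1.1 h).symm
    have hself : det2 (p v2 - p v1) (p v2) = det2 (p v2 - p v1) (p v1) := by
      simp [det2]; ring
    have hww : det2 (p v2 - p v1) (p w) - det2 (p v2 - p v1) (p v1) = det3 (p v1) (p v2) (p w) := by
      rw [← det2_sub_right, det2_sub]
    rcases lt_or_gt_of_ne hdet with h | h
    · obtain ⟨v3, c3, e3⟩ := ext _ (neg_ne_zero.2 hne)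
      have := e3 w hwK
      rw [hneg, hneg] at this
      refine ⟨v3, c3, ?_, ?_⟩ <;> rintro rfl <;> linarith
    · obtain ⟨v3, c3, e3⟩ := ext _ hne
      have := e3 w hwK
      refine ⟨v3, c3, ?_, ?_⟩ <;> rintro rfl <;> linarith
  obtain ⟨v3, c3, h31, h32⟩ := h3
  have hcard : ({v1, v2, v3} : Finset V).card = 3 :=
    Finset.card_eq_three.2 ⟨v1, v2, v3, hv12, h31.symm, h32.symm, rfl⟩
  have hC : Nat.card {v : V | IsCPTCorner E big H v} =
      (Finset.univ.filter (fun v => IsCPTCorner E big H v)).card := by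
    rw [Nat.card_eq_fintype_card, Fintype.card_subtype]
    rfl
  rw [hC, ← hcard]
  apply Finset.card_le_card
  intro v hv
  simp only [Finset.mem_insert, Finset.mem_singleton] at hv
  rcases hv with rfl | rfl | rfl <;> simp [*]

end Fwd2

/-- **Theorem 6** (part of Theorem 7 of Haas et al.).  For a combinatorial
pseudo-triangulation `G` with non-degenerate faces, the following are equivalent:
(i) `G` can be stretched to a pseudo-triangulation with the given assignment of angles;
(ii) every subgraph of `G` with at least three vertices has at least three corners. -/
theorem cpt_stretchable_iff_three_corners
    {V : Type} [Fintype V] [DecidableEq V] (G : SimpleGraph V) [DecidableRel G.Adj]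
    (E : PlaneEmb G) (big : G.Dart → Prop) (hcpt : IsCPTLabelling E big)
    (hnd : NonDegenerateFaces E) :
    (∃ p : V → ℝ × ℝ, Stretches G E big p) ↔
      ∀ H : G.Subgraph, 3 ≤ Nat.card H.verts →
        3 ≤ Nat.card {v : V | IsCPTCorner E big H v} := by
  constructor
  · rintro ⟨p, hS⟩ H hH
    exact fwd_dir hcpt hS H hH
  · intro hH
    exact rev_dir hcpt hnd hH
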